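/- Fix s > 1. Then there exist constants c > 0 and σ > 0 such that for every sufficiently large K > 1 there exist a Fourier-side solution a of the cubic defocusing NLS (the case v ≡ 0), defined for all t ∈ ℝ and with ‖a(t)‖_{H^s} < ∞ for all t and ‖a(0)‖_{H^s} > 0, and a time T with 0 < T ≤ K^c, such that ‖a(T)‖_{H^s} ≥ K·‖a(0)‖_{H^s} and ‖a(0)‖_{L²} ≤ K^{−σ}. -/

import Mathlib

noncomputable section

open scoped BigOperators

/-- We identify the two-torus side with the Fourier side: modes are indexed by `ℤ × ℤ`. -/
abbrev Z2 := ℤ × ℤ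

/-- The squared Euclidean norm `|n|²` of a mode `n ∈ ℤ²`, as a real number. -/
def nsq (n : Z2) : ℝ := (n.1 : ℝ) ^ 2 + (n.2 : ℝ) ^ 2

/-- Triples of modes. -/
abbrev Triple := Z2 × Z2 × Z2

/-- The cubic nonlinearity term `a_{n₁} ⋅ conj(a_{n₂}) ⋅ a_{n₃}` attached to a triple. -/
def cubicTerm (a : Z2 → ℂ) (p : Triple) : ℂ :=
  a p.1 * (starRingEnd ℂ) (a p.2.1) * a p.2.2

/-- A Fourier-side solution of the cubic defocusing NLS with convolution potential `V`,
whose (real) Fourier coefficients are `v`: for every `n` and `t`, the sum over triples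
`n₁ - n₂ + n₃ = n` converges absolutely, `a_n` is differentiable in `t`, and
`-i a_n'(t) = (|n|² + v_n) a_n(t) + ∑_{n₁-n₂+n₃=n} a_{n₁} conj(a_{n₂}) a_{n₃}`. -/
def IsSolutionV (v : Z2 → ℝ) (a : ℝ → Z2 → ℂ) : Prop :=
  ∀ (n : Z2) (t : ℝ),
    Summable (fun p : {p : Triple // p.1 - p.2.1 + p.2.2 = n} => ‖cubicTerm (a t) p.1‖) ∧
    ∃ d : ℂ, HasDerivAt (fun τ : ℝ => a τ n) d t ∧
      -Complex.I * d =
        ((nsq n + v n : ℝ) : ℂ) * a t n +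
          ∑' p : {p : Triple // p.1 - p.2.1 + p.2.2 = n}, cubicTerm (a t) p.1

/-- The square of the `H^s` Sobolev norm `∑ (1+|n|²)^s |a_n|²`. -/
def HsNormSq (s : ℝ) (a : Z2 → ℂ) : ℝ := ∑' n : Z2, (1 + nsq n) ^ s * ‖a n‖ ^ 2

/-- Finiteness of the `H^s` norm. -/
def HsFinite (s : ℝ) (a : Z2 → ℂ) : Prop :=
  Summable fun n : Z2 => (1 + nsq n) ^ s * ‖a n‖ ^ 2

/-- The `H^s` Sobolev norm. -/
def HsNorm (s : ℝ) (a : Z2 → ℂ) : ℝ := HsNormSq s a ^ (1 / 2 : ℝ)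

/-- The `L²` (mass) norm. -/
def L2Norm (a : Z2 → ℂ) : ℝ := (∑' n : Z2, ‖a n‖ ^ 2) ^ (1 / 2 : ℝ)

open Set Filter Topology Metric

section GlobalODE

variable {E : Type*} [NormedAddCommGroup E] [NormedSpace ℝ E]

/-- A radial cutoff, equal to `1` on the ball of radius `R` and to `0` outside the ball of
radius `R + 1`. -/
def radialCutoff (R : ℝ) (x : E) : ℝ := max 0 (min 1 (R + 1 - ‖x‖))

lemma radialCutoff_nonneg (R : ℝ) (x : E) : 0 ≤ radialCutoff R x := le_max_left _ _

lemma radialCutoff_le_one (R : ℝ) (x : E) : radialCutoff R x ≤ 1 :=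
  max_le zero_le_one (min_le_left _ _)

lemma radialCutoff_eq_one {R : ℝ} {x : E} (hx : ‖x‖ ≤ R) : radialCutoff R x = 1 := by
  rw [radialCutoff, min_eq_left (by linarith), max_eq_right zero_le_one]

lemma radialCutoff_eq_zero {R : ℝ} {x : E} (hx : R + 1 ≤ ‖x‖) : radialCutoff R x = 0 :=
  max_eq_left ((min_le_right _ _).trans (by linarith))

lemma abs_radialCutoff_sub_le (R : ℝ) (x y : E) :
    |radialCutoff R x - radialCutoff R y| ≤ ‖x - y‖ := by
  have h1 := abs_norm_sub_norm_le x y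
  rw [abs_le] at h1 ⊢
  unfold radialCutoff
  constructor
  all_goals
    rcases max_cases 0 (min 1 (R + 1 - ‖x‖)) with h | h <;>
    rcases max_cases 0 (min 1 (R + 1 - ‖y‖)) with h' | h' <;>
    rcases min_cases 1 (R + 1 - ‖x‖) with h2 | h2 <;>
    rcases min_cases 1 (R + 1 - ‖y‖) with h2' | h2' <;> linarith [norm_nonneg (x - y)]

lemma norm_radialCutoff_smul_le {R L : ℝ} {f : E → E} (hL : ∀ x, ‖x‖ ≤ R + 1 → ‖f x‖ ≤ L)
    (hL0 : 0 ≤ L) (x : E) : ‖radialCutoff R x • f x‖ ≤ L := by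
  rcases le_total ‖x‖ (R + 1) with h | h
  · rw [norm_smul, Real.norm_of_nonneg (radialCutoff_nonneg R x)]
    exact (mul_le_mul (radialCutoff_le_one R x) (hL x h) (norm_nonneg _) zero_le_one).trans
      (one_mul L).le
  · rw [radialCutoff_eq_zero h, zero_smul, norm_zero]; exact hL0

lemma norm_radialCutoff_smul_sub_le {R L K : ℝ} {f : E → E}
    (hL : ∀ x, ‖x‖ ≤ R + 1 → ‖f x‖ ≤ L) (hL0 : 0 ≤ L) (hK0 : 0 ≤ K)
    (hK : ∀ x y, ‖x‖ ≤ R + 1 → ‖y‖ ≤ R + 1 → ‖f x - f y‖ ≤ K * ‖x - y‖) (x y : E) :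
    ‖radialCutoff R x • f x - radialCutoff R y • f y‖ ≤ (L + K) * ‖x - y‖ := by
  have hKn : 0 ≤ K * ‖x - y‖ := by positivity
  have key : ∀ x y : E, ‖x‖ ≤ R + 1 →
      |radialCutoff R x - radialCutoff R y| * ‖f x‖ ≤ L * ‖x - y‖ := by
    intro x y h
    rw [mul_comm L]
    exact mul_le_mul (abs_radialCutoff_sub_le R x y) (hL x h) (norm_nonneg _) (norm_nonneg _)
  rcases le_total ‖x‖ (R + 1) with h | h <;> rcases le_total ‖y‖ (R + 1) with h' | h'
  · have e : radialCutoff R x • f x - radialCutoff R y • f y =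
        (radialCutoff R x - radialCutoff R y) • f x + radialCutoff R y • (f x - f y) := by
      module
    rw [e]
    refine (norm_add_le _ _).trans ?_
    rw [norm_smul, norm_smul, Real.norm_eq_abs, Real.norm_of_nonneg (radialCutoff_nonneg R y),
      add_mul]
    refine add_le_add (key x y h) ?_
    calc radialCutoff R y * ‖f x - f y‖ ≤ 1 * (K * ‖x - y‖) :=
          mul_le_mul (radialCutoff_le_one R y) (hK x y h h') (norm_nonneg _) zero_le_one
      _ = _ := one_mul _
  · have := key x y h
    rw [radialCutoff_eq_zero h', sub_zero, abs_of_nonneg (radialCutoff_nonneg R x)] at this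
    rw [radialCutoff_eq_zero h', zero_smul, sub_zero, norm_smul,
      Real.norm_of_nonneg (radialCutoff_nonneg R x)]
    linarith
  · have := key y x h'
    rw [radialCutoff_eq_zero h, sub_zero, abs_of_nonneg (radialCutoff_nonneg R y),
      norm_sub_rev] at this
    rw [radialCutoff_eq_zero h, zero_smul, zero_sub, norm_neg, norm_smul,
      Real.norm_of_nonneg (radialCutoff_nonneg R y)]
    linarith
  · rw [radialCutoff_eq_zero h, radialCutoff_eq_zero h']
    simp only [zero_smul, sub_zero, norm_zero]
    positivity

variable [CompleteSpace E]

/-- A bounded, globally Lipschitz vector field has solutions on arbitrarily long intervals. -/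
lemma exists_solution_of_bounded_lipschitz {f : ℝ → E → E} {L K : ℝ} (hL0 : 0 ≤ L) (hK0 : 0 ≤ K)
    (hL : ∀ t x, ‖f t x‖ ≤ L) (hK : ∀ t x y, ‖f t x - f t y‖ ≤ K * ‖x - y‖)
    (hc : ∀ x, Continuous fun t => f t x) (x₀ : E) {T : ℝ} (hT : 0 < T) :
    ∃ α : ℝ → E, α 0 = x₀ ∧ ∀ t ∈ Ioo (-T) T, HasDerivAt α (f t (α t)) t := by
  have h0 : (0 : ℝ) ∈ Icc (-T) T := ⟨by linarith, hT.le⟩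
  have hp : IsPicardLindelof f (⟨0, h0⟩ : Icc (-T) T) x₀ ⟨L * T, by positivity⟩ 0 ⟨L, hL0⟩
      ⟨K, hK0⟩ := by
    refine ⟨fun t _ => ?_, fun x _ => (hc x).continuousOn, fun t _ x _ => hL t x, ?_⟩
    · refine LipschitzOnWith.of_dist_le_mul fun x _ y _ => ?_
      rw [dist_eq_norm, dist_eq_norm]
      exact hK t x y
    · simp only [NNReal.coe_mk, sub_zero, zero_sub, neg_neg, max_self, NNReal.coe_zero]
      exact le_refl _
  obtain ⟨α, h1, h2⟩ := hp.exists_eq_forall_mem_Icc_hasDerivWithinAt₀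
  exact ⟨α, h1, fun t ht => (h2 t (Ioo_subset_Icc_self ht)).hasDerivAt (Icc_mem_nhds ht.1 ht.2)⟩

/-- An a priori bound yields a solution on a given symmetric interval. -/
lemma exists_solution_of_apriori {f : ℝ → E → E}
    (hL : ∀ R, ∃ L, ∀ t x, ‖x‖ ≤ R → ‖f t x‖ ≤ L)
    (hK : ∀ R, ∃ K, ∀ t x y, ‖x‖ ≤ R → ‖y‖ ≤ R → ‖f t x - f t y‖ ≤ K * ‖x - y‖)
    (hc : ∀ x, Continuous fun t => f t x) {x₀ : E} {T r : ℝ} (hT : 0 < T)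
    (hap : ∀ T' ∈ Ioc 0 T, ∀ α : ℝ → E, α 0 = x₀ →
      (∀ t ∈ Ioo (-T') T', HasDerivAt α (f t (α t)) t) → ∀ t ∈ Ioo (-T') T', ‖α t‖ ≤ r)
    (hx₀ : ‖x₀‖ ≤ r) :
    ∃ α : ℝ → E, α 0 = x₀ ∧ ∀ t ∈ Ioo (-T) T, HasDerivAt α (f t (α t)) t ∧ ‖α t‖ ≤ r := by
  obtain ⟨L, hL⟩ := hL (r + 1 + 1)
  obtain ⟨K, hK⟩ := hK (r + 1 + 1)
  have hL' : ∀ t x, ‖x‖ ≤ r + 1 + 1 → ‖f t x‖ ≤ |L| := fun t x hx =>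
    (hL t x hx).trans (le_abs_self L)
  have hK' : ∀ t x y, ‖x‖ ≤ r + 1 + 1 → ‖y‖ ≤ r + 1 + 1 →
      ‖f t x - f t y‖ ≤ |K| * ‖x - y‖ := fun t x y hx hy =>
    (hK t x y hx hy).trans (mul_le_mul_of_nonneg_right (le_abs_self K) (norm_nonneg _))
  obtain ⟨α, h0, hα⟩ := exists_solution_of_bounded_lipschitz
    (f := fun t x => radialCutoff (r + 1) x • f t x) (L := |L|) (K := |L| + |K|)
    (abs_nonneg _) (by positivity)
    (fun t x => norm_radialCutoff_smul_le (hL' t) (abs_nonneg _) x)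
    (fun t x y => norm_radialCutoff_smul_sub_le (hL' t) (abs_nonneg _) (abs_nonneg _) (hK' t) x y)
    (fun x => (hc x).const_smul _) x₀ (T := 2 * T) (by linarith)
  have hcont : ∀ t, |t| ≤ T → ContinuousAt α t := fun t ht =>
    (hα t ⟨by linarith [(abs_le.1 ht).1], by linarith [(abs_le.1 ht).2]⟩).continuousAt
  have hsol : ∀ t, |t| ≤ T → ‖α t‖ ≤ r + 1 → HasDerivAt α (f t (α t)) t := by
    intro t ht hb
    have := hα t ⟨by linarith [(abs_le.1 ht).1], by linarith [(abs_le.1 ht).2]⟩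
    simpa only [radialCutoff_eq_one hb, one_smul] using this
  have key : Icc 0 T ⊆ {τ | ∀ u ∈ Icc (-1 : ℝ) 1, ‖α (u * τ)‖ ≤ r} := by
    refine IsClosed.Icc_subset_of_forall_exists_gt ?_ (by simp [h0, hx₀]) ?_
    · have e : {τ | ∀ u ∈ Icc (-1 : ℝ) 1, ‖α (u * τ)‖ ≤ r} ∩ Icc 0 T =
          ⋂ u : Icc (-1 : ℝ) 1, (Icc 0 T ∩ (fun τ => ‖α (u * τ)‖) ⁻¹' Iic r) := by
        ext τ
        simp only [mem_inter_iff, mem_setOf_eq, mem_iInter, mem_preimage, mem_Iic, Subtype.forall]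
        exact ⟨fun h u hu => ⟨h.2, h.1 u hu⟩, fun h =>
          ⟨fun u hu => (h u hu).2, (h 0 ⟨by norm_num, by norm_num⟩).1⟩⟩
      rw [e]
      refine isClosed_iInter fun u => ContinuousOn.preimage_isClosed_of_isClosed ?_ isClosed_Icc
        isClosed_Iic
      intro τ hτ
      have hu : |(u : ℝ) * τ| ≤ T := by
        rw [abs_mul, abs_of_nonneg hτ.1]
        have := abs_le.2 u.2
        nlinarith [hτ.1, hτ.2, abs_nonneg (u : ℝ)]
      exact ((hcont _ hu).comp (f := fun τ => (u : ℝ) * τ)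
        (by fun_prop)).norm.continuousWithinAt
    · rintro τ ⟨hτ, hτ0, hτT⟩ y hy
      have hin : ∀ t, |t| ≤ τ → ‖α t‖ ≤ r := by
        intro t ht
        rcases hτ0.eq_or_lt with h | h
        · have : t = 0 := abs_nonpos_iff.1 (h ▸ ht)
          rw [this, h0]; exact hx₀
        · have := hτ (t / τ) (by
            rw [mem_Icc, ← abs_le, abs_div, abs_of_pos h]; exact (div_le_one h).2 ht)
          rwa [div_mul_cancel₀ _ h.ne'] at this
      have hτabs : |τ| = τ := abs_of_nonneg hτ0
      have e1 : ∀ᶠ u in 𝓝 τ, ‖α u‖ < r + 1 :=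
        (hcont τ (by linarith)).norm.eventually_lt_const (by linarith [hin τ hτabs.le])
      have e2 : ∀ᶠ u in 𝓝 τ, ‖α (-u)‖ < r + 1 := by
        have hn : |(-τ)| ≤ τ := by rw [abs_neg]; exact hτabs.le
        exact ((hcont (-τ) (by linarith)).comp (f := fun u : ℝ => -u)
          (by fun_prop)).norm.eventually_lt_const (by
            show ‖α (-τ)‖ < r + 1
            linarith [hin (-τ) hn])
      obtain ⟨ε, hε, hball⟩ := Metric.eventually_nhds_iff.1 (e1.and e2)
      set T' := min (τ + ε) T with hT'
      have hτT' : τ < T' := lt_min (by linarith) hτT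
      have hT'T : T' ≤ T := min_le_right _ _
      have hT'ε : T' ≤ τ + ε := min_le_left _ _
      have hlt : ∀ t ∈ Ioo (-T') T', ‖α t‖ ≤ r + 1 := by
        intro t ht
        rcases le_total |t| τ with h | h
        · linarith [hin t h]
        · have ht' := abs_lt.2 ht
          rcases abs_choice t with hc | hc
          · have := (hball (y := t) (by rw [Real.dist_eq, abs_lt]; constructor <;> linarith)).1
            exact this.le
          · have := (hball (y := -t) (by rw [Real.dist_eq, abs_lt]; constructor <;> linarith)).2
            rw [neg_neg] at this
            exact this.le
      have hr := hap T' ⟨by linarith, hT'T⟩ α h0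
        (fun t ht => hsol t ((abs_lt.2 ht).le.trans hT'T) (hlt t ht))
      have hyτ : τ < y := hy
      refine ⟨min y ((τ + T') / 2), fun u hu => hr _ (abs_lt.1 ?_), lt_min hyτ (by linarith),
        min_le_left _ _⟩
      have hpos : 0 ≤ min y ((τ + T') / 2) := le_min (by linarith) (by linarith)
      rw [abs_mul, abs_of_nonneg hpos]
      have h1 := abs_le.2 hu
      have h2 : min y ((τ + T') / 2) < T' := (min_le_right _ _).trans_lt (by linarith)
      nlinarith [abs_nonneg u]
  have hb : ∀ t, |t| < T → ‖α t‖ ≤ r := fun t ht => by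
    have := key ⟨hT.le, le_refl T⟩ (t / T) (by
      rw [mem_Icc, ← abs_le, abs_div, abs_of_pos hT]; exact (div_le_one hT).2 ht.le)
    rwa [div_mul_cancel₀ _ hT.ne'] at this
  refine ⟨α, h0, fun t ht => ?_⟩
  have ht' : |t| < T := abs_lt.2 ht
  exact ⟨hsol t ht'.le ((hb t ht').trans (by linarith)), hb t ht'⟩

/-- Global existence from a priori bounds. -/
theorem exists_global_solution_of_apriori {f : ℝ → E → E}
    (hL : ∀ R, ∃ L, ∀ t x, ‖x‖ ≤ R → ‖f t x‖ ≤ L)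
    (hK : ∀ R, ∃ K, ∀ t x y, ‖x‖ ≤ R → ‖y‖ ≤ R → ‖f t x - f t y‖ ≤ K * ‖x - y‖)
    (hc : ∀ x, Continuous fun t => f t x) (x₀ : E)
    (hap : ∀ T > 0, ∃ r, ∀ T' ∈ Ioc 0 T, ∀ α : ℝ → E, α 0 = x₀ →
      (∀ t ∈ Ioo (-T') T', HasDerivAt α (f t (α t)) t) → ∀ t ∈ Ioo (-T') T', ‖α t‖ ≤ r) :
    ∃ α : ℝ → E, α 0 = x₀ ∧ ∀ t, HasDerivAt α (f t (α t)) t := by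
  have hex : ∀ n : ℕ, ∃ α : ℝ → E, α 0 = x₀ ∧ ∃ r, ∀ t ∈ Ioo (-((n : ℝ) + 1)) ((n : ℝ) + 1),
      HasDerivAt α (f t (α t)) t ∧ ‖α t‖ ≤ r := by
    intro n
    have hn : 0 < (n : ℝ) + 1 := by positivity
    obtain ⟨r, hr⟩ := hap (n + 1) hn
    obtain ⟨α, h1, h2⟩ := exists_solution_of_apriori hL hK hc hn (r := max r ‖x₀‖)
      (fun T' hT' α h0 hα t ht => (hr T' hT' α h0 hα t ht).trans (le_max_left _ _))
      (le_max_right _ _)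
    exact ⟨α, h1, _, h2⟩
  choose α h0 r hα using hex
  have hagree : ∀ m n : ℕ, m ≤ n → EqOn (α m) (α n) (Ioo (-((m : ℝ) + 1)) ((m : ℝ) + 1)) := by
    intro m n hmn
    have hmn' : (m : ℝ) ≤ n := by exact_mod_cast hmn
    obtain ⟨K, hK⟩ := hK (max (r m) (r n))
    refine ODE_solution_unique_of_mem_Ioo (v := f) (K := ⟨|K|, abs_nonneg K⟩)
      (s := fun _ => closedBall 0 (max (r m) (r n))) (t₀ := 0) ?_ ?_ ?_ ?_ ?_
    · intro t _
      refine LipschitzOnWith.of_dist_le_mul fun x hx y hy => ?_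
      rw [mem_closedBall_zero_iff] at hx hy
      rw [dist_eq_norm, dist_eq_norm]
      exact (hK t x y hx hy).trans (mul_le_mul_of_nonneg_right (le_abs_self K) (norm_nonneg _))
    · have : (0 : ℝ) < m + 1 := by positivity
      exact ⟨by linarith, this⟩
    · intro t ht
      exact ⟨(hα m t ht).1, by
        rw [mem_closedBall_zero_iff]; exact (hα m t ht).2.trans (le_max_left _ _)⟩
    · intro t ht
      have ht' : t ∈ Ioo (-((n : ℝ) + 1)) ((n : ℝ) + 1) :=
        ⟨by linarith [ht.1], by linarith [ht.2]⟩
      exact ⟨(hα n t ht').1, by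
        rw [mem_closedBall_zero_iff]; exact (hα n t ht').2.trans (le_max_right _ _)⟩
    · rw [h0, h0]
  refine ⟨fun t => α ⌈|t|⌉₊ t, by simp [h0], fun t => ?_⟩
  set n := ⌈|t|⌉₊ + 1 with hn
  have hlt : ∀ t : ℝ, t ∈ Ioo (-((⌈|t|⌉₊ : ℝ) + 1)) ((⌈|t|⌉₊ : ℝ) + 1) := fun t => by
    have := Nat.le_ceil |t|
    exact abs_lt.1 (by linarith)
  have hev : (fun t => α ⌈|t|⌉₊ t) =ᶠ[𝓝 t] α n := by
    have : ∀ᶠ u : ℝ in 𝓝 t, |u| < (n : ℝ) := by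
      refine (continuous_abs.tendsto t).eventually_lt_const ?_
      have := Nat.le_ceil |t|
      rw [hn]; push_cast; linarith
    filter_upwards [this] with u hu
    exact hagree _ _ (Nat.ceil_le.2 hu.le) (hlt u)
  have hd := (hα n t ⟨by have := (hlt t).1; rw [hn]; push_cast; linarith,
    by have := (hlt t).2; rw [hn]; push_cast; linarith⟩).1
  have he : α ⌈|t|⌉₊ t = α n t := hev.eq_of_nhds
  simp only [he]
  exact hd.congr_of_eventuallyEq hev

end GlobalODE

/-- A positive solution of the Volterra lattice on the sites `1, …, N`, extended by zero. -/
structure IsVolterraFlow (N : ℕ) (X : ℕ → ℝ → ℝ) : Prop where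
  zero_left : ∀ t, X 0 t = 0
  zero_right : ∀ k t, N < k → X k t = 0
  pos : ∀ k t, 1 ≤ k → k ≤ N → 0 < X k t
  hasDerivAt : ∀ k t, HasDerivAt (X (k + 1)) (4 * X (k + 1) t * (X k t - X (k + 2) t)) t

/-- The Volterra variables attached to their logarithms. -/
def volterraVar {N : ℕ} (Y : Fin N → ℝ) (k : ℕ) : ℝ :=
  if h : 1 ≤ k ∧ k ≤ N then Real.exp (Y ⟨k - 1, by omega⟩) else 0

lemma volterraVar_succ {N : ℕ} (Y : Fin N → ℝ) (i : Fin N) :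
    volterraVar Y (i + 1) = Real.exp (Y i) := by
  have : 1 ≤ (i : ℕ) + 1 ∧ (i : ℕ) + 1 ≤ N := ⟨by omega, i.2⟩
  simp [volterraVar, this]

lemma volterraVar_nonneg {N : ℕ} (Y : Fin N → ℝ) (k : ℕ) : 0 ≤ volterraVar Y k := by
  unfold volterraVar
  split_ifs
  · positivity
  · exact le_refl _

lemma contDiff_volterraVar {N : ℕ} (k : ℕ) :
    ContDiff ℝ 1 (fun Y : Fin N → ℝ => volterraVar Y k) := by
  unfold volterraVar
  split_ifs
  · fun_prop
  · exact contDiff_const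

/-- The vector field of the Volterra lattice in logarithmic variables. -/
def volterraField {N : ℕ} (Y : Fin N → ℝ) (i : Fin N) : ℝ :=
  4 * (volterraVar Y i - volterraVar Y (i + 2))

lemma contDiff_volterraField {N : ℕ} : ContDiff ℝ 1 (volterraField (N := N)) := by
  rw [contDiff_pi]
  intro i
  exact contDiff_const.mul ((contDiff_volterraVar _).sub (contDiff_volterraVar _))

lemma sum_exp_mul_volterraField {N : ℕ} (Y : Fin N → ℝ) :
    ∑ i, Real.exp (Y i) * volterraField Y i = 0 := by
  have h : ∀ i : Fin N, Real.exp (Y i) * volterraField Y i =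
      (fun k : ℕ => 4 * (volterraVar Y k * volterraVar Y (k + 1)) -
        4 * (volterraVar Y (k + 1) * volterraVar Y (k + 2))) i := by
    intro i
    simp only [volterraField, ← volterraVar_succ]
    ring
  rw [Finset.sum_congr rfl fun i _ => h i, Fin.sum_univ_eq_sum_range (fun k : ℕ =>
    4 * (volterraVar Y k * volterraVar Y (k + 1)) -
      4 * (volterraVar Y (k + 1) * volterraVar Y (k + 2))), Finset.sum_range_sub' (fun k => 4 * (volterraVar Y k * volterraVar Y (k + 1)))]
  simp [volterraVar]

theorem exists_isVolterraFlow (N : ℕ) (x₀ : ℕ → ℝ) (hx₀ : ∀ k, 0 < x₀ k) :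
    ∃ X : ℕ → ℝ → ℝ, IsVolterraFlow N X ∧ ∀ k, 1 ≤ k → k ≤ N → X k 0 = x₀ k := by
  have hcomp : ∀ R, IsCompact (closedBall (0 : Fin N → ℝ) R) := fun R => isCompact_closedBall 0 R
  have hex : ∃ α : ℝ → Fin N → ℝ, (α 0 = fun i : Fin N => Real.log (x₀ (i + 1))) ∧
      ∀ t, HasDerivAt α (volterraField (α t)) t := by
    refine exists_global_solution_of_apriori (f := fun _ Y => volterraField Y) ?_ ?_
      (fun x => continuous_const) _ ?_
    · intro R
      obtain ⟨C, hC⟩ := (hcomp R).exists_bound_of_continuousOn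
        (contDiff_volterraField (N := N)).continuous.continuousOn
      exact ⟨C, fun _ x hx => hC x (mem_closedBall_zero_iff.2 hx)⟩
    · intro R
      obtain ⟨K, hK⟩ := LocallyLipschitzOn.exists_lipschitzOnWith_of_compact (hcomp R)
        (contDiff_volterraField (N := N)).locallyLipschitz.locallyLipschitzOn
      refine ⟨K, fun _ x y hx hy => ?_⟩
      have := hK.dist_le_mul x (mem_closedBall_zero_iff.2 hx) y (mem_closedBall_zero_iff.2 hy)
      rwa [dist_eq_norm, dist_eq_norm] at this
    · intro T hT
      set y₀ : Fin N → ℝ := fun i => Real.log (x₀ (i + 1)) with hy₀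
      set S := ∑ i, Real.exp (y₀ i) with hS
      have hS0 : 0 ≤ S := Finset.sum_nonneg fun i _ => by positivity
      refine ⟨‖y₀‖ + 4 * S * T, fun T' hT' α h0 hα t ht => ?_⟩
      have h0mem : (0 : ℝ) ∈ Ioo (-T') T' := ⟨by linarith [hT'.1], hT'.1⟩
      have hcons : ∀ t ∈ Ioo (-T') T', ∑ i, Real.exp (α t i) = S := by
        intro t ht
        have hd : ∀ t ∈ Ioo (-T') T', HasDerivWithinAt (fun t => ∑ i, Real.exp (α t i)) 0
            (Ioo (-T') T') t := by
          intro t ht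
          have := HasDerivAt.fun_sum (u := Finset.univ)
            fun i (_ : i ∈ Finset.univ) => ((hasDerivAt_pi.1 (hα t ht)) i).exp
          rw [sum_exp_mul_volterraField] at this
          exact this.hasDerivWithinAt
        have := (convex_Ioo (-T') T').norm_image_sub_le_of_norm_hasDerivWithin_le (C := 0) hd
          (fun _ _ => by simp) h0mem ht
        rw [zero_mul, norm_le_zero_iff, sub_eq_zero] at this
        rw [this, hS, h0]
      have hx : ∀ t ∈ Ioo (-T') T', ∀ k, volterraVar (α t) k ≤ S := by
        intro t ht k
        rw [← hcons t ht]
        by_cases hk : 1 ≤ k ∧ k ≤ N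
        · simp only [volterraVar, hk, and_self, dif_pos]
          exact Finset.single_le_sum (f := fun i => Real.exp (α t i)) (fun i _ => by positivity)
            (Finset.mem_univ _)
        · simp only [volterraVar, hk, dif_neg, not_false_eq_true]
          exact Finset.sum_nonneg fun i _ => by positivity
      have hbd : ∀ t ∈ Ioo (-T') T', ‖volterraField (α t)‖ ≤ 4 * S := by
        intro t ht
        rw [pi_norm_le_iff_of_nonneg (by positivity)]
        intro i
        rw [Real.norm_eq_abs, abs_le]
        have a1 := hx t ht i
        have a2 := hx t ht (i + 2)
        have a3 := volterraVar_nonneg (α t) i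
        have a4 := volterraVar_nonneg (α t) (i + 2)
        unfold volterraField
        constructor <;> linarith
      have := (convex_Ioo (-T') T').norm_image_sub_le_of_norm_hasDerivWithin_le
        (fun t ht => (hα t ht).hasDerivWithinAt) hbd h0mem ht
      rw [h0, sub_zero] at this
      have h2 : ‖t‖ ≤ T := (abs_lt.2 ht).le.trans hT'.2
      have h3 : ‖α t‖ ≤ ‖y₀‖ + ‖α t - y₀‖ := by
        simpa using norm_add_le y₀ (α t - y₀)
      have h4 : 4 * S * ‖t‖ ≤ 4 * S * T := mul_le_mul_of_nonneg_left h2 (by positivity)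
      linarith
  obtain ⟨α, h0, hα⟩ := hex
  refine ⟨fun k t => volterraVar (α t) k, ⟨?_, ?_, ?_, ?_⟩, ?_⟩
  · intro t; simp [volterraVar]
  · intro k t hk
    have : ¬ (1 ≤ k ∧ k ≤ N) := by omega
    simp [volterraVar, this]
  · intro k t h1 h2
    simp only [volterraVar, h1, h2, and_self, dif_pos]
    positivity
  · intro k t
    by_cases hk : k < N
    · have h1 := volterraVar_succ (α t) ⟨k, hk⟩
      have h2 : (fun t => volterraVar (α t) (k + 1)) = fun t => Real.exp (α t ⟨k, hk⟩) :=
        funext fun t => volterraVar_succ (α t) ⟨k, hk⟩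
      simp only at h1
      rw [h1, h2]
      have := ((hasDerivAt_pi.1 (hα t)) ⟨k, hk⟩).exp
      convert this using 1
      simp only [volterraField]
      ring
    · have h : ∀ t, volterraVar (α t) (k + 1) = 0 := by
        intro t
        have : ¬ (1 ≤ k + 1 ∧ k + 1 ≤ N) := by omega
        simp only [volterraVar, this, dif_neg, not_false_eq_true]
      simp only [h]
      simpa using hasDerivAt_const t (0 : ℝ)
  · intro k h1 h2
    have hk := hx₀ k
    simp only [volterraVar, h1, h2, and_self, dif_pos, h0]
    rw [Nat.sub_add_cancel h1, Real.exp_log hk]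

namespace IsVolterraFlow

variable {N : ℕ} {X : ℕ → ℝ → ℝ}

lemma nonneg (h : IsVolterraFlow N X) (k : ℕ) (t : ℝ) : 0 ≤ X k t := by
  rcases Nat.eq_zero_or_pos k with rfl | hk
  · rw [h.zero_left]
  · rcases le_or_gt k N with hk' | hk'
    · exact (h.pos k t hk hk').le
    · rw [h.zero_right k t hk']

lemma sum_eq (h : IsVolterraFlow N X) (t : ℝ) :
    ∑ k ∈ Finset.range N, X (k + 1) t = ∑ k ∈ Finset.range N, X (k + 1) 0 := by
  have hd : ∀ t, HasDerivAt (fun t => ∑ k ∈ Finset.range N, X (k + 1) t) 0 t := by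
    intro t
    have := HasDerivAt.fun_sum (u := Finset.range N) fun k _ => h.hasDerivAt k t
    refine this.congr_deriv ?_
    rw [Finset.sum_congr rfl (g := fun k => 4 * (X k t * X (k + 1) t) -
      4 * (X (k + 1) t * X (k + 1 + 1) t)) (fun k _ => by ring),
      Finset.sum_range_sub' (fun k => 4 * (X k t * X (k + 1) t))]
    rw [h.zero_left, h.zero_right (N + 1) t (by omega)]
    ring
  exact is_const_of_deriv_eq_zero (fun t => (hd t).differentiableAt) (fun t => (hd t).deriv) t 0

lemma quartic_eq (h : IsVolterraFlow N X) (t : ℝ) :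
    ∑ k ∈ Finset.range N, (X (k + 1) t ^ 2 + 2 * (X (k + 1) t * X (k + 2) t)) =
      ∑ k ∈ Finset.range N, (X (k + 1) 0 ^ 2 + 2 * (X (k + 1) 0 * X (k + 2) 0)) := by
  have hd : ∀ t, HasDerivAt
      (fun t => ∑ k ∈ Finset.range N, (X (k + 1) t ^ 2 + 2 * (X (k + 1) t * X (k + 2) t))) 0 t := by
    intro t
    have := HasDerivAt.fun_sum (u := Finset.range N) fun k _ =>
      ((h.hasDerivAt k t).fun_pow 2).fun_add
        (((h.hasDerivAt k t).fun_mul (h.hasDerivAt (k + 1) t)).const_mul 2)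
    refine this.congr_deriv ?_
    rw [Finset.sum_congr rfl (g := fun k =>
      8 * (X k t * X (k + 1) t ^ 2 + X k t * X (k + 1) t * X (k + 2) t) -
      8 * (X (k + 1) t * X (k + 1 + 1) t ^ 2 + X (k + 1) t * X (k + 1 + 1) t * X (k + 1 + 2) t))
      (fun k _ => by push_cast; ring),
      Finset.sum_range_sub' (fun k =>
        8 * (X k t * X (k + 1) t ^ 2 + X k t * X (k + 1) t * X (k + 2) t))]
    rw [h.zero_left, h.zero_right (N + 1) t (by omega)]
    ring
  exact is_const_of_deriv_eq_zero (fun t => (hd t).differentiableAt) (fun t => (hd t).deriv) t 0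

end IsVolterraFlow

lemma sum_range_two_mul (F : ℕ → ℝ) (n : ℕ) :
    ∑ k ∈ Finset.range (2 * n), F k = ∑ i ∈ Finset.range n, (F (2 * i) + F (2 * i + 1)) := by
  induction n with
  | zero => simp
  | succ n ih =>
    rw [show 2 * (n + 1) = 2 * n + 1 + 1 by ring, Finset.sum_range_succ, Finset.sum_range_succ, ih,
      Finset.sum_range_succ]
    ring

lemma sum_range_mul_sub (F : ℕ → ℝ) (n : ℕ) :
    ∑ k ∈ Finset.range n, (k : ℝ) * (F k - F (k + 1)) =
      ∑ k ∈ Finset.range n, F (k + 1) - n * F n := by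
  induction n with
  | zero => simp
  | succ n ih =>
    rw [Finset.sum_range_succ, ih, Finset.sum_range_succ]
    push_cast
    ring

lemma sum_range_succ_mul_sub (F : ℕ → ℝ) (n : ℕ) :
    ∑ k ∈ Finset.range n, ((k : ℝ) + 1) * (F k - F (k + 1)) =
      ∑ k ∈ Finset.range n, F k - n * F n := by
  induction n with
  | zero => simp
  | succ n ih =>
    rw [Finset.sum_range_succ, ih, Finset.sum_range_succ]
    push_cast
    ring

namespace IsVolterraFlow

variable {n : ℕ} {X : ℕ → ℝ → ℝ}

/-- A quantity that grows at a definite rate as long as the last site is not strongly excited. -/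
def lyapunov (n : ℕ) (X : ℕ → ℝ → ℝ) (t : ℝ) : ℝ :=
  ∑ k ∈ Finset.range n, (k : ℝ) * Real.log (X (2 * k + 1) t) +
    16 * n * ∑ k ∈ Finset.range n, ((k : ℝ) + 1) * Real.log (X (2 * k + 2) t)

lemma hasDerivAt_log (h : IsVolterraFlow (2 * n) X) {k : ℕ} (hk : k < 2 * n) (t : ℝ) :
    HasDerivAt (fun t => Real.log (X (k + 1) t)) (4 * (X k t - X (k + 2) t)) t := by
  have hp := h.pos (k + 1) t (by omega) hk
  refine ((h.hasDerivAt k t).log hp.ne').congr_deriv ?_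
  field_simp

lemma hasDerivAt_lyapunov (h : IsVolterraFlow (2 * n) X) (t : ℝ) :
    HasDerivAt (lyapunov n X)
      (4 * (∑ k ∈ Finset.range n, X (2 * k + 2) t - n * X (2 * n) t +
        16 * n * ∑ k ∈ Finset.range n, X (2 * k + 1) t)) t := by
  have h1 := HasDerivAt.fun_sum (u := Finset.range n) fun k hk =>
    (h.hasDerivAt_log (k := 2 * k) (by have := Finset.mem_range.1 hk; omega) t).const_mul (k : ℝ)
  have h2 := (HasDerivAt.fun_sum (u := Finset.range n) fun k hk =>
    (h.hasDerivAt_log (k := 2 * k + 1) (by have := Finset.mem_range.1 hk; omega) t).const_mul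
      ((k : ℝ) + 1)).const_mul (16 * (n : ℝ))
  refine (h1.fun_add h2).congr_deriv ?_
  have e1 := sum_range_mul_sub (fun k => X (2 * k) t) n
  have e2 := sum_range_succ_mul_sub (fun k => X (2 * k + 1) t) n
  rw [h.zero_right (2 * n + 1) t (by omega)] at e2
  simp only [Nat.mul_add, mul_one] at e1 e2
  have e3 : ∑ k ∈ Finset.range n, (k : ℝ) * (4 * (X (2 * k) t - X (2 * k + 2) t)) =
      4 * ∑ k ∈ Finset.range n, (k : ℝ) * (X (2 * k) t - X (2 * k + 2) t) := by
    rw [Finset.mul_sum]; exact Finset.sum_congr rfl fun k _ => by ring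
  have e4 : ∑ k ∈ Finset.range n, ((k : ℝ) + 1) * (4 * (X (2 * k + 1) t - X (2 * k + 1 + 2) t)) =
      4 * ∑ k ∈ Finset.range n, ((k : ℝ) + 1) * (X (2 * k + 1) t - X (2 * k + 2 + 1) t) := by
    rw [Finset.mul_sum]; exact Finset.sum_congr rfl fun k _ => by ring_nf
  rw [e3, e1, e4, e2]
  ring

lemma quartic_le (h : IsVolterraFlow (2 * n) X) (hn : 1 ≤ n) (t : ℝ) :
    ∑ k ∈ Finset.range (2 * n), (X (k + 1) t ^ 2 + 2 * (X (k + 1) t * X (k + 2) t)) ≤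
      (∑ k ∈ Finset.range n, X (2 * k + 2) t - X (2 * n) t) ^ 2 + X (2 * n) t ^ 2 +
        4 * (∑ k ∈ Finset.range n, X (2 * k + 1) t) *
          ∑ k ∈ Finset.range (2 * n), X (k + 1) t := by
  set S := ∑ k ∈ Finset.range (2 * n), X (k + 1) t with hS
  have hX := fun k => h.nonneg k t
  have hS0 : 0 ≤ S := Finset.sum_nonneg fun k _ => hX _
  have hS2 : S = ∑ i ∈ Finset.range n, (X (2 * i + 1) t + X (2 * i + 2) t) :=
    sum_range_two_mul (fun k => X (k + 1) t) n
  have hpair : ∀ i ∈ Finset.range n, X (2 * i + 1) t + X (2 * i + 2) t ≤ S := by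
    intro i hi
    rw [hS2]
    exact Finset.single_le_sum (f := fun i => X (2 * i + 1) t + X (2 * i + 2) t)
      (fun i _ => add_nonneg (hX _) (hX _)) hi
  rw [sum_range_two_mul (fun k => X (k + 1) t ^ 2 + 2 * (X (k + 1) t * X (k + 2) t))]
  have hodd : ∑ i ∈ Finset.range n, X (2 * i + 3) t ≤ ∑ i ∈ Finset.range n, X (2 * i + 1) t := by
    have e := Finset.sum_range_succ' (fun i => X (2 * i + 1) t) n
    have e' := Finset.sum_range_succ (fun i => X (2 * i + 1) t) n
    rw [h.zero_right (2 * n + 1) t (by omega)] at e'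
    have e3 : ∀ i, 2 * (i + 1) + 1 = 2 * i + 3 := fun i => by ring
    simp only [e3] at e
    linarith [hX (2 * 0 + 1)]
  have hsq : ∑ i ∈ Finset.range n, X (2 * i + 2) t ^ 2 ≤
      (∑ k ∈ Finset.range n, X (2 * k + 2) t - X (2 * n) t) ^ 2 + X (2 * n) t ^ 2 := by
    obtain ⟨m, rfl⟩ : ∃ m, n = m + 1 := ⟨n - 1, by omega⟩
    rw [Finset.sum_range_succ, Finset.sum_range_succ, show 2 * (m + 1) = 2 * m + 2 by ring,
      add_sub_cancel_right]
    gcongr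
    exact Finset.sum_sq_le_sq_sum_of_nonneg (fun i _ => hX _)
  calc _ ≤ ∑ i ∈ Finset.range n, (2 * S * X (2 * i + 1) t + X (2 * i + 2) t ^ 2 +
        2 * S * X (2 * i + 3) t) := by
        refine Finset.sum_le_sum fun i hi => ?_
        have a := hpair i hi
        have b1 := hX (2 * i + 1)
        have b2 := hX (2 * i + 2)
        have b3 := hX (2 * i + 3)
        have e : 2 * i + 1 + 1 = 2 * i + 2 := rfl
        have e' : 2 * i + 1 + 2 = 2 * i + 3 := rfl
        simp only [e, e']
        nlinarith [mul_le_mul_of_nonneg_right a b1, mul_nonneg b1 b2,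
          mul_le_mul_of_nonneg_right (show X (2 * i + 2) t ≤ S by linarith) b3]
    _ = 2 * S * ∑ i ∈ Finset.range n, X (2 * i + 1) t + ∑ i ∈ Finset.range n, X (2 * i + 2) t ^ 2 +
        2 * S * ∑ i ∈ Finset.range n, X (2 * i + 3) t := by
        rw [Finset.sum_add_distrib, Finset.sum_add_distrib, ← Finset.mul_sum, ← Finset.mul_sum]
    _ ≤ _ := by nlinarith [mul_le_mul_of_nonneg_left hodd hS0]

/-- Energy initially concentrated on the first site reaches the last site in polynomial time. -/
theorem exists_half_le (h : IsVolterraFlow (2 * n) X) (hn : 1 ≤ n) {δ : ℝ} (hδ : 0 < δ)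
    (hδn : 2 * n * δ ≤ 1 / (48 * n)) (h1 : X 1 0 = 1)
    (h2 : ∀ k, 2 ≤ k → k ≤ 2 * n → X k 0 = δ) :
    ∃ t ∈ Icc 0 (35 * (n : ℝ) ^ 3 * (1 + Real.log δ⁻¹)), 1 / 2 ≤ X (2 * n) t := by
  have hn1 : (1 : ℝ) ≤ n := by exact_mod_cast hn
  have hκ : 1 / (48 * (n : ℝ)) ≤ 1 / 48 := by
    apply one_div_le_one_div_of_le <;> linarith
  set κ := 1 / (48 * (n : ℝ)) with hκdef
  have hκ0 : 0 < κ := by positivity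
  have hκn : 48 * n * κ = 1 := by rw [hκdef]; field_simp
  have hδ1 : δ ≤ 1 := by nlinarith
  have hL : 0 ≤ Real.log δ⁻¹ := Real.log_nonneg ((one_le_inv₀ hδ).2 hδ1)
  set T := 35 * (n : ℝ) ^ 3 * (1 + Real.log δ⁻¹) with hT
  have hT0 : 0 < T := by positivity
  have hX := fun k t => h.nonneg k t
  have hS : ∀ t, ∑ k ∈ Finset.range (2 * n), X (k + 1) t = 1 + (2 * n - 1) * δ := by
    intro t
    rw [h.sum_eq t, show 2 * n = 2 * n - 1 + 1 by omega, Finset.sum_range_succ', zero_add, h1,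
      Finset.sum_congr rfl (g := fun _ => δ)
        (fun k hk => h2 _ (by omega) (by have := Finset.mem_range.1 hk; omega))]
    rw [Finset.sum_const, Finset.card_range, nsmul_eq_mul, Nat.cast_sub (by omega)]
    push_cast
    ring
  have hQ : ∀ t, 1 ≤ ∑ k ∈ Finset.range (2 * n),
      (X (k + 1) t ^ 2 + 2 * (X (k + 1) t * X (k + 2) t)) := by
    intro t
    rw [h.quartic_eq t]
    have := Finset.single_le_sum (f := fun k => X (k + 1) 0 ^ 2 + 2 * (X (k + 1) 0 * X (k + 2) 0))
      (s := Finset.range (2 * n)) (fun k _ => by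
        have := hX (k + 1) 0
        have := hX (k + 2) 0
        positivity)
      (Finset.mem_range.2 (show 0 < 2 * n by omega))
    refine le_trans ?_ this
    simp only [zero_add, h1]
    have := hX 2 0
    linarith
  by_contra hcon
  push Not at hcon
  have hbound : ∀ t, ∀ k, k < 2 * n → X (k + 1) t ≤ 1 + κ := by
    intro t k hk
    have := Finset.single_le_sum (f := fun k => X (k + 1) t) (fun k _ => hX (k + 1) t)
      (Finset.mem_range.2 hk)
    rw [hS t] at this
    linarith
  have hlog : ∀ t, ∀ k, k < 2 * n → Real.log (X (k + 1) t) ≤ 1 := by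
    intro t k hk
    have := Real.log_le_sub_one_of_pos (h.pos (k + 1) t (by omega) hk)
    linarith [hbound t k hk]
  have hlog0 : ∀ k, k < 2 * n → - Real.log δ⁻¹ ≤ Real.log (X (k + 1) 0) := by
    intro k hk
    rcases Nat.eq_zero_or_pos k with rfl | hk0
    · rw [zero_add, h1, Real.log_one]; linarith
    · rw [h2 (k + 1) (by omega) hk, Real.log_inv, neg_neg]
  have hder : ∀ t ∈ Icc 0 T, 1 / 2 ≤ 4 * (∑ k ∈ Finset.range n, X (2 * k + 2) t -
      n * X (2 * n) t + 16 * n * ∑ k ∈ Finset.range n, X (2 * k + 1) t) := by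
    intro t ht
    have hlt := hcon t ht
    have hq := (hQ t).trans (h.quartic_le hn t)
    have hs := hS t
    have hs2 := sum_range_two_mul (fun k => X (k + 1) t) n
    rw [Finset.sum_add_distrib] at hs2
    simp only [show ∀ k, 2 * k + 1 + 1 = 2 * k + 2 from fun k => rfl] at hs2
    have hP : 0 ≤ ∑ k ∈ Finset.range n, X (2 * k + 1) t := Finset.sum_nonneg fun k _ => hX _ t
    have hE : X (2 * n) t ≤ ∑ k ∈ Finset.range n, X (2 * k + 2) t := by
      have := Finset.single_le_sum (f := fun k => X (2 * k + 2) t) (fun k _ => hX (2 * k + 2) t)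
        (Finset.mem_range.2 (show n - 1 < n by omega))
      simpa only [show 2 * (n - 1) + 2 = 2 * n by omega] using this
    have hZ := hX (2 * n) t
    rw [hs] at hq hs2
    set P := ∑ k ∈ Finset.range n, X (2 * k + 1) t
    set V := ∑ k ∈ Finset.range n, X (2 * k + 2) t
    set Z := X (2 * n) t
    have hη : (2 * (n : ℝ) - 1) * δ ≤ κ := by linarith
    have hη0 : 0 ≤ (2 * (n : ℝ) - 1) * δ := by
      apply mul_nonneg _ hδ.le; linarith
    set η := (2 * (n : ℝ) - 1) * δ
    rcases le_or_gt (1 / 4) P with hP4 | hP4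
    · nlinarith
    · have a1 : V - Z ≥ 1 / 4 := by linarith
      have a2 : 2 * (V - Z) * Z ≤ 3 * κ + 8 * P := by
        have b1 : V ^ 2 ≤ (1 + κ) ^ 2 := by
          apply pow_le_pow_left₀ <;> linarith
        have b2 : 4 * P * (1 + η) ≤ 8 * P := by nlinarith
        nlinarith
      have a3 : Z ≤ 6 * κ + 16 * P := by nlinarith
      nlinarith
  have hmono : T / 2 ≤ lyapunov n X T - lyapunov n X 0 := by
    have := (convex_Icc 0 T).mul_sub_le_image_sub_of_le_deriv
      (f := lyapunov n X) (C := 1 / 2)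
      (fun t _ => (h.hasDerivAt_lyapunov t).continuousAt.continuousWithinAt)
      (fun t _ => (h.hasDerivAt_lyapunov t).differentiableAt.differentiableWithinAt)
      (fun t ht => by
        rw [(h.hasDerivAt_lyapunov t).deriv]
        exact hder t (interior_subset ht))
      0 ⟨le_refl _, hT0.le⟩ T ⟨hT0.le, le_refl _⟩ hT0.le
    linarith
  have hcoef1 : ∑ k ∈ Finset.range n, (k : ℝ) ≤ (n : ℝ) ^ 2 := by
    calc _ ≤ ∑ k ∈ Finset.range n, (n : ℝ) := Finset.sum_le_sum fun k hk => by
          exact_mod_cast (Finset.mem_range.1 hk).le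
      _ = _ := by rw [Finset.sum_const, Finset.card_range, nsmul_eq_mul]; ring
  have hcoef2 : ∑ k ∈ Finset.range n, ((k : ℝ) + 1) ≤ (n : ℝ) ^ 2 := by
    calc _ ≤ ∑ k ∈ Finset.range n, (n : ℝ) := Finset.sum_le_sum fun k hk => by
          exact_mod_cast Finset.mem_range.1 hk
      _ = _ := by rw [Finset.sum_const, Finset.card_range, nsmul_eq_mul]; ring
  have hdiff : lyapunov n X T - lyapunov n X 0 ≤
      (n : ℝ) ^ 2 * (1 + Real.log δ⁻¹) + 16 * n * ((n : ℝ) ^ 2 * (1 + Real.log δ⁻¹)) := by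
    have c1 : ∑ k ∈ Finset.range n, (k : ℝ) * Real.log (X (2 * k + 1) T) -
        ∑ k ∈ Finset.range n, (k : ℝ) * Real.log (X (2 * k + 1) 0) ≤
        (n : ℝ) ^ 2 * (1 + Real.log δ⁻¹) := by
      rw [← Finset.sum_sub_distrib]
      refine le_trans (Finset.sum_le_sum (g := fun k : ℕ => (k : ℝ) * (1 + Real.log δ⁻¹))
        fun k hk => ?_) ?_
      · have hk' := Finset.mem_range.1 hk
        rw [← mul_sub]
        refine mul_le_mul_of_nonneg_left ?_ (by positivity)
        linarith [hlog T (2 * k) (by omega), hlog0 (2 * k) (by omega)]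
      · rw [← Finset.sum_mul]
        exact mul_le_mul_of_nonneg_right hcoef1 (by linarith)
    have c2 : ∑ k ∈ Finset.range n, ((k : ℝ) + 1) * Real.log (X (2 * k + 2) T) -
        ∑ k ∈ Finset.range n, ((k : ℝ) + 1) * Real.log (X (2 * k + 2) 0) ≤
        (n : ℝ) ^ 2 * (1 + Real.log δ⁻¹) := by
      rw [← Finset.sum_sub_distrib]
      refine le_trans (Finset.sum_le_sum (g := fun k : ℕ => ((k : ℝ) + 1) * (1 + Real.log δ⁻¹))
        fun k hk => ?_) ?_
      · have hk' := Finset.mem_range.1 hk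
        rw [← mul_sub]
        refine mul_le_mul_of_nonneg_left ?_ (by positivity)
        linarith [hlog T (2 * k + 1) (by omega), hlog0 (2 * k + 1) (by omega)]
      · rw [← Finset.sum_mul]
        exact mul_le_mul_of_nonneg_right hcoef2 (by linarith)
    have c3 := mul_le_mul_of_nonneg_left c2 (show 0 ≤ 16 * (n : ℝ) by positivity)
    rw [mul_sub] at c3
    unfold lyapunov
    linarith
  have hfin : (n : ℝ) ^ 2 * (1 + Real.log δ⁻¹) ≤ (n : ℝ) ^ 3 * (1 + Real.log δ⁻¹) := by
    refine mul_le_mul_of_nonneg_right ?_ (by linarith)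
    exact pow_le_pow_right₀ hn1 (by norm_num)
  have hpos : 0 < (n : ℝ) ^ 3 * (1 + Real.log δ⁻¹) := by positivity
  nlinarith

end IsVolterraFlow

/-- The Banach space of absolutely summable families of Fourier coefficients. -/
abbrev Ell1 : Type := lp (fun _ : Z2 => ℂ) 1

namespace Ell1

lemma summable_norm (x : Ell1) : Summable fun n => ‖x n‖ := by
  have h := (lp.memℓp x).summable (by simp)
  simpa using h

lemma norm_eq (x : Ell1) : ‖x‖ = ∑' n, ‖x n‖ := by
  rw [lp.norm_eq_tsum_rpow (by simp)]
  simp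

/-- The element of `ℓ¹` with given absolutely summable coordinates. -/
def mk (f : Z2 → ℂ) (hf : Summable fun n => ‖f n‖) : Ell1 :=
  ⟨f, memℓp_gen (by simpa using hf)⟩

@[simp] lemma mk_apply (f : Z2 → ℂ) (hf : Summable fun n => ‖f n‖) (n : Z2) : mk f hf n = f n :=
  rfl

lemma add_apply (x y : Ell1) (n : Z2) : (x + y) n = x n + y n := rfl

lemma sub_apply (x y : Ell1) (n : Z2) : (x - y) n = x n - y n := rfl

lemma smul_apply (c : ℂ) (x : Ell1) (n : Z2) : (c • x) n = c * x n := rfl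

lemma real_smul_apply (c : ℝ) (x : Ell1) (n : Z2) : (c • x) n = c * x n := rfl

lemma norm_apply_le (x : Ell1) (n : Z2) : ‖x n‖ ≤ ‖x‖ := lp.norm_apply_le_norm one_ne_zero x n

/-- Integration against a bounded sequence. -/
def pairing (g : Z2 → ℂ) (C : ℝ) (hg : ∀ n, ‖g n‖ ≤ C) : Ell1 →L[ℂ] ℂ :=
  LinearMap.mkContinuous
    { toFun := fun x => ∑' n, x n * g n
      map_add' := fun x y => by
        simp only [add_apply, add_mul]
        exact Summable.tsum_add
          (Summable.of_norm_bounded (x.summable_norm.mul_right C) fun n => by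
            rw [norm_mul]; exact mul_le_mul_of_nonneg_left (hg n) (norm_nonneg _))
          (Summable.of_norm_bounded (y.summable_norm.mul_right C) fun n => by
            rw [norm_mul]; exact mul_le_mul_of_nonneg_left (hg n) (norm_nonneg _))
      map_smul' := fun c x => by
        simp only [smul_apply, mul_assoc, RingHom.id_apply, smul_eq_mul]
        exact tsum_mul_left }
    C fun x => by
      simp only [LinearMap.coe_mk, AddHom.coe_mk]
      rw [norm_eq, ← tsum_mul_left]
      refine tsum_of_norm_bounded (x.summable_norm.mul_left C).hasSum fun n => ?_
      rw [norm_mul, mul_comm]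
      exact mul_le_mul_of_nonneg_right (hg n) (norm_nonneg _)

lemma pairing_apply (g : Z2 → ℂ) (C : ℝ) (hg : ∀ n, ‖g n‖ ≤ C) (x : Ell1) :
    pairing g C hg x = ∑' n, x n * g n := rfl

/-- Multiplication by a bounded sequence. -/
def diag (g : Z2 → ℂ) (C : ℝ) (hg : ∀ n, ‖g n‖ ≤ C) : Ell1 →L[ℝ] Ell1 :=
  LinearMap.mkContinuous
    { toFun := fun x => mk (fun n => g n * x n)
        (Summable.of_nonneg_of_le (fun _ => norm_nonneg _) (fun n => by
          rw [norm_mul]; exact mul_le_mul_of_nonneg_right (hg n) (norm_nonneg _))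
          (x.summable_norm.mul_left C))
      map_add' := fun x y => by
        ext n; simp only [mk_apply, add_apply]; ring
      map_smul' := fun c x => by
        ext n; simp only [mk_apply, real_smul_apply, RingHom.id_apply]; ring }
    C fun x => by
      simp only [LinearMap.coe_mk, AddHom.coe_mk]
      rw [norm_eq, norm_eq, ← tsum_mul_left]
      refine Summable.tsum_le_tsum (fun n => ?_) (summable_norm _) (x.summable_norm.mul_left C)
      rw [mk_apply, norm_mul]
      exact mul_le_mul_of_nonneg_right (hg n) (norm_nonneg _)

lemma diag_apply (g : Z2 → ℂ) (C : ℝ) (hg : ∀ n, ‖g n‖ ≤ C) (x : Ell1) (n : Z2) :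
    diag g C hg x n = g n * x n := rfl

/-- The coordinate functional. -/
def coord (n : Z2) : Ell1 →L[ℂ] ℂ :=
  LinearMap.mkContinuous
    { toFun := fun x => x n, map_add' := fun _ _ => rfl, map_smul' := fun _ _ => rfl } 1
    fun x => by rw [one_mul]; exact norm_apply_le x n

lemma coord_apply (n : Z2) (x : Ell1) : coord n x = x n := rfl

end Ell1

/-- The output frequency of a triple. -/
def triOut (p : Triple) : Z2 := p.1 - p.2.1 + p.2.2

/-- The cubic monomial attached to a triple. -/
def mono (x y z : Z2 → ℂ) (p : Triple) : ℂ :=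
  x p.1 * (starRingEnd ℂ) (y p.2.1) * z p.2.2

lemma norm_mono (x y z : Z2 → ℂ) (p : Triple) :
    ‖mono x y z p‖ = ‖x p.1‖ * (‖y p.2.1‖ * ‖z p.2.2‖) := by
  rw [mono, norm_mul, norm_mul, RCLike.norm_conj, mul_assoc]

lemma hasSum_triple {f g h : Z2 → ℝ} (hf : Summable f) (hg : Summable g) (hh : Summable h)
    (hf0 : 0 ≤ f) (hg0 : 0 ≤ g) (hh0 : 0 ≤ h) :
    HasSum (fun p : Triple => f p.1 * (g p.2.1 * h p.2.2)) ((∑' n, f n) * ((∑' n, g n) *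
      ∑' n, h n)) := by
  have h1 := hg.mul_of_nonneg hh hg0 hh0
  have h2 := hf.mul_of_nonneg h1 hf0 (fun q => mul_nonneg (hg0 _) (hh0 _))
  have e1 := hg.tsum_mul_tsum hh h1
  have e2 := hf.tsum_mul_tsum h1 h2
  rw [e1, e2]
  exact h2.hasSum

lemma hasSum_norm_mono (x y z : Ell1) :
    HasSum (fun p => ‖mono x y z p‖) (‖x‖ * (‖y‖ * ‖z‖)) := by
  simp only [norm_mono, Ell1.norm_eq]
  exact hasSum_triple x.summable_norm y.summable_norm z.summable_norm
    (fun _ => norm_nonneg _) (fun _ => norm_nonneg _) (fun _ => norm_nonneg _)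

/-- The trilinear operator with kernel `κ`. -/
def tri (κ : Triple → ℂ) (x y z : Ell1) : Ell1 :=
  ∑' p : Triple, lp.single 1 (triOut p) (κ p * mono x y z p)

section tri

variable {κ : Triple → ℂ} {x y z : Ell1}

lemma summable_tri (h : Summable fun p => ‖κ p * mono x y z p‖) :
    Summable fun p : Triple =>
      (lp.single 1 (triOut p) (κ p * mono x y z p) : Ell1) := by
  refine Summable.of_norm ?_
  simpa only [lp.norm_single one_pos] using h

lemma summable_kernel_mono {C : ℝ} (hκ : ∀ p, ‖κ p‖ ≤ C) (x y z : Ell1) :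
    Summable fun p => ‖κ p * mono x y z p‖ :=
  Summable.of_nonneg_of_le (fun _ => norm_nonneg _) (fun p => by
    rw [norm_mul]; exact mul_le_mul_of_nonneg_right (hκ p) (norm_nonneg _))
    ((hasSum_norm_mono x y z).summable.mul_left C)

lemma norm_tri_le_of_hasSum {f : Triple → ℝ} {S : ℝ} (hf : HasSum f S)
    (h : ∀ p, ‖κ p * mono x y z p‖ ≤ f p) : ‖tri κ x y z‖ ≤ S :=
  tsum_of_norm_bounded hf fun p => by rw [lp.norm_single one_pos]; exact h p

lemma norm_tri_le {C : ℝ} (hκ : ∀ p, ‖κ p‖ ≤ C) (x y z : Ell1) :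
    ‖tri κ x y z‖ ≤ C * (‖x‖ * (‖y‖ * ‖z‖)) :=
  norm_tri_le_of_hasSum ((hasSum_norm_mono x y z).mul_left C) fun p => by
    rw [norm_mul]; exact mul_le_mul_of_nonneg_right (hκ p) (norm_nonneg _)

lemma clm_tri {F : Type*} [NormedAddCommGroup F] [NormedSpace ℂ F] (L : Ell1 →L[ℂ] F)
    (h : Summable fun p => ‖κ p * mono x y z p‖) :
    L (tri κ x y z) = ∑' p : Triple, L (lp.single 1 (triOut p) (κ p * mono x y z p)) :=
  L.map_tsum (summable_tri h)

lemma tri_apply (h : Summable fun p => ‖κ p * mono x y z p‖) (n : Z2) :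
    tri κ x y z n =
      ∑' p : {p : Triple // p.1 - p.2.1 + p.2.2 = n}, κ p.1 * mono x y z p.1 := by
  rw [← Ell1.coord_apply, clm_tri _ h]
  refine Eq.trans ?_ (tsum_subtype {p : Triple | p.1 - p.2.1 + p.2.2 = n}
    (fun p => κ p * mono x y z p)).symm
  refine tsum_congr fun p => ?_
  rw [Ell1.coord_apply, lp.single_apply]
  by_cases hp : triOut p = n
  · rw [indicator_of_mem (by exact hp), ← hp, Pi.single_eq_same]
  · rw [indicator_of_notMem (by exact hp), Pi.single_eq_of_ne (Ne.symm hp)]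

lemma pairing_tri {g : Z2 → ℂ} {C : ℝ} (hg : ∀ n, ‖g n‖ ≤ C)
    (h : Summable fun p => ‖κ p * mono x y z p‖) :
    ∑' n, tri κ x y z n * g n = ∑' p, κ p * mono x y z p * g (triOut p) := by
  rw [← Ell1.pairing_apply g C hg, clm_tri _ h]
  refine tsum_congr fun p => ?_
  rw [Ell1.pairing_apply, tsum_eq_single (triOut p), lp.single_apply_self]
  intro n hn
  rw [lp.single_apply_ne 1 _ _ hn, zero_mul]

lemma tri_sub_tri {C : ℝ} (hκ : ∀ p, ‖κ p‖ ≤ C) (x y : Ell1) :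
    tri κ x x x - tri κ y y y =
      tri κ (x - y) x x + tri κ y (x - y) x + tri κ y y (x - y) := by
  have hs := fun x y z => summable_tri (summable_kernel_mono hκ x y z)
  unfold tri
  rw [← (hs _ _ _).tsum_sub (hs _ _ _), ← (hs _ _ _).tsum_add (hs _ _ _),
    ← ((hs _ _ _).add (hs _ _ _)).tsum_add (hs _ _ _)]
  refine tsum_congr fun p => ?_
  rw [← lp.single_sub, ← lp.single_add, ← lp.single_add]
  congr 1
  simp only [mono, Ell1.sub_apply, map_sub]
  ring

lemma norm_tri_sub_tri_le {C R : ℝ} (hκ : ∀ p, ‖κ p‖ ≤ C) {x y : Ell1} (hx : ‖x‖ ≤ R)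
    (hy : ‖y‖ ≤ R) : ‖tri κ x x x - tri κ y y y‖ ≤ 3 * C * R ^ 2 * ‖x - y‖ := by
  have hC : 0 ≤ C := (norm_nonneg _).trans (hκ 0)
  have hR : 0 ≤ R := (norm_nonneg _).trans hx
  rw [tri_sub_tri hκ]
  refine (norm_add₃_le).trans ?_
  have h1 := norm_tri_le hκ (x - y) x x
  have h2 := norm_tri_le hκ y (x - y) x
  have h3 := norm_tri_le hκ y y (x - y)
  have a : ‖x‖ * ‖x‖ ≤ R ^ 2 := by rw [sq]; gcongr
  have b : ‖y‖ * ‖x‖ ≤ R ^ 2 := by rw [sq]; gcongr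
  have c : ‖y‖ * ‖y‖ ≤ R ^ 2 := by rw [sq]; gcongr
  have hd : 0 ≤ C * ‖x - y‖ := by positivity
  nlinarith [mul_le_mul_of_nonneg_left a hd, mul_le_mul_of_nonneg_left b hd,
    mul_le_mul_of_nonneg_left c hd]

lemma continuous_tri {κ : ℝ → Triple → ℂ} {C : ℝ} (hκ : ∀ t p, ‖κ t p‖ ≤ C)
    (hc : ∀ p, Continuous fun t => κ t p) (x y z : Ell1) :
    Continuous fun t => tri (κ t) x y z := by
  refine continuous_tsum (fun p => ?_) ((hasSum_norm_mono x y z).summable.mul_left C)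
    fun p t => ?_
  · exact (lp.isometry_single (E := fun _ : Z2 => ℂ) (p := 1) (triOut p)).continuous.comp
      ((hc p).mul continuous_const)
  · rw [lp.norm_single one_pos, norm_mul]
    exact mul_le_mul_of_nonneg_right (hκ t p) (norm_nonneg _)

end tri

/-- The quartic form whose diagonal is the fourth power of the `L⁴` norm. -/
def quart (x y z v : Ell1) : ℂ := ∑' p, mono x y z p * (starRingEnd ℂ) (v (triOut p))

lemma norm_quart_term_le (x y z v : Ell1) (p : Triple) :
    ‖mono x y z p * (starRingEnd ℂ) (v (triOut p))‖ ≤ ‖mono x y z p‖ * ‖v‖ := by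
  rw [norm_mul, RCLike.norm_conj]
  exact mul_le_mul_of_nonneg_left (v.norm_apply_le _) (norm_nonneg _)

lemma summable_quart (x y z v : Ell1) :
    Summable fun p => mono x y z p * (starRingEnd ℂ) (v (triOut p)) :=
  Summable.of_norm_bounded ((hasSum_norm_mono x y z).summable.mul_right ‖v‖)
    (norm_quart_term_le x y z v)

lemma norm_quart_le (x y z v : Ell1) : ‖quart x y z v‖ ≤ ‖x‖ * (‖y‖ * ‖z‖) * ‖v‖ :=
  tsum_of_norm_bounded ((hasSum_norm_mono x y z).mul_right ‖v‖) (norm_quart_term_le x y z v)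

/-- The real part of the quartic form as a multilinear map. -/
def quartReAux : MultilinearMap ℝ (fun _ : Fin 4 => Ell1) ℝ :=
  MultilinearMap.mk' (fun m => (quart (m 0) (m 1) (m 2) (m 3)).re)
    (by
      intro m i x y
      rw [← Complex.add_re]
      congr 1
      unfold quart
      rw [← Summable.tsum_add (summable_quart _ _ _ _) (summable_quart _ _ _ _)]
      refine tsum_congr fun p => ?_
      fin_cases i <;> simp [mono, Function.update, Ell1.add_apply] <;> ring)
    (by
      intro m i c x
      rw [smul_eq_mul, ← Complex.re_ofReal_mul]
      congr 1
      unfold quart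
      rw [← tsum_mul_left]
      refine tsum_congr fun p => ?_
      fin_cases i <;> simp [mono, Function.update, Ell1.real_smul_apply] <;> ring)

/-- The real part of the quartic form as a continuous multilinear map. -/
def quartRe : ContinuousMultilinearMap ℝ (fun _ : Fin 4 => Ell1) ℝ :=
  quartReAux.mkContinuous 1 fun m => by
    rw [one_mul, Fin.prod_univ_four]
    refine (Complex.abs_re_le_norm _).trans ((norm_quart_le _ _ _ _).trans (le_of_eq ?_))
    ring

lemma quartRe_apply (m : Fin 4 → Ell1) : quartRe m = (quart (m 0) (m 1) (m 2) (m 3)).re := rfl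

lemma quart_swap_outer (x y z v : Ell1) : quart x y z v = quart z y x v := by
  have hi : Function.Involutive fun p : Triple => (p.2.2, p.2.1, p.1) := fun _ => rfl
  refine ((hi.toPerm _).tsum_eq _).symm.trans (tsum_congr fun p => ?_)
  have : triOut (p.2.2, p.2.1, p.1) = triOut p := by simp only [triOut]; abel
  simp only [Function.Involutive.coe_toPerm, this, mono]
  ring

lemma quart_swap_inner (x y z v : Ell1) : quart x y z v = quart x v z y := by
  have hi : Function.Involutive fun p : Triple => (p.1, triOut p, p.2.2) := fun p =>
    Prod.ext rfl (Prod.ext (by simp only [triOut]; abel) rfl)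
  refine ((hi.toPerm _).tsum_eq _).symm.trans (tsum_congr fun p => ?_)
  have : triOut (p.1, triOut p, p.2.2) = p.2.1 := by simp only [triOut]; abel
  simp only [Function.Involutive.coe_toPerm, this, mono]
  ring

lemma quart_conj (x y z v : Ell1) : (starRingEnd ℂ) (quart x y z v) = quart y x v z := by
  have hi : Function.Involutive fun p : Triple => (p.2.1, p.1, triOut p) := fun p =>
    Prod.ext rfl (Prod.ext rfl (by simp only [triOut]; abel))
  rw [quart, Complex.conj_tsum]
  refine ((hi.toPerm _).tsum_eq _).symm.trans (tsum_congr fun p => ?_)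
  have : triOut (p.2.1, p.1, triOut p) = p.2.2 := by simp only [triOut]; abel
  simp only [Function.Involutive.coe_toPerm, this, mono, map_mul, Complex.conj_conj]
  ring

lemma quart_self_im (x : Ell1) : (quart x x x x).im = 0 :=
  Complex.conj_eq_iff_im.mp (quart_conj x x x x)

lemma hasDerivAt_quart_self {a : ℝ → Ell1} {D : Ell1} {t : ℝ} (h : HasDerivAt a D t) :
    HasDerivAt (fun τ => (quart (a τ) (a τ) (a τ) (a τ)).re)
      (4 * (quart (a t) (a t) (a t) D).re) t := by
  have h1 := (HasFDerivAt.multilinear_comp quartRe (g := fun _ : Fin 4 => a)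
    (fun _ => h.hasFDerivAt)).hasDerivAt
  refine h1.congr_deriv ?_
  have re_conj : ∀ x y z v, (quart x y z v).re = (quart y x v z).re := fun x y z v => by
    rw [← quart_conj, Complex.conj_re]
  have e1 : (quart D (a t) (a t) (a t)).re = (quart (a t) (a t) (a t) D).re := by
    rw [quart_swap_outer, re_conj]
  have e2 : (quart (a t) D (a t) (a t)).re = (quart (a t) (a t) (a t) D).re := by
    rw [quart_swap_inner]
  have e3 : (quart (a t) (a t) D (a t)).re = (quart (a t) (a t) (a t) D).re := by
    rw [re_conj]
  simp [Fin.sum_univ_four, quartRe_apply, Function.update, ContinuousMultilinearMap.toContinuousLinearMap, e1, e2, e3]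
  ring

/-- The form is the sum of the squared moduli of the autocorrelation. -/
lemma quart_self_nonneg (x : Ell1) : 0 ≤ (quart x x x x).re := by
  let e : Triple ≃ Triple :=
    { toFun := fun q => (q.2.1 + q.1, q.2.1, q.2.2)
      invFun := fun p => (p.1 - p.2.1, p.2.1, p.2.2)
      left_inv := fun q => by simp
      right_inv := fun q => by simp }
  have h0 := (e.summable_iff).mpr (summable_quart x x x x)
  have h1 : quart x x x x = ∑' q : Triple, (x (q.2.1 + q.1) * (starRingEnd ℂ) (x q.2.1)) *
      (starRingEnd ℂ) (x (q.2.2 + q.1) * (starRingEnd ℂ) (x q.2.2)) := by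
    refine (e.tsum_eq _).symm.trans (tsum_congr fun q => ?_)
    have : triOut (e q) = q.2.2 + q.1 := by simp only [triOut, e, Equiv.coe_fn_mk]; abel
    rw [this]
    simp only [e, mono, Equiv.coe_fn_mk, map_mul, Complex.conj_conj]
    ring
  have h2 : ∀ k, Summable fun m => x (m + k) * (starRingEnd ℂ) (x m) := fun k =>
    Summable.of_norm_bounded (x.summable_norm.mul_left ‖x‖) fun m => by
      rw [norm_mul, RCLike.norm_conj]
      exact mul_le_mul_of_nonneg_right (x.norm_apply_le _) (norm_nonneg _)
  have h0' : Summable fun q : Triple => (x (q.2.1 + q.1) * (starRingEnd ℂ) (x q.2.1)) *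
      (starRingEnd ℂ) (x (q.2.2 + q.1) * (starRingEnd ℂ) (x q.2.2)) := by
    refine h0.congr fun q => ?_
    have : triOut (e q) = q.2.2 + q.1 := by simp only [triOut, e, Equiv.coe_fn_mk]; abel
    simp only [Function.comp, this]
    simp only [e, mono, Equiv.coe_fn_mk, map_mul, Complex.conj_conj]
    ring
  rw [h1, h0'.tsum_prod]
  have h3 : ∀ k, ∑' c : Z2 × Z2, (x (c.1 + k) * (starRingEnd ℂ) (x c.1)) *
      (starRingEnd ℂ) (x (c.2 + k) * (starRingEnd ℂ) (x c.2)) =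
      ((‖∑' m, x (m + k) * (starRingEnd ℂ) (x m)‖ ^ 2 : ℝ) : ℂ) := fun k => by
    rw [Complex.ofReal_pow, ← Complex.mul_conj', Complex.conj_tsum]
    have h4 : Summable fun m => ‖(starRingEnd ℂ) (x (m + k) * (starRingEnd ℂ) (x m))‖ := by
      simpa using (h2 k).norm
    exact (tsum_mul_tsum_of_summable_norm (h2 k).norm h4).symm
  simp only [h3]
  rw [← Complex.ofReal_tsum, Complex.ofReal_re]
  exact tsum_nonneg fun k => by positivity

/-- The size of a frequency, at least `1`. -/
def size (n : Z2) : ℝ := 1 + |(n.1 : ℝ)| + |(n.2 : ℝ)|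

lemma one_le_size (n : Z2) : 1 ≤ size n := by
  unfold size; linarith [abs_nonneg (n.1 : ℝ), abs_nonneg (n.2 : ℝ)]

lemma nsq_nonneg (n : Z2) : 0 ≤ nsq n := by unfold nsq; positivity

lemma one_add_nsq_le (n : Z2) : 1 + nsq n ≤ size n ^ 2 := by
  unfold nsq size
  rw [← sq_abs (n.1 : ℝ), ← sq_abs (n.2 : ℝ)]
  nlinarith [abs_nonneg (n.1 : ℝ), abs_nonneg (n.2 : ℝ),
    mul_nonneg (abs_nonneg (n.1 : ℝ)) (abs_nonneg (n.2 : ℝ))]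

lemma size_triOut_le (p : Triple) :
    size (triOut p) + 2 ≤ size p.1 + size p.2.1 + size p.2.2 := by
  have h : ∀ a b c : ℝ, |a - b + c| ≤ |a| + |b| + |c| := fun a b c =>
    (abs_add_le _ _).trans (add_le_add_left (abs_sub _ _) _)
  have h1 := h (p.1.1 : ℝ) p.2.1.1 p.2.2.1
  have h2 := h (p.1.2 : ℝ) p.2.1.2 p.2.2.2
  simp only [size, triOut, Prod.fst_add, Prod.fst_sub, Prod.snd_add, Prod.snd_sub, Int.cast_add,
    Int.cast_sub]
  linarith

lemma size_triOut_le_mul (p : Triple) :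
    size (triOut p) ≤ size p.1 * (size p.2.1 * size p.2.2) := by
  have h := size_triOut_le p
  have h1 := one_le_size p.1
  have h2 := one_le_size p.2.1
  have h3 := one_le_size p.2.2
  have h4 : size p.2.1 + size p.2.2 - 1 ≤ size p.2.1 * size p.2.2 := by nlinarith
  nlinarith [mul_le_mul h1 h4 (by linarith) (by linarith)]

/-- The polynomial weight. -/
def wt (r : ℕ) (n : Z2) : ℝ := size n ^ r

lemma one_le_wt (r : ℕ) (n : Z2) : 1 ≤ wt r n := one_le_pow₀ (one_le_size n)

lemma wt_pos (r : ℕ) (n : Z2) : 0 < wt r n := one_pos.trans_le (one_le_wt r n)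

lemma wt_triOut_le_mul (r : ℕ) (p : Triple) :
    wt r (triOut p) ≤ wt r p.1 * (wt r p.2.1 * wt r p.2.2) := by
  simp only [wt, ← mul_pow]
  exact pow_le_pow_left₀ (zero_le_one.trans (one_le_size _)) (size_triOut_le_mul p) r

lemma wt_triOut_le_add (r : ℕ) (p : Triple) :
    wt r (triOut p) ≤ 3 ^ r * (wt r p.1 + wt r p.2.1 + wt r p.2.2) := by
  have h := size_triOut_le p
  have h0 := one_le_size (triOut p)
  have key : ∀ n, size (triOut p) ≤ 3 * size n → wt r (triOut p) ≤ 3 ^ r * wt r n := fun n hn => by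
    simp only [wt, ← mul_pow]
    exact pow_le_pow_left₀ (by linarith) hn r
  have hp := fun n => (wt_pos r n).le
  have h3 : (0 : ℝ) ≤ 3 ^ r := by positivity
  rcases le_total (size p.1) (size p.2.1) with h1 | h1 <;>
  rcases le_total (size p.2.1) (size p.2.2) with h2 | h2 <;>
  rcases le_total (size p.1) (size p.2.2) with h4 | h4
  all_goals first
    | exact (key p.1 (by linarith)).trans (mul_le_mul_of_nonneg_left
        (by linarith [hp p.1, hp p.2.1, hp p.2.2]) h3)
    | exact (key p.2.1 (by linarith)).trans (mul_le_mul_of_nonneg_left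
        (by linarith [hp p.1, hp p.2.1, hp p.2.2]) h3)
    | exact (key p.2.2 (by linarith)).trans (mul_le_mul_of_nonneg_left
        (by linarith [hp p.1, hp p.2.1, hp p.2.2]) h3)

/-- The resonance function. -/
def resonance (p : Triple) : ℝ := nsq p.1 - nsq p.2.1 + nsq p.2.2 - nsq (triOut p)

/-- The oscillating kernel of the interaction picture. -/
def osc (t : ℝ) (p : Triple) : ℂ := Complex.exp ((resonance p * t : ℝ) * Complex.I)

lemma norm_osc (t : ℝ) (p : Triple) : ‖osc t p‖ = 1 := Complex.norm_exp_ofReal_mul_I _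

/-- The oscillating kernel in the weighted variables. -/
def kern (r : ℕ) (t : ℝ) (p : Triple) : ℂ :=
  osc t p * ((wt r (triOut p) / (wt r p.1 * (wt r p.2.1 * wt r p.2.2)) : ℝ) : ℂ)

lemma norm_kern (r : ℕ) (t : ℝ) (p : Triple) :
    ‖kern r t p‖ = wt r (triOut p) / (wt r p.1 * (wt r p.2.1 * wt r p.2.2)) := by
  have h := wt_pos r
  rw [kern, norm_mul, norm_osc, one_mul, Complex.norm_real, Real.norm_of_nonneg]
  have := h (triOut p); have := h p.1; have := h p.2.1; have := h p.2.2
  positivity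

lemma norm_kern_le (r : ℕ) (t : ℝ) (p : Triple) : ‖kern r t p‖ ≤ 1 := by
  have h := wt_pos r
  rw [norm_kern]
  exact div_le_one_of_le₀ (wt_triOut_le_mul r p)
    (mul_pos (h _) (mul_pos (h _) (h _))).le

lemma continuous_kern (r : ℕ) (p : Triple) : Continuous fun t => kern r t p := by
  unfold kern osc; fun_prop

/-- The linear propagator divided by the weight. -/
def propCoef (r : ℕ) (t : ℝ) (n : Z2) : ℂ :=
  Complex.exp ((nsq n * t : ℝ) * Complex.I) / (wt r n : ℂ)

lemma norm_propCoef (r : ℕ) (t : ℝ) (n : Z2) : ‖propCoef r t n‖ = 1 / wt r n := by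
  rw [propCoef, norm_div, Complex.norm_exp_ofReal_mul_I, Complex.norm_real,
    Real.norm_of_nonneg (wt_pos r n).le]

lemma norm_propCoef_le (r : ℕ) (t : ℝ) (n : Z2) : ‖propCoef r t n‖ ≤ 1 := by
  rw [norm_propCoef]
  exact div_le_one_of_le₀ (one_le_wt r n) (wt_pos r n).le

/-- The linear propagator, acting on weighted sequences. -/
def prop (r : ℕ) (t : ℝ) : Ell1 →L[ℝ] Ell1 := Ell1.diag (propCoef r t) 1 (norm_propCoef_le r t)

lemma prop_apply (r : ℕ) (t : ℝ) (x : Ell1) (n : Z2) :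
    prop r t x n = propCoef r t n * x n := rfl

lemma nsq_sq_le_wt {r : ℕ} (hr : 4 ≤ r) (n : Z2) : nsq n ^ 2 ≤ wt r n := by
  have h := one_add_nsq_le n
  have h0 := nsq_nonneg n
  calc nsq n ^ 2 ≤ (size n ^ 2) ^ 2 := pow_le_pow_left₀ h0 (by linarith) 2
    _ = size n ^ 4 := by ring
    _ ≤ wt r n := pow_le_pow_right₀ (one_le_size n) hr

lemma one_add_nsq_le_wt {r : ℕ} (hr : 2 ≤ r) (n : Z2) : 1 + nsq n ≤ wt r n :=
  (one_add_nsq_le n).trans (pow_le_pow_right₀ (one_le_size n) hr)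

lemma norm_deriv_propCoef_le {r : ℕ} (hr : 4 ≤ r) (t : ℝ) (n : Z2) :
    ‖Complex.I * nsq n * propCoef r t n‖ ≤ 1 := by
  rw [norm_mul, norm_mul, Complex.norm_I, one_mul, Complex.norm_real, norm_propCoef,
    Real.norm_of_nonneg (nsq_nonneg n), mul_one_div]
  exact div_le_one_of_le₀ (by linarith [one_add_nsq_le_wt (r := r) (by omega) n]) (wt_pos r n).le

lemma norm_exp_mul_I_sub_le (x : ℝ) :
    ‖Complex.exp (x * Complex.I) - 1 - x * Complex.I‖ ≤ 3 * x ^ 2 := by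
  rcases le_or_gt |x| 1 with h | h
  · have hn : ‖(x : ℂ) * Complex.I‖ = |x| := by simp
    have := Complex.norm_exp_sub_one_sub_id_le (x := x * Complex.I) (by rw [hn]; exact h)
    rw [hn, sq_abs] at this
    nlinarith [sq_nonneg x]
  · have h1 : ‖Complex.exp (x * Complex.I) - 1 - x * Complex.I‖ ≤ 1 + 1 + |x| := by
      refine (norm_sub_le _ _).trans (add_le_add ((norm_sub_le _ _).trans ?_) ?_)
      · rw [Complex.norm_exp_ofReal_mul_I, norm_one]
      · simp
    rw [← sq_abs]
    nlinarith

lemma hasDerivAt_prop {r : ℕ} (hr : 4 ≤ r) (t : ℝ) :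
    HasDerivAt (prop r) (Ell1.diag (fun n => Complex.I * nsq n * propCoef r t n) 1
      (norm_deriv_propCoef_le hr t)) t := by
  rw [hasDerivAt_iff_isLittleO]
  refine Asymptotics.IsBigO.trans_isLittleO (g := fun τ => (τ - t) ^ 2) ?_ ?_
  · refine Asymptotics.IsBigO.of_bound 3 (Eventually.of_forall fun τ => ?_)
    refine ContinuousLinearMap.opNorm_le_bound _ (by positivity) fun x => ?_
    rw [Ell1.norm_eq, Ell1.norm_eq, ← tsum_mul_left]
    refine Summable.tsum_le_tsum (fun n => ?_) (Ell1.summable_norm _)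
      (x.summable_norm.mul_left _)
    have e : (prop r τ - prop r t - (τ - t) • Ell1.diag
        (fun n => Complex.I * nsq n * propCoef r t n) 1 (norm_deriv_propCoef_le hr t)) x n =
        propCoef r t n * (Complex.exp ((nsq n * (τ - t) : ℝ) * Complex.I) - 1 -
          (nsq n * (τ - t) : ℝ) * Complex.I) * x n := by
      change propCoef r τ n * x n - propCoef r t n * x n -
        ((τ - t : ℝ) : ℂ) * (Complex.I * nsq n * propCoef r t n * x n) = _
      have : propCoef r τ n =
          propCoef r t n * Complex.exp ((nsq n * (τ - t) : ℝ) * Complex.I) := by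
        unfold propCoef
        rw [div_mul_eq_mul_div, ← Complex.exp_add]
        congr 2
        push_cast; ring
      rw [this]
      push_cast; ring
    rw [e, norm_mul, norm_mul, norm_propCoef]
    refine mul_le_mul_of_nonneg_right ?_ (norm_nonneg _)
    have hw := wt_pos r n
    calc 1 / wt r n * _ ≤ 1 / wt r n * (3 * (nsq n * (τ - t)) ^ 2) :=
          mul_le_mul_of_nonneg_left (norm_exp_mul_I_sub_le _) (by positivity)
      _ = nsq n ^ 2 / wt r n * (3 * (τ - t) ^ 2) := by ring
      _ ≤ 1 * (3 * (τ - t) ^ 2) := by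
          gcongr
          exact div_le_one_of_le₀ (nsq_sq_le_wt hr n) hw.le
      _ = 3 * ‖(τ - t) ^ 2‖ := by rw [one_mul, Real.norm_of_nonneg (sq_nonneg _)]
  · have : (fun τ : ℝ => (τ - t) ^ 2) = fun τ => (τ - t) * (τ - t) := by ext; ring
    rw [this]
    refine Asymptotics.IsLittleO.of_norm_left ?_
    have h2 : Tendsto (fun τ : ℝ => τ - t) (𝓝 t) (𝓝 0) := by
      have : Continuous fun τ : ℝ => τ - t := by fun_prop
      simpa using this.tendsto t
    have h3 := ((Asymptotics.isLittleO_one_iff ℝ).mpr h2).mul_isBigO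
      (Asymptotics.isBigO_refl (fun τ : ℝ => τ - t) (𝓝 t))
    simpa using h3

/-- Passing to the Schrödinger picture removes the oscillating kernel. -/
lemma kern_mul_mono (r : ℕ) (t : ℝ) (x y z : Ell1) (p : Triple) :
    kern r t p * mono x y z p * propCoef r t (triOut p) =
      mono (prop r t x) (prop r t y) (prop r t z) p := by
  have h := fun n => Complex.ofReal_ne_zero.mpr (wt_pos r n).ne'
  simp only [mono, prop_apply, propCoef, kern, osc, map_mul, map_div₀, Complex.conj_ofReal,
    ← Complex.exp_conj, Complex.conj_I]
  have e : Complex.exp ((resonance p * t : ℝ) * Complex.I) *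
      Complex.exp ((nsq (triOut p) * t : ℝ) * Complex.I) =
      Complex.exp ((nsq p.1 * t : ℝ) * Complex.I) *
      Complex.exp ((nsq p.2.1 * t : ℝ) * -Complex.I) *
      Complex.exp ((nsq p.2.2 * t : ℝ) * Complex.I) := by
    simp only [← Complex.exp_add]
    congr 1
    simp only [resonance]
    push_cast; ring
  have h1 := h p.1
  have h2 := h p.2.1
  have h3 := h p.2.2
  have h4 := h (triOut p)
  generalize Complex.exp ((resonance p * t : ℝ) * Complex.I) = e0 at e ⊢
  generalize Complex.exp ((nsq (triOut p) * t : ℝ) * Complex.I) = e1 at e ⊢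
  generalize Complex.exp ((nsq p.1 * t : ℝ) * Complex.I) = e2 at e ⊢
  generalize Complex.exp ((nsq p.2.1 * t : ℝ) * -Complex.I) = e3 at e ⊢
  generalize Complex.exp ((nsq p.2.2 * t : ℝ) * Complex.I) = e4 at e ⊢
  push_cast
  field_simp
  linear_combination x p.1 * (starRingEnd ℂ) (y p.2.1) * z p.2.2 * e

lemma prop_tri (r : ℕ) (t : ℝ) (x y z : Ell1) :
    prop r t (tri (kern r t) x y z) =
      tri (fun _ => 1) (prop r t x) (prop r t y) (prop r t z) := by
  ext n
  rw [prop_apply, tri_apply (summable_kernel_mono (norm_kern_le r t) x y z),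
    tri_apply (summable_kernel_mono (C := 1) (by simp) _ _ _), ← tsum_mul_left]
  refine tsum_congr fun p => ?_
  have hp : triOut p.1 = n := p.2
  rw [one_mul, ← kern_mul_mono, hp]
  ring

lemma Ell1.summable_mul (x : Ell1) {g : Z2 → ℂ} {C : ℝ} (hg : ∀ n, ‖g n‖ ≤ C) :
    Summable fun n => x n * g n :=
  Summable.of_norm_bounded (x.summable_norm.mul_right C) fun n => by
    rw [norm_mul]; exact mul_le_mul_of_nonneg_left (hg n) (norm_nonneg _)

/-- The multiplier of the `H¹` form in the weighted variables. -/
def kinCoef (r : ℕ) (n : Z2) : ℝ := (1 + nsq n) / wt r n ^ 2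

lemma kinCoef_nonneg (r : ℕ) (n : Z2) : 0 ≤ kinCoef r n :=
  div_nonneg (by linarith [nsq_nonneg n]) (sq_nonneg _)

lemma kinCoef_le {r : ℕ} (hr : 4 ≤ r) (n : Z2) : kinCoef r n ≤ 1 := by
  have h1 := one_le_wt r n
  have h2 := one_add_nsq_le_wt (r := r) (by omega) n
  exact div_le_one_of_le₀ (by nlinarith) (sq_nonneg _)

lemma norm_kinCoef_mul_le {r : ℕ} (hr : 4 ≤ r) (y : Ell1) (n : Z2) :
    ‖(kinCoef r n : ℂ) * (starRingEnd ℂ) (y n)‖ ≤ ‖y‖ := by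
  rw [norm_mul, RCLike.norm_conj, Complex.norm_real, Real.norm_of_nonneg (kinCoef_nonneg r n)]
  exact (mul_le_of_le_one_left (norm_nonneg _) (kinCoef_le hr n)).trans (y.norm_apply_le n)

/-- The `H¹` form in the weighted variables. -/
def kinForm (r : ℕ) (x y : Ell1) : ℂ := ∑' n, x n * (kinCoef r n * (starRingEnd ℂ) (y n))

lemma summable_kinForm {r : ℕ} (hr : 4 ≤ r) (x y : Ell1) :
    Summable fun n => x n * (kinCoef r n * (starRingEnd ℂ) (y n)) :=
  x.summable_mul (norm_kinCoef_mul_le hr y)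

lemma norm_kinForm_le {r : ℕ} (hr : 4 ≤ r) (x y : Ell1) : ‖kinForm r x y‖ ≤ ‖x‖ * ‖y‖ := by
  rw [Ell1.norm_eq x, ← tsum_mul_right]
  refine tsum_of_norm_bounded (x.summable_norm.mul_right _).hasSum fun n => ?_
  rw [norm_mul]
  exact mul_le_mul_of_nonneg_left (norm_kinCoef_mul_le hr y n) (norm_nonneg _)

/-- The real part of the `H¹` form as a continuous bilinear map. -/
def kinBilin {r : ℕ} (hr : 4 ≤ r) : Ell1 →L[ℝ] Ell1 →L[ℝ] ℝ :=
  LinearMap.mkContinuous₂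
    (LinearMap.mk₂ ℝ (fun x y => (kinForm r x y).re)
      (fun x x' y => by
        rw [← Complex.add_re, kinForm, kinForm, kinForm,
          ← Summable.tsum_add (summable_kinForm hr _ _) (summable_kinForm hr _ _)]
        simp only [Ell1.add_apply, add_mul])
      (fun c x y => by
        rw [smul_eq_mul, ← Complex.re_ofReal_mul, kinForm, kinForm, ← tsum_mul_left]
        simp only [Ell1.real_smul_apply, mul_assoc])
      (fun x y y' => by
        rw [← Complex.add_re, kinForm, kinForm, kinForm,
          ← Summable.tsum_add (summable_kinForm hr _ _) (summable_kinForm hr _ _)]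
        simp only [Ell1.add_apply, map_add, mul_add])
      (fun c x y => by
        rw [smul_eq_mul, ← Complex.re_ofReal_mul, kinForm, kinForm, ← tsum_mul_left]
        simp only [Ell1.real_smul_apply, map_mul, Complex.conj_ofReal]
        congr 2
        ext n
        ring))
    1 fun x y => by
      rw [one_mul]
      exact (Complex.abs_re_le_norm _).trans (norm_kinForm_le hr x y)

lemma kinBilin_apply {r : ℕ} (hr : 4 ≤ r) (x y : Ell1) :
    kinBilin hr x y = (kinForm r x y).re := rfl

lemma kinForm_re_comm (r : ℕ) (x y : Ell1) : (kinForm r x y).re = (kinForm r y x).re := by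
  rw [← Complex.conj_re, kinForm, Complex.conj_tsum]
  congr 1
  refine tsum_congr fun n => ?_
  simp only [map_mul, Complex.conj_conj, Complex.conj_ofReal]
  ring

lemma hasDerivAt_kinForm_self {r : ℕ} (hr : 4 ≤ r) {c : ℝ → Ell1} {D : Ell1} {t : ℝ}
    (h : HasDerivAt c D t) :
    HasDerivAt (fun τ => (kinForm r (c τ) (c τ)).re) (2 * (kinForm r D (c t)).re) t := by
  refine ((kinBilin hr).hasDerivAt_of_bilinear (fun _ => h) (fun _ => h)).congr_deriv ?_
  rw [kinBilin_apply, kinBilin_apply, kinForm_re_comm]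
  ring

lemma kinForm_self (r : ℕ) (x : Ell1) :
    (kinForm r x x).re = ∑' n, kinCoef r n * ‖x n‖ ^ 2 := by
  have : kinForm r x x = ((∑' n, kinCoef r n * ‖x n‖ ^ 2 : ℝ) : ℂ) := by
    rw [Complex.ofReal_tsum]
    refine tsum_congr fun n => ?_
    push_cast
    rw [← Complex.mul_conj']
    ring
  rw [this, Complex.ofReal_re]

/-- The weighted equation of the interaction picture. -/
def weightedField (r : ℕ) (t : ℝ) (x : Ell1) : Ell1 := Complex.I • tri (kern r t) x x x

lemma hasDerivAt_prop_apply {r : ℕ} (hr : 4 ≤ r) {c : ℝ → Ell1} {t : ℝ}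
    (h : HasDerivAt c (weightedField r t (c t)) t) :
    ∃ D : Ell1, HasDerivAt (fun τ => prop r τ (c τ)) D t ∧ ∀ n, D n =
      Complex.I * (nsq n * prop r t (c t) n + tri (fun _ => 1) (prop r t (c t))
        (prop r t (c t)) (prop r t (c t)) n) := by
  refine ⟨_, (hasDerivAt_prop hr t).clm_apply h, fun n => ?_⟩
  rw [Ell1.add_apply, Ell1.diag_apply, prop_apply, weightedField, Ell1.smul_apply, prop_apply,
    ← prop_tri, prop_apply]
  ring

/-- The conserved quantity: mass plus energy. -/
def energy (r : ℕ) (t : ℝ) (x : Ell1) : ℝ :=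
  (kinForm r x x).re +
    1 / 2 * (quart (prop r t x) (prop r t x) (prop r t x) (prop r t x)).re

lemma hasDerivAt_energy {r : ℕ} (hr : 4 ≤ r) {c : ℝ → Ell1} {t : ℝ}
    (h : HasDerivAt c (weightedField r t (c t)) t) :
    HasDerivAt (fun τ => energy r τ (c τ)) 0 t := by
  obtain ⟨D, hD, hDn⟩ := hasDerivAt_prop_apply hr h
  refine ((hasDerivAt_kinForm_self hr h).add
    ((hasDerivAt_quart_self hD).const_mul (1 / 2))).congr_deriv ?_
  set a := prop r t (c t) with ha
  set N := tri (fun _ => 1) a a a with hN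
  have hsum := summable_kernel_mono (κ := fun _ => 1) (C := 1) (by simp) a a a
  have hq : ∀ v : Ell1, quart a a a v = ∑' n, N n * (starRingEnd ℂ) (v n) := fun v => by
    rw [pairing_tri (C := ‖v‖) (fun n => by rw [RCLike.norm_conj]; exact v.norm_apply_le n) hsum]
    exact tsum_congr fun p => by rw [one_mul]
  have hs : ∀ v : Ell1, Summable fun n => N n * (starRingEnd ℂ) (v n) := fun v =>
    N.summable_mul (C := ‖v‖) fun n => by rw [RCLike.norm_conj]; exact v.norm_apply_le n
  have key : kinForm r (weightedField r t (c t)) (c t) + quart a a a D =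
      Complex.I * quart a a a a + -Complex.I * quart a a a N := by
    rw [hq, hq, hq, kinForm, ← tsum_mul_left, ← tsum_mul_left,
      ← Summable.tsum_add (summable_kinForm hr _ _) (hs D),
      ← Summable.tsum_add ((hs a).mul_left _) ((hs N).mul_left _)]
    refine tsum_congr fun n => ?_
    have hw := Complex.ofReal_ne_zero.mpr (wt_pos r n).ne'
    have e1 : weightedField r t (c t) n * (kinCoef r n * (starRingEnd ℂ) (c t n)) =
        Complex.I * (1 + nsq n) * N n * (starRingEnd ℂ) (a n) := by
      have hp : propCoef r t n * (starRingEnd ℂ) (propCoef r t n) = 1 / (wt r n : ℂ) ^ 2 := by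
        rw [Complex.mul_conj', norm_propCoef]
        push_cast
        ring
      have hk : (kinCoef r n : ℂ) = (1 + nsq n) *
          (propCoef r t n * (starRingEnd ℂ) (propCoef r t n)) := by
        rw [hp, kinCoef]
        push_cast
        ring
      rw [hN, ha, ← prop_tri, prop_apply, prop_apply, weightedField, Ell1.smul_apply, map_mul, hk]
      ring
    rw [e1, hDn]
    simp only [map_mul, map_add, Complex.conj_I, Complex.conj_ofReal]
    ring
  have h1 : (Complex.I * quart a a a a).re = 0 := by
    rw [Complex.I_mul_re, quart_self_im, neg_zero]
  have h2 : (-Complex.I * quart a a a N).re = 0 := by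
    rw [neg_mul, Complex.neg_re, Complex.I_mul_re, neg_neg, hq]
    have : ∑' n, N n * (starRingEnd ℂ) (N n) = ((∑' n, ‖N n‖ ^ 2 : ℝ) : ℂ) := by
      rw [Complex.ofReal_tsum]
      exact tsum_congr fun n => by rw [Complex.mul_conj']; push_cast; ring
    rw [this, Complex.ofReal_im]
  have h3 := congrArg Complex.re key
  rw [Complex.add_re, Complex.add_re, h1, h2] at h3
  linarith

lemma sum_kinCoef_le_energy {r : ℕ} (t : ℝ) (x : Ell1) :
    ∑' n, kinCoef r n * ‖x n‖ ^ 2 ≤ energy r t x := by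
  rw [energy, kinForm_self]
  linarith [quart_self_nonneg (prop r t x)]

lemma summable_kinCoef {r : ℕ} (hr : 4 ≤ r) (x : Ell1) :
    Summable fun n => kinCoef r n * ‖x n‖ ^ 2 := by
  refine (summable_kinForm hr x x).norm.congr fun n => ?_
  rw [norm_mul, norm_mul, RCLike.norm_conj, Complex.norm_real,
    Real.norm_of_nonneg (kinCoef_nonneg r n)]
  ring

lemma size_sq_le (n : Z2) : size n ^ 2 ≤ 3 * (1 + nsq n) := by
  unfold size nsq
  rw [← sq_abs (n.1 : ℝ), ← sq_abs (n.2 : ℝ)]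
  nlinarith [sq_nonneg (|(n.1 : ℝ)| - |(n.2 : ℝ)|), sq_nonneg (|(n.1 : ℝ)| - 1),
    sq_nonneg (|(n.2 : ℝ)| - 1)]

/-- The dyadic box of frequencies. -/
def box (J : ℕ) : Finset Z2 := Finset.Icc (-2 ^ J) (2 ^ J) ×ˢ Finset.Icc (-2 ^ J) (2 ^ J)

lemma card_box (J : ℕ) : ((box J).card : ℝ) = (2 * 2 ^ J + 1) ^ 2 := by
  have h : ((2 ^ J + 1 - -2 ^ J : ℤ).toNat : ℝ) = 2 * 2 ^ J + 1 := by
    have h0 : (0 : ℤ) ≤ 2 ^ J + 1 - -2 ^ J := by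
      have : (0 : ℤ) < 2 ^ J := by positivity
      omega
    have h1 := Int.toNat_of_nonneg h0
    have h2 : (((2 ^ J + 1 - -2 ^ J : ℤ).toNat : ℤ) : ℝ) = ((2 ^ J + 1 - -2 ^ J : ℤ) : ℝ) := by
      rw [h1]
    push_cast at h2
    rw [h2]; ring
  rw [box, Finset.card_product, Int.card_Icc, Nat.cast_mul, h]
  ring

lemma two_pow_le_size {J : ℕ} {n : Z2} (hn : n ∉ box J) : (2 : ℝ) ^ J ≤ size n := by
  by_contra! h
  refine hn ?_
  have h1 : |(n.1 : ℝ)| ≤ 2 ^ J := by unfold size at h; linarith [abs_nonneg (n.2 : ℝ)]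
  have h2 : |(n.2 : ℝ)| ≤ 2 ^ J := by unfold size at h; linarith [abs_nonneg (n.1 : ℝ)]
  have h3 : |n.1| ≤ 2 ^ J := by exact_mod_cast h1
  have h4 : |n.2| ≤ 2 ^ J := by exact_mod_cast h2
  simp only [box, Finset.mem_product, Finset.mem_Icc]
  exact ⟨abs_le.mp h3, abs_le.mp h4⟩

lemma sum_box_inv_size_sq_le (J : ℕ) : ∑ n ∈ box J, (size n ^ 2)⁻¹ ≤ 9 + 25 * J := by
  have hle : ∀ n, (size n ^ 2)⁻¹ ≤ 1 := fun n =>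
    inv_le_one_of_one_le₀ (one_le_pow₀ (one_le_size n))
  induction J with
  | zero =>
    calc ∑ n ∈ box 0, (size n ^ 2)⁻¹ ≤ ∑ n ∈ box 0, 1 := Finset.sum_le_sum fun n _ => hle n
      _ = ((box 0).card : ℝ) := by simp
      _ ≤ _ := by rw [card_box]; norm_num
  | succ J ih =>
    have hsub : box J ⊆ box (J + 1) := by
      have h : (2 : ℤ) ^ J ≤ 2 ^ (J + 1) := by gcongr <;> simp
      intro n hn
      simp only [box, Finset.mem_product, Finset.mem_Icc] at hn ⊢
      omega
    rw [← Finset.sum_sdiff hsub]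
    have h2 : (0 : ℝ) < 2 ^ J := by positivity
    have h2' : (1 : ℝ) ≤ 2 ^ J := one_le_pow₀ (by norm_num)
    have : ∑ n ∈ box (J + 1) \ box J, (size n ^ 2)⁻¹ ≤ 25 := by
      calc _ ≤ ∑ n ∈ box (J + 1) \ box J, (((2 : ℝ) ^ J) ^ 2)⁻¹ := by
            refine Finset.sum_le_sum fun n hn => ?_
            have := two_pow_le_size (Finset.mem_sdiff.mp hn).2
            gcongr
        _ ≤ ∑ n ∈ box (J + 1), (((2 : ℝ) ^ J) ^ 2)⁻¹ :=
            Finset.sum_le_sum_of_subset_of_nonneg Finset.sdiff_subset fun _ _ _ => by positivity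
        _ = (2 * 2 ^ (J + 1) + 1) ^ 2 * (((2 : ℝ) ^ J) ^ 2)⁻¹ := by
            rw [Finset.sum_const, nsmul_eq_mul, card_box]
        _ ≤ 25 := by
            rw [← div_eq_mul_inv, div_le_iff₀ (by positivity), pow_succ 2 J]
            nlinarith
    push_cast
    linarith

lemma Ell1.norm_prop_eq (r : ℕ) (t : ℝ) (x : Ell1) : ‖prop r t x‖ = ∑' n, ‖x n‖ / wt r n := by
  rw [Ell1.norm_eq]
  refine tsum_congr fun n => ?_
  rw [prop_apply, norm_mul, norm_propCoef]
  ring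

/-- A logarithmic bound for the `ℓ¹` norm in terms of the `H¹` norm. -/
lemma sq_norm_prop_le {r : ℕ} (hr : 4 ≤ r) (t : ℝ) {x : Ell1} {E : ℝ}
    (hE : ∑' n, kinCoef r n * ‖x n‖ ^ 2 ≤ E) :
    ‖prop r t x‖ ^ 2 ≤ (2 + 300 * E) * (1 + Real.log (1 + ‖x‖)) := by
  have hE0 : 0 ≤ E :=
    (tsum_nonneg fun n => mul_nonneg (kinCoef_nonneg r n) (sq_nonneg _)).trans hE
  have hw := wt_pos r
  set L := Real.log (1 + ‖x‖) with hL
  have hL0 : 0 ≤ L := Real.log_nonneg (by linarith [norm_nonneg x])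
  obtain ⟨J, hJ1, hJ2⟩ : ∃ J : ℕ, ‖x‖ ≤ 2 ^ J ∧ (J : ℝ) ≤ 1 + 2 * L := by
    refine ⟨⌈2 * L⌉₊, ?_, ?_⟩
    · have h1 : (2 * L) ≤ ⌈2 * L⌉₊ := Nat.le_ceil _
      have h2 : (1 : ℝ) / 2 ≤ Real.log 2 := by linarith [Real.log_two_gt_d9]
      have h3 : L ≤ ⌈2 * L⌉₊ * Real.log 2 := by nlinarith
      calc ‖x‖ ≤ 1 + ‖x‖ := by linarith
        _ = Real.exp L := (Real.exp_log (by linarith [norm_nonneg x])).symm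
        _ ≤ Real.exp (⌈2 * L⌉₊ * Real.log 2) := Real.exp_le_exp.mpr h3
        _ = 2 ^ ⌈2 * L⌉₊ := by
            rw [Real.exp_nat_mul, Real.exp_log (by norm_num)]
    · linarith [Nat.ceil_lt_add_one (show 0 ≤ 2 * L by positivity)]
  have hb : Summable fun n => ‖x n‖ / wt r n :=
    Summable.of_nonneg_of_le (fun n => div_nonneg (norm_nonneg _) (hw n).le)
      (fun n => div_le_self (norm_nonneg _) (one_le_wt r n)) x.summable_norm
  have hlow : (∑ n ∈ box J, ‖x n‖ / wt r n) ^ 2 ≤ 3 * E * (9 + 25 * J) := by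
    have h1 := Finset.sum_sq_le_sum_mul_sum_of_sq_eq_mul (box J) (r := fun n => ‖x n‖ / wt r n)
      (f := fun n => size n ^ 2 * (‖x n‖ / wt r n) ^ 2) (g := fun n => (size n ^ 2)⁻¹)
      (fun n _ => by positivity) (fun n _ => by positivity) (fun n _ => by
        have := one_le_size n
        have : size n ^ 2 ≠ 0 := by positivity
        field_simp)
    have h2 : ∑ n ∈ box J, size n ^ 2 * (‖x n‖ / wt r n) ^ 2 ≤ 3 * E := by
      calc _ ≤ ∑ n ∈ box J, 3 * (kinCoef r n * ‖x n‖ ^ 2) := by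
            refine Finset.sum_le_sum fun n _ => ?_
            have h := size_sq_le n
            have h0 : 0 ≤ (‖x n‖ / wt r n) ^ 2 := sq_nonneg _
            calc _ ≤ 3 * (1 + nsq n) * (‖x n‖ / wt r n) ^ 2 := mul_le_mul_of_nonneg_right h h0
              _ = _ := by unfold kinCoef; rw [div_pow]; ring
        _ = 3 * ∑ n ∈ box J, kinCoef r n * ‖x n‖ ^ 2 := (Finset.mul_sum _ _ _).symm
        _ ≤ 3 * E := by
            have := (summable_kinCoef hr x).sum_le_tsum (box J)
              fun n _ => mul_nonneg (kinCoef_nonneg r n) (sq_nonneg _)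
            linarith
    calc _ ≤ _ := h1
      _ ≤ 3 * E * (9 + 25 * J) := mul_le_mul h2 (sum_box_inv_size_sq_le J)
          (Finset.sum_nonneg fun n _ => by positivity) (by positivity)
  have htail : ∑' n : {n // n ∉ box J}, ‖x n‖ / wt r n ≤ 1 := by
    have h2 : (0 : ℝ) < 2 ^ J := by positivity
    calc _ ≤ ∑' n : {n // n ∉ box J}, ‖x n‖ / 2 ^ J := by
          refine Summable.tsum_le_tsum (fun n => ?_) (hb.subtype _)
            ((x.summable_norm.div_const _).subtype _)
          refine div_le_div_of_nonneg_left (norm_nonneg _) h2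
            ((two_pow_le_size n.2).trans ?_)
          exact le_self_pow₀ (one_le_size _) (by omega)
      _ ≤ ∑' n, ‖x n‖ / 2 ^ J :=
          (x.summable_norm.div_const _).tsum_subtype_le _ {n | n ∉ box J} (fun n => by positivity)
      _ = ‖x‖ / 2 ^ J := by rw [tsum_div_const, ← Ell1.norm_eq]
      _ ≤ 1 := div_le_one_of_le₀ hJ1 h2.le
  have hsplit : ‖prop r t x‖ ≤ (∑ n ∈ box J, ‖x n‖ / wt r n) + 1 := by
    rw [Ell1.norm_prop_eq, ← hb.sum_add_tsum_subtype_compl (box J)]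
    linarith
  have hn := norm_nonneg (prop r t x)
  set S := ∑ n ∈ box J, ‖x n‖ / wt r n
  have h5 : ‖prop r t x‖ ^ 2 ≤ 2 + 2 * S ^ 2 := by
    nlinarith [sq_nonneg (S - 1), pow_le_pow_left₀ hn hsplit 2]
  have h6 : 3 * E * (9 + 25 * J) ≤ 3 * E * (50 * (1 + L)) := by
    refine mul_le_mul_of_nonneg_left (by linarith) (by positivity)
  nlinarith

lemma norm_tri_kern_le (r : ℕ) (t : ℝ) (x : Ell1) :
    ‖tri (kern r t) x x x‖ ≤ 3 * 3 ^ r * ‖prop r t x‖ ^ 2 * ‖x‖ := by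
  have hw := wt_pos r
  have hb : Summable fun n => ‖x n‖ / wt r n :=
    Summable.of_nonneg_of_le (fun n => div_nonneg (norm_nonneg _) (hw n).le)
      (fun n => div_le_self (norm_nonneg _) (one_le_wt r n)) x.summable_norm
  have hb0 : (0 : Z2 → ℝ) ≤ fun n => ‖x n‖ / wt r n := fun n =>
    div_nonneg (norm_nonneg _) (hw n).le
  have hx := x.summable_norm
  have hx0 : (0 : Z2 → ℝ) ≤ fun n => ‖x n‖ := fun n => norm_nonneg _
  have H := (((hasSum_triple hx hb hb hx0 hb0 hb0).add (hasSum_triple hb hx hb hb0 hx0 hb0)).add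
    (hasSum_triple hb hb hx hb0 hb0 hx0)).mul_left (3 ^ r)
  rw [← Ell1.norm_prop_eq r t, ← Ell1.norm_eq] at H
  refine (norm_tri_le_of_hasSum H fun p => ?_).trans (le_of_eq (by ring))
  rw [norm_mul, norm_kern, norm_mono]
  have h1 := hw p.1
  have h2 := hw p.2.1
  have h3 := hw p.2.2
  calc _ = wt r (triOut p) *
        (‖x p.1‖ / wt r p.1 * (‖x p.2.1‖ / wt r p.2.1 * (‖x p.2.2‖ / wt r p.2.2))) := by
        field_simp
    _ ≤ 3 ^ r * (wt r p.1 + wt r p.2.1 + wt r p.2.2) *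
        (‖x p.1‖ / wt r p.1 * (‖x p.2.1‖ / wt r p.2.1 * (‖x p.2.2‖ / wt r p.2.2))) :=
        mul_le_mul_of_nonneg_right (wt_triOut_le_add r p) (by positivity)
    _ = _ := by field_simp

lemma norm_weightedField (r : ℕ) (t : ℝ) (x : Ell1) :
    ‖weightedField r t x‖ = ‖tri (kern r t) x x x‖ := by
  rw [weightedField, norm_smul, Complex.norm_I, one_mul]

/-- Double exponential bound from a logarithmic differential inequality. -/
lemma norm_le_exp_exp {c c' : ℝ → Ell1} {κ T : ℝ} (hκ : 0 ≤ κ)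
    (hc : ∀ t ∈ Ico 0 T, HasDerivAt c (c' t) t)
    (hb : ∀ t ∈ Ico 0 T, ‖c' t‖ ≤ κ * ((1 + Real.log (1 + ‖c t‖)) * ‖c t‖)) :
    ∀ t ∈ Ico 0 T, ‖c t‖ ≤ Real.exp (Real.exp ((3 * κ + 1) * T + ‖c 0‖)) := by
  intro t ht
  have hsub : Icc 0 t ⊆ Ico 0 T := fun x hx => ⟨hx.1, hx.2.trans_lt ht.2⟩
  set k := 3 * κ + 1 with hk
  have hk0 : 0 < k := by positivity
  have hB : ∀ x, HasDerivAt (fun x => Real.exp (Real.exp (k * x + ‖c 0‖)))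
      (Real.exp (Real.exp (k * x + ‖c 0‖)) * (Real.exp (k * x + ‖c 0‖) * k)) x := fun x => by
    have : HasDerivAt (fun x => k * x + ‖c 0‖) k x := by
      simpa using ((hasDerivAt_id x).const_mul k).add_const ‖c 0‖
    exact this.exp.exp
  have h := image_norm_le_of_norm_deriv_right_lt_deriv_boundary (f := c) (f' := c') (a := 0)
    (b := t) (fun x hx => (hc x (hsub hx)).continuousAt.continuousWithinAt)
    (fun x hx => (hc x (hsub ⟨hx.1, hx.2.le⟩)).hasDerivWithinAt)
    (B := fun x => Real.exp (Real.exp (k * x + ‖c 0‖)))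
    (B' := fun x => Real.exp (Real.exp (k * x + ‖c 0‖)) * (Real.exp (k * x + ‖c 0‖) * k))
    (by
      have h1 := Real.add_one_le_exp ‖c 0‖
      have h2 := Real.add_one_le_exp (Real.exp ‖c 0‖)
      simp only [mul_zero, zero_add]
      linarith) hB (fun x hx heq => by
      refine (hb x (hsub ⟨hx.1, hx.2.le⟩)).trans_lt ?_
      rw [heq]
      set y := Real.exp (k * x + ‖c 0‖) with hy
      have hy1 : 1 ≤ y := Real.one_le_exp (by have := hx.1; positivity)
      have hey : 1 ≤ Real.exp y := Real.one_le_exp (by linarith)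
      have hlog : Real.log (1 + Real.exp y) ≤ 1 + y := by
        rw [Real.log_le_iff_le_exp (by positivity), Real.exp_add]
        have := Real.add_one_le_exp (1 : ℝ)
        nlinarith
      have hpos : 0 < Real.exp y := Real.exp_pos y
      have h3 : κ * ((1 + Real.log (1 + Real.exp y)) * Real.exp y) ≤
          κ * (3 * y * Real.exp y) := by gcongr; linarith
      have h4 : 0 < Real.exp y * y := by positivity
      rw [hk]
      nlinarith)
  refine (h (right_mem_Icc.mpr ht.1)).trans ?_
  refine Real.exp_le_exp.mpr (Real.exp_le_exp.mpr ?_)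
  have := ht.2.le
  gcongr

lemma norm_solution_le {r : ℕ} (hr : 4 ≤ r) {c : ℝ → Ell1} {T : ℝ} (hT : 0 < T)
    (hc : ∀ t ∈ Ioo (-T) T, HasDerivAt c (weightedField r t (c t)) t) :
    ∀ t ∈ Ioo (-T) T, ‖c t‖ ≤ Real.exp (Real.exp
      ((3 * (3 * 3 ^ r * (2 + 300 * energy r 0 (c 0))) + 1) * T + ‖c 0‖)) := by
  set E := energy r 0 (c 0) with hE
  have h0 : (0 : ℝ) ∈ Ioo (-T) T := ⟨by linarith, hT⟩
  have hcons : ∀ t ∈ Ioo (-T) T, energy r t (c t) = E := fun t ht =>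
    isOpen_Ioo.is_const_of_fderiv_eq_zero (𝕜 := ℝ) (f := fun t => energy r t (c t))
      isPreconnected_Ioo
      (fun x hx => (hasDerivAt_energy hr (hc x hx)).differentiableAt.differentiableWithinAt)
      (fun x hx => by
        rw [(hasDerivAt_energy hr (hc x hx)).hasFDerivAt.fderiv]
        simp) ht h0
  have hE0 : 0 ≤ E := (tsum_nonneg fun n =>
    mul_nonneg (kinCoef_nonneg r n) (sq_nonneg _)).trans (sum_kinCoef_le_energy 0 (c 0))
  set κ := 3 * 3 ^ r * (2 + 300 * E) with hκ
  have hκ0 : 0 ≤ κ := by positivity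
  have hf : ∀ t ∈ Ioo (-T) T, ‖weightedField r t (c t)‖ ≤
      κ * ((1 + Real.log (1 + ‖c t‖)) * ‖c t‖) := fun t ht => by
    rw [norm_weightedField]
    refine (norm_tri_kern_le r t (c t)).trans ?_
    have h1 := sq_norm_prop_le hr t ((sum_kinCoef_le_energy t (c t)).trans (hcons t ht).le)
    calc _ ≤ 3 * 3 ^ r * ((2 + 300 * E) * (1 + Real.log (1 + ‖c t‖))) * ‖c t‖ := by gcongr
      _ = _ := by rw [hκ]; ring
  intro t ht
  rcases le_total 0 t with h | h
  · exact norm_le_exp_exp hκ0 (c := c) (c' := fun t => weightedField r t (c t)) (T := T)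
      (fun x hx => hc x ⟨by linarith [hx.1], hx.2⟩)
      (fun x hx => hf x ⟨by linarith [hx.1], hx.2⟩) t ⟨h, ht.2⟩
  · have hm : ∀ x ∈ Ico 0 T, -x ∈ Ioo (-T) T := fun x hx => ⟨by linarith [hx.2], by
      linarith [hx.1]⟩
    have := norm_le_exp_exp hκ0 (c := fun τ => c (-τ))
      (c' := fun τ => -weightedField r (-τ) (c (-τ))) (T := T)
      (fun x hx => ((hc (-x) (hm x hx)).scomp x (hasDerivAt_neg x)).congr_deriv (by
        rw [neg_smul, one_smul]))
      (fun x hx => by rw [norm_neg]; exact hf (-x) (hm x hx)) (-t) ⟨by linarith, by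
        linarith [ht.1]⟩
    simpa using this

theorem exists_global_weighted {r : ℕ} (hr : 4 ≤ r) (x₀ : Ell1) :
    ∃ c : ℝ → Ell1, c 0 = x₀ ∧ ∀ t, HasDerivAt c (weightedField r t (c t)) t := by
  refine exists_global_solution_of_apriori (f := weightedField r) (fun R => ⟨|R| ^ 3, ?_⟩)
    (fun R => ⟨3 * 1 * |R| ^ 2, ?_⟩) (fun x => ?_) x₀ (fun T hT => ?_)
  · intro t x hx
    rw [norm_weightedField]
    refine (norm_tri_le (norm_kern_le r t) x x x).trans ?_
    have : ‖x‖ ≤ |R| := hx.trans (le_abs_self R)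
    calc _ = ‖x‖ ^ 3 := by ring
      _ ≤ |R| ^ 3 := by gcongr
  · intro t x y hx hy
    rw [weightedField, weightedField, ← smul_sub, norm_smul, Complex.norm_I, one_mul]
    exact norm_tri_sub_tri_le (norm_kern_le r t) (hx.trans (le_abs_self R))
      (hy.trans (le_abs_self R))
  · exact (continuous_tri (norm_kern_le r) (continuous_kern r) x x x).const_smul Complex.I
  · have hE0 : 0 ≤ energy r 0 x₀ := (tsum_nonneg fun n =>
      mul_nonneg (kinCoef_nonneg r n) (sq_nonneg _)).trans (sum_kinCoef_le_energy 0 x₀)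
    refine ⟨Real.exp (Real.exp ((3 * (3 * 3 ^ r * (2 + 300 * energy r 0 x₀)) + 1) * T + ‖x₀‖)),
      fun T' hT' α hα hd t ht => (norm_solution_le hr hT'.1 hd t ht).trans
        (Real.exp_le_exp.mpr (Real.exp_le_exp.mpr ?_))⟩
    rw [hα]
    have := hT'.2
    gcongr

lemma propCoef_eq (r : ℕ) (t : ℝ) (n : Z2) :
    propCoef r t n = Complex.exp ((nsq n * t : ℝ) * Complex.I) * propCoef r 0 n := by
  simp [propCoef, div_eq_mul_inv]

lemma kern_eq (r : ℕ) (t : ℝ) (p : Triple) : kern r t p = osc t p * kern r 0 p := by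
  simp [kern, osc]

lemma prop_zero_tri (r : ℕ) (t : ℝ) (x y z : Ell1) :
    prop r 0 (tri (kern r t) x y z) =
      tri (osc t) (prop r 0 x) (prop r 0 y) (prop r 0 z) := by
  ext n
  rw [prop_apply, tri_apply (summable_kernel_mono (norm_kern_le r t) x y z),
    tri_apply (summable_kernel_mono (fun p => (norm_osc t p).le) _ _ _), ← tsum_mul_left]
  refine tsum_congr fun p => ?_
  have hp : triOut p.1 = n := p.2
  rw [← kern_mul_mono, hp, kern_eq]
  ring

lemma isSolutionV_of_weighted {r : ℕ} (hr : 4 ≤ r) {c : ℝ → Ell1}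
    (hc : ∀ t, HasDerivAt c (weightedField r t (c t)) t) :
    IsSolutionV (fun _ => 0) fun t => prop r t (c t) := by
  intro n t
  obtain ⟨D, hD, hDn⟩ := hasDerivAt_prop_apply hr (hc t)
  refine ⟨(hasSum_norm_mono _ _ _).summable.subtype _, D n, ?_, ?_⟩
  · exact ((Ell1.coord n).restrictScalars ℝ).hasFDerivAt.comp_hasDerivAt t hD
  · rw [hDn, ← mul_assoc, neg_mul, Complex.I_mul_I, neg_neg, one_mul, add_zero,
      tri_apply (summable_kernel_mono (C := 1) (by simp) _ _ _)]
    congr 1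
    exact tsum_congr fun p => one_mul _

lemma hsFinite_prop {r : ℕ} {s : ℝ} (hs : s ≤ r) (t : ℝ) (x : Ell1) :
    HsFinite s (prop r t x) := by
  refine Summable.of_nonneg_of_le (fun n => ?_) (fun n => ?_) (x.summable_norm.mul_left ‖x‖)
  · have := nsq_nonneg n
    positivity
  · have h0 := nsq_nonneg n
    have hw := wt_pos r n
    have h1 : (1 + nsq n) ^ s ≤ wt r n ^ 2 := by
      calc (1 + nsq n) ^ s ≤ (1 + nsq n) ^ (r : ℝ) :=
            Real.rpow_le_rpow_of_exponent_le (by linarith) hs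
        _ = (1 + nsq n) ^ r := Real.rpow_natCast _ _
        _ ≤ (size n ^ 2) ^ r := pow_le_pow_left₀ (by linarith) (one_add_nsq_le n) r
        _ = wt r n ^ 2 := by rw [wt, ← pow_mul, ← pow_mul, mul_comm]
    rw [prop_apply, norm_mul, norm_propCoef]
    calc _ ≤ wt r n ^ 2 * (1 / wt r n * ‖x n‖) ^ 2 :=
          mul_le_mul_of_nonneg_right h1 (sq_nonneg _)
      _ = ‖x n‖ * ‖x n‖ := by field_simp
      _ ≤ ‖x‖ * ‖x n‖ := mul_le_mul_of_nonneg_right (x.norm_apply_le n) (norm_nonneg _)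

/-- Global existence in the interaction picture for finitely supported data. -/
theorem exists_global_interaction (s : ℝ) {f : Z2 → ℂ} (hf : f.support.Finite) :
    ∃ b : ℝ → Ell1, (∀ n, b 0 n = f n) ∧
      (∀ t, HasDerivAt b (Complex.I • tri (osc t) (b t) (b t) (b t)) t) ∧
      IsSolutionV (fun _ => 0) (fun t n => Complex.exp ((nsq n * t : ℝ) * Complex.I) * b t n) ∧
      ∀ t, HsFinite s fun n => Complex.exp ((nsq n * t : ℝ) * Complex.I) * b t n := by
  obtain ⟨r, hr⟩ : ∃ r : ℕ, 4 ≤ r ∧ s ≤ r :=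
    ⟨max 4 ⌈s⌉₊, le_max_left _ _, (Nat.le_ceil s).trans (by exact_mod_cast le_max_right _ _)⟩
  have hsum : Summable fun n => ‖(wt r n : ℂ) * f n‖ := by
    refine summable_of_finite_support (hf.subset fun n hn => ?_)
    simp only [Function.mem_support, ne_eq, norm_eq_zero, mul_eq_zero, not_or] at hn
    exact hn.2
  obtain ⟨c, hc0, hc⟩ := exists_global_weighted hr.1 (Ell1.mk _ hsum)
  have hpt : (fun t n => Complex.exp ((nsq n * t : ℝ) * Complex.I) * prop r 0 (c t) n) =
      fun t => ⇑(prop r t (c t)) := by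
    funext t n
    rw [prop_apply, prop_apply, propCoef_eq r t, mul_assoc]
  refine ⟨fun t => prop r 0 (c t), fun n => ?_, fun t => ?_, ?_, fun t => ?_⟩
  · have hw := Complex.ofReal_ne_zero.mpr (wt_pos r n).ne'
    rw [prop_apply, hc0, Ell1.mk_apply, propCoef]
    simp only [mul_zero, Complex.ofReal_zero, zero_mul, Complex.exp_zero]
    field_simp
  · refine ((prop r 0).hasFDerivAt.comp_hasDerivAt t (hc t)).congr_deriv ?_
    rw [← prop_zero_tri]
    ext n
    simp only [prop_apply, weightedField, Ell1.smul_apply]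
    ring
  · rw [hpt]
    exact isSolutionV_of_weighted hr.1 hc
  · have := congrFun hpt t
    simp only at this
    rw [this]
    exact hsFinite_prop hr.2 t (c t)

namespace Ell1

/-- The basis vector at a frequency. -/
def basis (n : Z2) : Ell1 := lp.single 1 n (1 : ℂ)

lemma norm_basis (n : Z2) : ‖basis n‖ = 1 := by
  rw [basis, lp.norm_single one_pos, norm_one]

lemma single_eq (n : Z2) (z : ℂ) : (lp.single 1 n z : Ell1) = z • basis n := by
  rw [basis, ← lp.single_smul, smul_eq_mul, mul_one]

lemma basis_apply (n m : Z2) : basis n m = if m = n then 1 else 0 := by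
  rw [basis, lp.single_apply, Pi.single_apply]

lemma sum_apply {ι : Type*} (s : Finset ι) (f : ι → Ell1) (n : Z2) :
    (∑ i ∈ s, f i) n = ∑ i ∈ s, f i n := by
  simp only [← coord_apply, map_sum]

end Ell1

section averaging

variable {ι : Type*} [Fintype ι] (P : ι → Z2)

/-- The superposition of finitely many modes, dilated by `M`. -/
def modes (M : ℕ) (v : ι → ℂ) : Ell1 := ∑ x, v x • Ell1.basis (M • P x)

/-- The triple of frequencies attached to a triple of indices. -/
def freq (M : ℕ) (q : ι × ι × ι) : Triple := (M • P q.1, M • P q.2.1, M • P q.2.2)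

/-- The cubic monomial of a triple of indices. -/
def cube (v : ι → ℂ) (q : ι × ι × ι) : ℂ := v q.1 * (starRingEnd ℂ) (v q.2.1) * v q.2.2

lemma triOut_freq (M : ℕ) (q : ι × ι × ι) : triOut (freq P M q) = M • triOut (freq P 1 q) := by
  simp only [triOut, freq, one_smul, smul_add, smul_sub]

lemma nsq_smul (M : ℕ) (n : Z2) : nsq (M • n) = M ^ 2 * nsq n := by
  have h1 : (M • n).1 = M * n.1 := by rw [Prod.smul_fst, nsmul_eq_mul]
  have h2 : (M • n).2 = M * n.2 := by rw [Prod.smul_snd, nsmul_eq_mul]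
  rw [nsq, nsq, h1, h2]
  push_cast
  ring

lemma resonance_freq (M : ℕ) (q : ι × ι × ι) :
    resonance (freq P M q) = M ^ 2 * resonance (freq P 1 q) := by
  simp only [resonance, triOut_freq P M q]
  simp only [freq, nsq_smul]
  push_cast
  ring

variable {P}

lemma smul_injective {M : ℕ} (hM : 1 ≤ M) (hP : Function.Injective P) :
    Function.Injective fun x => M • P x := fun x y h => by
  refine hP ?_
  have h1 := congrArg Prod.fst h
  have h2 := congrArg Prod.snd h
  simp only [Prod.smul_fst, Prod.smul_snd, nsmul_eq_mul] at h1 h2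
  have hM' : (M : ℤ) ≠ 0 := by positivity
  exact Prod.ext (mul_left_cancel₀ hM' h1) (mul_left_cancel₀ hM' h2)

lemma modes_apply {M : ℕ} (hM : 1 ≤ M) (hP : Function.Injective P) (v : ι → ℂ) (x : ι) :
    modes P M v (M • P x) = v x := by
  rw [modes, Ell1.sum_apply, Finset.sum_eq_single x]
  · rw [Ell1.smul_apply, Ell1.basis_apply, if_pos rfl, mul_one]
  · intro y _ hy
    rw [Ell1.smul_apply, Ell1.basis_apply, if_neg, mul_zero]
    exact fun h => hy (smul_injective hM hP h.symm)
  · simp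

lemma modes_apply_of_notMem {M : ℕ} (v : ι → ℂ) {n : Z2} (hn : n ∉ range fun x => M • P x) :
    modes P M v n = 0 := by
  rw [modes, Ell1.sum_apply]
  refine Finset.sum_eq_zero fun y _ => ?_
  rw [Ell1.smul_apply, Ell1.basis_apply, if_neg, mul_zero]
  exact fun h => hn ⟨y, h.symm⟩

lemma norm_modes_le {M : ℕ} {v : ι → ℂ} {C : ℝ} (hv : ∀ x, ‖v x‖ ≤ C) :
    ‖modes P M v‖ ≤ Fintype.card ι * C := by
  refine (norm_sum_le_of_le Finset.univ (fun x _ => ?_)).trans_eq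
    (b := ∑ _x : ι, C) (by rw [Finset.sum_const, Finset.card_univ, nsmul_eq_mul])
  rw [norm_smul, Ell1.norm_basis, mul_one]
  exact hv x

lemma tri_modes {M : ℕ} (hM : 1 ≤ M) (hP : Function.Injective P) (κ : Triple → ℂ) (v : ι → ℂ) :
    tri κ (modes P M v) (modes P M v) (modes P M v) =
      ∑ q : ι × ι × ι, (κ (freq P M q) * cube v q) • Ell1.basis (M • triOut (freq P 1 q)) := by
  have hi := smul_injective hM hP
  have hinj : Function.Injective (freq P M) := fun q q' h => by
    simp only [freq, Prod.mk.injEq] at h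
    exact Prod.ext (hi h.1) (Prod.ext (hi h.2.1) (hi h.2.2))
  rw [tri, ← hinj.tsum_eq, tsum_fintype]
  · refine Finset.sum_congr rfl fun q _ => ?_
    rw [Ell1.single_eq, triOut_freq]
    congr 2
    simp only [mono, freq, modes_apply hM hP, cube]
  · intro p hp
    by_contra hcon
    refine hp ?_
    have : mono (modes P M v) (modes P M v) (modes P M v) p = 0 := by
      by_contra h0
      simp only [mono, mul_ne_zero_iff, map_ne_zero] at h0
      have hr : ∀ n, modes P M v n ≠ 0 → ∃ x, M • P x = n := fun n hn => by
        by_contra h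
        exact hn (modes_apply_of_notMem v h)
      obtain ⟨x, hx⟩ := hr _ h0.1.1
      obtain ⟨y, hy⟩ := hr _ h0.1.2
      obtain ⟨z, hz⟩ := hr _ h0.2
      exact hcon ⟨(x, y, z), by rw [freq]; simp only [hx, hy, hz]⟩
    simp only [this, mul_zero, Ell1.single_eq, zero_smul]

end averaging

section averaging

variable {ι : Type*} [Fintype ι] {P : ι → Z2}

/-- The derivative of the cubic monomial `cube v q` in the direction `v'`. -/
def cubeDeriv (v v' : ι → ℂ) (q : ι × ι × ι) : ℂ :=
  (v' q.1 * (starRingEnd ℂ) (v q.2.1) + v q.1 * (starRingEnd ℂ) (v' q.2.1)) * v q.2.2 +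
    v q.1 * (starRingEnd ℂ) (v q.2.1) * v' q.2.2

lemma hasDerivAt_cube {β β' : ι → ℝ → ℂ} {t : ℝ} (hβ : ∀ x, HasDerivAt (β x) (β' x t) t)
    (q : ι × ι × ι) : HasDerivAt (fun τ => cube (fun x => β x τ) q)
      (cubeDeriv (fun x => β x t) (fun x => β' x t) q) t := by
  have h2 : HasDerivAt (fun τ => (starRingEnd ℂ) (β q.2.1 τ)) ((starRingEnd ℂ) (β' q.2.1 t)) t :=
    (hβ q.2.1).star
  exact ((hβ q.1).fun_mul h2).fun_mul (hβ q.2.2)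

lemma norm_cube_le {v : ι → ℂ} {C : ℝ} (hv : ∀ x, ‖v x‖ ≤ C) (q : ι × ι × ι) :
    ‖cube v q‖ ≤ C ^ 3 := by
  have h0 : 0 ≤ C := (norm_nonneg _).trans (hv q.1)
  rw [cube, norm_mul, norm_mul, RCLike.norm_conj]
  calc ‖v q.1‖ * ‖v q.2.1‖ * ‖v q.2.2‖ ≤ C * C * C := by
        gcongr <;> exact hv _
    _ = C ^ 3 := by ring

lemma norm_cubeDeriv_le {v v' : ι → ℂ} {C : ℝ} (hv : ∀ x, ‖v x‖ ≤ C) (hv' : ∀ x, ‖v' x‖ ≤ C)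
    (q : ι × ι × ι) : ‖cubeDeriv v v' q‖ ≤ 3 * C ^ 3 := by
  have h0 : 0 ≤ C := (norm_nonneg _).trans (hv q.1)
  have h : ∀ {x y z : ℂ}, ‖x‖ ≤ C → ‖y‖ ≤ C → ‖z‖ ≤ C →
      ‖x * (starRingEnd ℂ) y * z‖ ≤ C * C * C := fun hx hy hz => by
    rw [norm_mul, norm_mul, RCLike.norm_conj]
    gcongr
  rw [cubeDeriv, add_mul]
  refine (norm_add₃_le).trans ?_
  linarith [h (hv' q.1) (hv q.2.1) (hv q.2.2), h (hv q.1) (hv' q.2.1) (hv q.2.2),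
    h (hv q.1) (hv q.2.1) (hv' q.2.2), pow_succ C 2, sq C]

/-- The finite combination of the output modes of all triples, weighted by the inverse of
the resonance. -/
def nonresonantSum (P : ι → Z2) (M : ℕ) (t : ℝ) (c : ι × ι × ι → ℂ) : Ell1 :=
  ∑ q : ι × ι × ι, (c q * (osc t (freq P M q) * ((resonance (freq P 1 q))⁻¹ / M ^ 2 : ℝ))) •
    Ell1.basis (M • triOut (freq P 1 q))

lemma norm_nonresonantSum_le (M : ℕ) (t : ℝ) {c : ι × ι × ι → ℂ} {D : ℝ} (hc : ∀ q, ‖c q‖ ≤ D) :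
    ‖nonresonantSum P M t c‖ ≤ D * (∑ q, |resonance (freq P 1 q)|⁻¹) / M ^ 2 := by
  rw [mul_div_assoc, Finset.sum_div, Finset.mul_sum]
  refine norm_sum_le_of_le _ fun q _ => ?_
  rw [norm_smul, Ell1.norm_basis, mul_one, norm_mul, norm_mul, norm_osc, one_mul,
    Complex.norm_real, norm_div, norm_inv, Real.norm_eq_abs, norm_pow, Real.norm_natCast]
  exact mul_le_mul_of_nonneg_right (hc q) (by positivity)

lemma hasDerivAt_osc (t : ℝ) (p : Triple) :
    HasDerivAt (fun τ => osc τ p) (resonance p * Complex.I * osc t p) t := by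
  have h1 : HasDerivAt (fun τ : ℝ => ((resonance p * τ : ℝ) : ℂ) * Complex.I)
      (resonance p * Complex.I) t := by
    have := ((hasDerivAt_id t).const_mul (resonance p)).ofReal_comp.mul_const Complex.I
    simpa using this
  exact h1.cexp.congr_deriv (by rw [osc]; ring)

/-- The first-order normal form identity: adding the corrector removes the nonresonant terms. -/
lemma hasDerivAt_corrected {M : ℕ} (hM : 1 ≤ M) (hP : Function.Injective P) {β β' : ι → ℝ → ℂ}
    {t : ℝ} (hβ : ∀ x, HasDerivAt (β x) (β' x t) t)
    (hres : ∀ φ : Z2 → Ell1, ∑ x, β' x t • φ (P x) =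
      ∑ q : ι × ι × ι, if resonance (freq P 1 q) = 0 then
        (Complex.I * cube (fun x => β x t) q) • φ (triOut (freq P 1 q)) else 0) :
    HasDerivAt (fun τ => modes P M (fun x => β x τ) +
        nonresonantSum P M τ (cube fun x => β x τ))
      (Complex.I • tri (osc t) (modes P M fun x => β x t) (modes P M fun x => β x t)
          (modes P M fun x => β x t) +
        nonresonantSum P M t (cubeDeriv (fun x => β x t) fun x => β' x t)) t := by
  have h1 : HasDerivAt (fun τ => modes P M (fun x => β x τ))
      (∑ x, β' x t • Ell1.basis (M • P x)) t :=
    HasDerivAt.fun_sum fun x _ => (hβ x).smul_const _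
  have h2 : HasDerivAt (fun τ => nonresonantSum P M τ (cube fun x => β x τ))
      (∑ q : ι × ι × ι, (cubeDeriv (fun x => β x t) (fun x => β' x t) q *
          (osc t (freq P M q) * ((resonance (freq P 1 q))⁻¹ / M ^ 2 : ℝ)) +
          cube (fun x => β x t) q * (resonance (freq P M q) * Complex.I * osc t (freq P M q) *
            ((resonance (freq P 1 q))⁻¹ / M ^ 2 : ℝ))) •
        Ell1.basis (M • triOut (freq P 1 q))) t :=
    HasDerivAt.fun_sum fun q _ => ((hasDerivAt_cube hβ q).fun_mul
      ((hasDerivAt_osc t _).mul_const _)).smul_const _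
  refine (h1.fun_add h2).congr_deriv ?_
  rw [hres fun n => Ell1.basis (M • n), tri_modes hM hP, Finset.smul_sum, nonresonantSum,
    ← Finset.sum_add_distrib, ← Finset.sum_add_distrib]
  refine Finset.sum_congr rfl fun q _ => ?_
  have hM' : (M : ℂ) ≠ 0 := by
    have : M ≠ 0 := by omega
    exact_mod_cast this
  split_ifs with h0
  · have : osc t (freq P M q) = 1 := by
      rw [osc, resonance_freq, h0]; simp
    rw [smul_smul, ← add_smul, ← add_smul, resonance_freq, h0, this]
    congr 1
    push_cast
    simp
  · rw [zero_add, smul_smul, ← add_smul, resonance_freq P M]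
    congr 1
    have h0' : (resonance (freq P 1 q) : ℂ) ≠ 0 := by exact_mod_cast h0
    push_cast
    field_simp
    ring

/-- Exact solutions follow the effective resonant dynamics, at every fixed time,
in the limit of large dilation. -/
theorem exists_dilation_forall_norm_sub_le (hP : Function.Injective P) {β β' : ι → ℝ → ℂ}
    (hβ : ∀ x t, HasDerivAt (β x) (β' x t) t) (hc : ∀ x, Continuous (β' x))
    (hres : ∀ t, ∀ φ : Z2 → Ell1, ∑ x, β' x t • φ (P x) =
      ∑ q : ι × ι × ι, if resonance (freq P 1 q) = 0 then
        (Complex.I * cube (fun x => β x t) q) • φ (triOut (freq P 1 q)) else 0)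
    {T ε : ℝ} (hT : 0 ≤ T) (hε : 0 < ε) :
    ∃ M : ℕ, 1 ≤ M ∧ ∀ b : ℝ → Ell1,
      (∀ t, HasDerivAt b (Complex.I • tri (osc t) (b t) (b t) (b t)) t) →
      b 0 = modes P M (fun x => β x 0) → ∀ x, ‖b T (M • P x) - β x T‖ ≤ ε := by
  have hβc : ∀ x, Continuous (β x) := fun x =>
    continuous_iff_continuousAt.mpr fun t => (hβ x t).continuousAt
  obtain ⟨C, hC⟩ : ∃ C, ∀ t ∈ Icc 0 T, ∑ x, (‖β x t‖ + ‖β' x t‖) ≤ C := by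
    have : Continuous fun t => ∑ x, (‖β x t‖ + ‖β' x t‖) :=
      continuous_finsetSum _ fun x _ => (hβc x).norm.add (hc x).norm
    obtain ⟨C, hC⟩ := (isCompact_Icc (a := 0) (b := T)).bddAbove_image this.continuousOn
    exact ⟨C, fun t ht => hC ⟨t, ht, rfl⟩⟩
  have hb : ∀ t ∈ Icc 0 T, ∀ x, ‖β x t‖ + ‖β' x t‖ ≤ C := fun t ht x =>
    (Finset.single_le_sum (f := fun x => ‖β x t‖ + ‖β' x t‖) (fun _ _ => by positivity)
      (Finset.mem_univ x)).trans (hC t ht)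
  have hb1 : ∀ t ∈ Icc 0 T, ∀ x, ‖β x t‖ ≤ C := fun t ht x => by
    linarith [hb t ht x, norm_nonneg (β' x t)]
  have hb2 : ∀ t ∈ Icc 0 T, ∀ x, ‖β' x t‖ ≤ C := fun t ht x => by
    linarith [hb t ht x, norm_nonneg (β x t)]
  have hC0 : 0 ≤ C := (Finset.sum_nonneg fun _ _ => by positivity).trans (hC 0 ⟨le_rfl, hT⟩)
  set W : ℝ := 3 * C ^ 3 * (∑ q, |resonance (freq P 1 q)|⁻¹) + 1 with hW
  have hS : 0 ≤ ∑ q : ι × ι × ι, |resonance (freq P 1 q)|⁻¹ :=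
    Finset.sum_nonneg fun _ _ => by positivity
  have hW0 : 0 < W := by positivity
  set R : ℝ := Fintype.card ι * C + 2 with hR
  have hR0 : 0 ≤ R := by positivity
  set L : ℝ := 5 * R ^ 2 + 1 with hL
  obtain ⟨M, hMe⟩ := exists_nat_ge ((3 * W * Real.exp (L * T)) / min ε 1 + 1)
  have hmin : 0 < min ε 1 := lt_min hε one_pos
  have hM1 : (1 : ℝ) ≤ M := by
    have : 0 ≤ (3 * W * Real.exp (L * T)) / min ε 1 := by positivity
    linarith
  refine ⟨M, by exact_mod_cast hM1, fun b hbd hb0 x => ?_⟩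
  have hM : 1 ≤ M := by exact_mod_cast hM1
  set e : ℝ := W / M ^ 2 with he
  have he0 : 0 < e := by positivity
  have hsmall : 3 * e * Real.exp (L * T) ≤ min ε 1 := by
    have h1 : 3 * W * Real.exp (L * T) ≤ min ε 1 * M := by
      rw [← div_le_iff₀' hmin]; linarith
    have h2 : (M : ℝ) ≤ M ^ 2 := by nlinarith
    rw [he, mul_div_assoc', div_mul_eq_mul_div, div_le_iff₀ (by positivity)]
    exact h1.trans (by gcongr)
  have hexp : ∀ t ∈ Icc 0 T, Real.exp (L * t) ≤ Real.exp (L * T) := fun t ht =>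
    Real.exp_le_exp.mpr (by have := ht.2; gcongr)
  have hw : ∀ t ∈ Icc 0 T, ‖nonresonantSum P M t (cube fun x => β x t)‖ ≤ e := fun t ht => by
    refine (norm_nonresonantSum_le M t fun q => norm_cube_le (hb1 t ht) q).trans ?_
    rw [he, hW]
    gcongr
    nlinarith [mul_nonneg (pow_nonneg hC0 3) hS]
  have hρ : ∀ t ∈ Icc 0 T,
      ‖nonresonantSum P M t (cubeDeriv (fun x => β x t) fun x => β' x t)‖ ≤ e := fun t ht => by
    refine (norm_nonresonantSum_le M t fun q => norm_cubeDeriv_le (hb1 t ht) (hb2 t ht) q).trans ?_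
    rw [he, hW]
    gcongr
    linarith
  have hd : ∀ t, HasDerivAt (fun τ => b τ - (modes P M (fun x => β x τ) +
        nonresonantSum P M τ (cube fun x => β x τ)))
      (Complex.I • tri (osc t) (b t) (b t) (b t) -
        (Complex.I • tri (osc t) (modes P M fun x => β x t) (modes P M fun x => β x t)
          (modes P M fun x => β x t) +
        nonresonantSum P M t (cubeDeriv (fun x => β x t) fun x => β' x t))) t := fun t =>
    (hbd t).fun_sub (hasDerivAt_corrected hM hP (fun x => hβ x t) (hres t))
  have hB : ∀ t, HasDerivAt (fun t => 2 * e * Real.exp (L * t))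
      (2 * e * (Real.exp (L * t) * L)) t := fun t => by
    have : HasDerivAt (fun t => L * t) L t := by simpa using (hasDerivAt_id t).const_mul L
    exact this.exp.const_mul _
  have hle1 : Real.exp (L * T) * e ≤ 1 / 3 := by linarith [min_le_right ε 1]
  have key := image_norm_le_of_norm_deriv_right_lt_deriv_boundary (a := 0) (b := T)
    (fun t _ => (hd t).continuousAt.continuousWithinAt)
    (fun t _ => (hd t).hasDerivWithinAt)
    (B := fun t => 2 * e * Real.exp (L * t))
    (B' := fun t => 2 * e * (Real.exp (L * t) * L))
    (by
      have h0 : (0 : ℝ) ∈ Icc 0 T := ⟨le_rfl, hT⟩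
      rw [hb0, sub_add_cancel_left, norm_neg, mul_zero, Real.exp_zero]
      linarith [hw 0 h0]) hB (fun t ht heq => by
      have ht' : t ∈ Icc 0 T := ⟨ht.1, ht.2.le⟩
      have hexp1 : 1 ≤ Real.exp (L * t) := Real.one_le_exp (by have := ht.1; positivity)
      set E := Real.exp (L * t) with hE
      have hEe : e ≤ e * E := le_mul_of_one_le_right he0.le hexp1
      have hEe1 : e * E ≤ 1 / 3 := by nlinarith [hexp t ht']
      set B0 := modes P M fun x => β x t with hB0
      set w0 := nonresonantSum P M t (cube fun x => β x t) with hw0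
      set ρ0 := nonresonantSum P M t (cubeDeriv (fun x => β x t) fun x => β' x t) with hρ0
      have hm : ‖B0‖ ≤ R - 2 := by
        rw [hR, add_sub_cancel_right]; exact norm_modes_le (hb1 t ht')
      have hdist : ‖b t - B0‖ ≤ 3 * (e * E) := by
        calc ‖b t - B0‖ = ‖(b t - (B0 + w0)) + w0‖ := by congr 1; abel
          _ ≤ ‖b t - (B0 + w0)‖ + ‖w0‖ := norm_add_le _ _
          _ ≤ 2 * e * E + e := add_le_add heq.le (hw t ht')
          _ ≤ _ := by linarith
      have hbn : ‖b t‖ ≤ R := by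
        calc ‖b t‖ = ‖(b t - B0) + B0‖ := by rw [sub_add_cancel]
          _ ≤ _ := norm_add_le _ _
          _ ≤ _ := by linarith
      have hlip := norm_tri_sub_tri_le (κ := osc t) (C := 1) (fun p => (norm_osc t p).le) hbn
        (show ‖B0‖ ≤ R by linarith)
      calc ‖Complex.I • tri (osc t) (b t) (b t) (b t) -
            (Complex.I • tri (osc t) B0 B0 B0 + ρ0)‖
          = ‖Complex.I • (tri (osc t) (b t) (b t) (b t) - tri (osc t) B0 B0 B0) - ρ0‖ := by
            rw [smul_sub]; congr 1; abel
        _ ≤ ‖tri (osc t) (b t) (b t) (b t) - tri (osc t) B0 B0 B0‖ + ‖ρ0‖ := by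
            refine (norm_sub_le _ _).trans ?_
            rw [norm_smul, Complex.norm_I, one_mul]
        _ ≤ 3 * 1 * R ^ 2 * (3 * (e * E)) + e :=
            add_le_add (hlip.trans (by gcongr)) (hρ t ht')
        _ < 2 * e * (E * L) := by
            have : 0 ≤ R ^ 2 * (e * E) := by positivity
            rw [hL]
            nlinarith)
  have hT' : T ∈ Icc 0 T := ⟨hT, le_rfl⟩
  have h1 := key hT'
  have h2 : ‖b T - modes P M (fun x => β x T)‖ ≤ ε := by
    calc ‖b T - modes P M (fun x => β x T)‖
        = ‖(b T - (modes P M (fun x => β x T) + nonresonantSum P M T (cube fun x => β x T))) +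
          nonresonantSum P M T (cube fun x => β x T)‖ := by congr 1; abel
      _ ≤ 2 * e * Real.exp (L * T) + e := (norm_add_le _ _).trans (add_le_add h1 (hw T hT'))
      _ ≤ 3 * e * Real.exp (L * T) := by
          have : 1 ≤ Real.exp (L * T) := Real.one_le_exp (by positivity)
          nlinarith
      _ ≤ ε := hsmall.trans (min_le_left _ _)
  refine le_trans ?_ h2
  have h3 := Ell1.norm_apply_le (b T - modes P M (fun x => β x T)) (M • P x)
  rwa [Ell1.sub_apply, modes_apply hM hP] at h3

end averaging

/-- The Euclidean inner product of two Gaussian integers. -/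
def gdot (z w : GaussianInt) : ℤ := z.re * w.re + z.im * w.im

lemma gdot_self_eq_zero {z : GaussianInt} (h : gdot z z = 0) : z = 0 := by
  have h' : z.re * z.re + z.im * z.im = 0 := h
  have h1 : z.re = 0 := by nlinarith [mul_self_nonneg z.re, mul_self_nonneg z.im]
  have h2 : z.im = 0 := by nlinarith [mul_self_nonneg z.re, mul_self_nonneg z.im]
  exact Zsqrtd.ext h1 h2

lemma gdot_mul_left (c z w : GaussianInt) : gdot (c * z) (c * w) = gdot c c * gdot z w := by
  simp only [gdot, Zsqrtd.re_mul, Zsqrtd.im_mul]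
  ring

lemma gdot_add_smul (s : ℤ) (z z' w w' : GaussianInt) :
    gdot (z + s * z') (w + s * w') =
      gdot z w + (gdot z w' + gdot z' w) * s + gdot z' w' * s ^ 2 := by
  simp only [gdot, Zsqrtd.re_mul, Zsqrtd.im_mul, Zsqrtd.re_add, Zsqrtd.im_add, Zsqrtd.re_intCast,
    Zsqrtd.im_intCast]
  ring

/-- A quadratic polynomial with a nonzero extreme coefficient has finitely many integer roots. -/
lemma finite_setOf_quadratic_eq_zero {a b c : ℤ} (h : a ≠ 0 ∨ c ≠ 0) :
    {s : ℤ | a + b * s + c * s ^ 2 = 0}.Finite := by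
  classical
  let p : Polynomial ℤ := Polynomial.C a + Polynomial.C b * Polynomial.X +
    Polynomial.C c * Polynomial.X ^ 2
  have hp : p ≠ 0 := by
    intro h0
    have h1 : p.coeff 0 = a := by simp [p]
    have h2 : p.coeff 2 = c := by
      simp only [p, Polynomial.coeff_add, Polynomial.coeff_C_mul, Polynomial.coeff_X_pow,
        Polynomial.coeff_X, Polynomial.coeff_C]
      norm_num
    rw [h0, Polynomial.coeff_zero] at h1 h2
    rcases h with h | h
    · exact h h1.symm
    · exact h h2.symm
  refine (p.roots.toFinset.finite_toSet).subset fun s hs => ?_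
  simp only [Finset.mem_coe, Multiset.mem_toFinset, Polynomial.mem_roots hp, Polynomial.IsRoot]
  simpa [p] using hs

section generic

variable {D τ : Type*} [Fintype D]

/-- A linear combination with Gaussian integer coefficients. -/
def glin (r V : D → GaussianInt) : GaussianInt := ∑ d, r d * V d

lemma glin_add_smul (r V W : D → GaussianInt) (s : ℤ) :
    glin r (V + (s : GaussianInt) • W) = glin r V + s * glin r W := by
  simp only [glin, Pi.add_apply, Pi.smul_apply, smul_eq_mul, mul_add, Finset.sum_add_distrib,
    Finset.mul_sum]
  congr 1
  exact Finset.sum_congr rfl fun d _ => by ring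

/-- Finitely many quadratic forms, none of which vanishes identically, are simultaneously nonzero
at some point. -/
lemma exists_forall_gdot_ne_zero (S : Finset τ) (r r' : τ → D → GaussianInt)
    (h : ∀ i ∈ S, ∃ V, gdot (glin (r i) V) (glin (r' i) V) ≠ 0) :
    ∃ V, ∀ i ∈ S, gdot (glin (r i) V) (glin (r' i) V) ≠ 0 := by
  classical
  induction S using Finset.induction_on with
  | empty => exact ⟨0, by simp⟩
  | insert i S hi ih =>
    obtain ⟨V, hV⟩ := ih fun j hj => h j (Finset.mem_insert_of_mem hj)
    obtain ⟨W, hW⟩ := h i (Finset.mem_insert_self i S)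
    have hfin : (⋃ j ∈ (insert i S : Finset τ), {s : ℤ | gdot (glin (r j) V) (glin (r' j) V) +
        (gdot (glin (r j) V) (glin (r' j) W) + gdot (glin (r j) W) (glin (r' j) V)) * s +
        gdot (glin (r j) W) (glin (r' j) W) * s ^ 2 = 0}).Finite := by
      refine Set.Finite.biUnion (Finset.finite_toSet _) fun j hj => ?_
      refine finite_setOf_quadratic_eq_zero ?_
      rcases Finset.mem_insert.mp hj with rfl | hj
      · exact Or.inr hW
      · exact Or.inl (hV j hj)
    obtain ⟨s, hs⟩ := hfin.exists_notMem
    refine ⟨V + (s : GaussianInt) • W, fun j hj h0 => hs ?_⟩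
    rw [glin_add_smul, glin_add_smul, gdot_add_smul] at h0
    exact Set.mem_biUnion hj h0

/-- If `gdot (glin r V) (glin r' V)` vanishes for all `V`, then the coefficient vectors are
proportional with an imaginary ratio. -/
lemma mul_star_eq_neg_of_forall_gdot_eq_zero {r r' : D → GaussianInt}
    (h : ∀ V, gdot (glin r V) (glin r' V) = 0) (k l : D) :
    r k * star (r' l) = -(r' k * star (r l)) := by
  classical
  have hs : ∀ (r : D → GaussianInt) k c, glin r (Pi.single k c) = r k * c := fun r k c => by
    rw [glin, Finset.sum_eq_single k]
    · rw [Pi.single_eq_same]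
    · intro d _ hd
      rw [Pi.single_eq_of_ne hd, mul_zero]
    · simp
  have hadd : ∀ (r V W : D → GaussianInt), glin r (V + W) = glin r V + glin r W := fun r V W => by
    simp only [glin, Pi.add_apply, mul_add, Finset.sum_add_distrib]
  have h1 := fun k => h (Pi.single k 1)
  have h2 := h (Pi.single k 1 + Pi.single l 1)
  have h3 := h (Pi.single k 1 + Pi.single l ⟨0, 1⟩)
  have hk := h1 k
  have hl := h1 l
  simp only [hadd, hs, mul_one] at hk hl h2 h3
  simp only [gdot, Zsqrtd.re_mul, Zsqrtd.im_mul, Zsqrtd.re_add, Zsqrtd.im_add] at hk hl h2 h3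
  apply Zsqrtd.ext
  · simp only [Zsqrtd.re_mul, Zsqrtd.re_neg, Zsqrtd.re_star, Zsqrtd.im_star]
    linarith
  · simp only [Zsqrtd.im_mul, Zsqrtd.im_neg, Zsqrtd.re_star, Zsqrtd.im_star]
    linarith

end generic

section slots

variable {κ : Type*} [DecidableEq κ]

/-- The linear and bilinear monomials in the slot values. -/
def feat (u : κ → GaussianInt) (d : κ × κ) : GaussianInt :=
  if d.1 = d.2 then u d.1 else u d.1 * u d.2

/-- A right angle at `b` for generic parameters happens inside a single slot. -/
lemma eq_or_exists_slot_of_forall_gdot_eq_zero [Fintype κ] {a b c : κ → GaussianInt}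
    (h : ∀ V, gdot (glin (feat a - feat b) V) (glin (feat c - feat b) V) = 0) :
    a = b ∨ c = b ∨ ∃ k, (∀ l, l ≠ k → a l = b l ∧ c l = b l) ∧
      gdot (a k - b k) (c k - b k) = 0 ∧ a k ≠ b k ∧ c k ≠ b k := by
  by_contra! hcon
  obtain ⟨hab, hcb, hk⟩ := hcon
  obtain ⟨k, hk0⟩ := Function.ne_iff.mp hcb
  have hf : ∀ (u : κ → GaussianInt) l, feat u (l, l) = u l := fun u l => if_pos rfl
  have key := fun d => mul_star_eq_neg_of_forall_gdot_eq_zero h d (k, k)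
  simp only [Pi.sub_apply, hf] at key
  have hkk := key (k, k)
  simp only [hf] at hkk
  have hdot : gdot (a k - b k) (c k - b k) = 0 := by
    have := congrArg Zsqrtd.re hkk
    simp only [Zsqrtd.re_mul, Zsqrtd.re_neg, Zsqrtd.re_star, Zsqrtd.im_star] at this
    rw [gdot]; linarith
  obtain ⟨y, hy⟩ : ∃ y, star (c k - b k) = y := ⟨_, rfl⟩
  obtain ⟨x, hx⟩ : ∃ x, star (a k - b k) = x := ⟨_, rfl⟩
  rw [hx, hy] at key
  have hy0 : y ≠ 0 := by
    rw [← hy]; exact star_ne_zero.mpr (sub_ne_zero.mpr hk0)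
  have hx0 : x ≠ 0 := by
    rintro rfl
    refine hab (funext fun l => ?_)
    have := key (l, l)
    simp only [hf, mul_zero, neg_zero, mul_eq_zero, hy0, or_false] at this
    exact sub_eq_zero.mp this
  have hak : a k ≠ b k := by
    rintro h0
    rw [h0, sub_self, star_zero] at hx
    exact hx0 hx.symm
  have hxy : x + y ≠ 0 := by
    intro h0
    rw [← hx, ← hy, ← star_add, star_eq_zero] at h0
    have : c k - b k = -(a k - b k) := by linear_combination h0
    rw [this] at hdot
    have h1 : gdot (a k - b k) (a k - b k) = 0 := by
      simp only [gdot, Zsqrtd.re_neg, Zsqrtd.im_neg] at hdot ⊢; linarith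
    exact hak (sub_eq_zero.mp (gdot_self_eq_zero h1))
  have hlin : ∀ l, (a l - b l) * y = -((c l - b l) * x) := fun l => by
    simpa only [hf] using key (l, l)
  have hc : ∀ l, l ≠ k → c l = b l := fun l hl => by
    have h1 := key (l, k)
    simp only [feat, if_neg hl] at h1
    have h2 := hlin l
    have h3 := hlin k
    have h4 : x * (x + y) * ((c l - b l) * (c k - b k)) = 0 := by
      linear_combination y * h1 - (y * b l + (a l - b l) * y) * h3 -
        (b k * y - x * (c k - b k)) * h2
    rcases mul_eq_zero.mp h4 with h4 | h4
    · exact absurd h4 (mul_ne_zero hx0 hxy)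
    · rcases mul_eq_zero.mp h4 with h4 | h4
      · exact sub_eq_zero.mp h4
      · exact absurd (sub_eq_zero.mp h4) hk0
  have ha : ∀ l, l ≠ k → a l = b l := fun l hl => by
    have h2 := hlin l
    rw [hc l hl, sub_self, zero_mul, neg_zero, mul_eq_zero] at h2
    exact sub_eq_zero.mp (h2.resolve_right hy0)
  exact hk0 (hk k (fun l hl => ⟨ha l hl, hc l hl⟩) hdot hak)

end slots

section affine

/-- `F` is an affine function of the value in slot `k`, the other values being those of `u₀`. -/
def AffineInSlot {κ : Type*} (k : κ) (u₀ : κ → GaussianInt) (F : (κ → GaussianInt) → GaussianInt) : Prop :=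
  ∃ A B, ∀ u, (∀ l, l ≠ k → u l = u₀ l) → F u = A + B * u k

variable {κ : Type*} {k : κ} {u₀ : κ → GaussianInt}

lemma AffineInSlot.add {F G : (κ → GaussianInt) → GaussianInt} (hF : AffineInSlot k u₀ F)
    (hG : AffineInSlot k u₀ G) : AffineInSlot k u₀ fun u => F u + G u := by
  obtain ⟨A, B, h⟩ := hF
  obtain ⟨A', B', h'⟩ := hG
  exact ⟨A + A', B + B', fun u hu => by beta_reduce; rw [h u hu, h' u hu]; ring⟩

lemma AffineInSlot.sum {τ : Type*} {S : Finset τ} {F : τ → (κ → GaussianInt) → GaussianInt}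
    (hF : ∀ i, AffineInSlot k u₀ (F i)) : AffineInSlot k u₀ fun u => ∑ i ∈ S, F i u := by
  choose A B h using hF
  exact ⟨∑ i ∈ S, A i, ∑ i ∈ S, B i, fun u hu => by
    beta_reduce
    rw [Finset.sum_congr rfl fun i _ => h i u hu, Finset.sum_add_distrib, Finset.sum_mul]⟩

lemma AffineInSlot.const_mul {F : (κ → GaussianInt) → GaussianInt} (hF : AffineInSlot k u₀ F)
    (c : GaussianInt) : AffineInSlot k u₀ fun u => c * F u := by
  obtain ⟨A, B, h⟩ := hF
  exact ⟨c * A, c * B, fun u hu => by beta_reduce; rw [h u hu]; ring⟩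

lemma AffineInSlot.prod {τ : Type*} (S : Finset τ) {g : τ → κ} (hg : Function.Injective g) :
    AffineInSlot k u₀ fun u => ∏ i ∈ S, u (g i) := by
  classical
  by_cases h : ∃ i ∈ S, g i = k
  · obtain ⟨i, hi, rfl⟩ := h
    refine ⟨0, ∏ j ∈ S.erase i, u₀ (g j), fun u hu => ?_⟩
    beta_reduce
    rw [← Finset.mul_prod_erase _ _ hi, zero_add, mul_comm]
    congr 1
    exact Finset.prod_congr rfl fun j hj => hu _ fun h => Finset.ne_of_mem_erase hj (hg h)
  · push Not at h
    refine ⟨∏ j ∈ S, u₀ (g j), 0, fun u hu => ?_⟩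
    beta_reduce
    rw [zero_mul, add_zero]
    exact Finset.prod_congr rfl fun j hj => hu _ (h j hj)

lemma affineInSlot_feat [DecidableEq κ] (d : κ × κ) : AffineInSlot k u₀ fun u => feat u d := by
  unfold feat
  split_ifs with h
  · by_cases hk : d.1 = k
    · exact ⟨0, 1, fun u _ => by beta_reduce; rw [hk]; ring⟩
    · exact ⟨u₀ d.1, 0, fun u hu => by beta_reduce; rw [hu _ hk]; ring⟩
  · by_cases hk : d.1 = k
    · exact ⟨0, u₀ d.2, fun u hu => by 
        beta_reduce
        rw [hu d.2 (fun h' => h (hk.trans h'.symm)), hk]; ring⟩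
    · by_cases hk' : d.2 = k
      · exact ⟨0, u₀ d.1, fun u hu => by beta_reduce; rw [hu d.1 hk, hk']; ring⟩
      · exact ⟨u₀ d.1 * u₀ d.2, 0, fun u hu => by beta_reduce; rw [hu _ hk, hu _ hk']; ring⟩

end affine

/-- The frequency attached to a Gaussian integer. -/
def toZ2 (z : GaussianInt) : Z2 := (z.re, z.im)

lemma nsq_toZ2 (z : GaussianInt) : nsq (toZ2 z) = gdot z z := by
  simp only [nsq, toZ2, gdot]; push_cast; ring

lemma toZ2_sub_add (a b c : GaussianInt) :
    toZ2 a - toZ2 b + toZ2 c = toZ2 (a - b + c) := rfl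

lemma resonance_toZ2 (a b c : GaussianInt) :
    resonance (toZ2 a, toZ2 b, toZ2 c) = -2 * gdot (a - b) (c - b) := by
  simp only [resonance, triOut, toZ2_sub_add, nsq_toZ2, gdot, Zsqrtd.re_sub, Zsqrtd.im_sub,
    Zsqrtd.re_add, Zsqrtd.im_add]
  push_cast
  ring

lemma gdot_add_self_le (z w : GaussianInt) :
    gdot (z + w) (z + w) ≤ 2 * gdot z z + 2 * gdot w w := by
  simp only [gdot, Zsqrtd.re_add, Zsqrtd.im_add]
  nlinarith [sq_nonneg (z.re - w.re), sq_nonneg (z.im - w.im)]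

lemma gdot_self_nonneg (z : GaussianInt) : 0 ≤ gdot z z :=
  add_nonneg (mul_self_nonneg _) (mul_self_nonneg _)

lemma gdot_intCast_mul (s : ℤ) (z : GaussianInt) :
    gdot (s * z) (s * z) = s ^ 2 * gdot z z := by
  rw [gdot_mul_left]; simp [gdot, sq]

/-- Multi-affine placement of a finite set of points with prescribed slot values, such that
right angles occur only inside a single slot. -/
theorem exists_generic_position {ι τ κ : Type*} [Fintype ι] [Fintype τ] [Fintype κ]
    {u : ι → κ → GaussianInt} (hu : Function.Injective u) {g : τ → κ}
    (hg : Function.Injective g) :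
    ∃ (P : ι → Z2) (s : ℕ), 1 ≤ s ∧ Function.Injective P ∧
      (∀ a b c, resonance (P a, P b, P c) = 0 → a = b ∨ c = b ∨
        ∃ k, (∀ l, l ≠ k → u a l = u b l ∧ u c l = u b l) ∧
          gdot (u a k - u b k) (u c k - u b k) = 0 ∧ u a k ≠ u b k ∧ u c k ≠ u b k) ∧
      (∀ a b c x k, (∀ l, l ≠ k → u a l = u x l ∧ u b l = u x l ∧ u c l = u x l) →
        u a k - u b k + u c k = u x k → gdot (u a k - u b k) (u c k - u b k) = 0 →
        P a - P b + P c = P x ∧ resonance (P a, P b, P c) = 0) ∧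
      ∀ x, nsq (P x) ≤ (2 * gdot (∏ i, u x (g i)) (∏ i, u x (g i)) + 1) * s ^ 2 ∧
        (gdot (∏ i, u x (g i)) (∏ i, u x (g i)) - 1) * s ^ 2 ≤ 2 * nsq (P x) := by
  classical
  set S : Finset (ι × ι × ι) := Finset.univ.filter fun p =>
    ∃ V, gdot (glin (feat (u p.1) - feat (u p.2.1)) V) (glin (feat (u p.2.2) - feat (u p.2.1)) V)
      ≠ 0 with hS
  obtain ⟨V, hV⟩ := exists_forall_gdot_ne_zero S (fun p => feat (u p.1) - feat (u p.2.1))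
    (fun p => feat (u p.2.2) - feat (u p.2.1)) fun p hp => (Finset.mem_filter.mp hp).2
  set Q : (κ → GaussianInt) → GaussianInt := fun v => ∏ i, v (g i) with hQ
  set r : ι → GaussianInt := fun x => glin (feat (u x)) V with hr
  have hfin : (⋃ p ∈ S, {s : ℤ | gdot (r p.1 - r p.2.1) (r p.2.2 - r p.2.1) +
      (gdot (r p.1 - r p.2.1) (Q (u p.2.2) - Q (u p.2.1)) +
        gdot (Q (u p.1) - Q (u p.2.1)) (r p.2.2 - r p.2.1)) * s +
      gdot (Q (u p.1) - Q (u p.2.1)) (Q (u p.2.2) - Q (u p.2.1)) * s ^ 2 = 0}).Finite := by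
    refine Set.Finite.biUnion (Finset.finite_toSet _) fun p hp =>
      finite_setOf_quadratic_eq_zero (Or.inl ?_)
    have := hV p hp
    simpa only [glin, hr, Pi.sub_apply, sub_mul, Finset.sum_sub_distrib] using this
  obtain ⟨s', hs', hs'S⟩ :=
    (Set.Ici_infinite (1 + ∑ x, 2 * gdot (r x) (r x))).exists_notMem_finite hfin
  have hr0 : ∀ x, 0 ≤ 2 * gdot (r x) (r x) := fun x => by have := gdot_self_nonneg (r x); linarith
  have hs1 : 1 ≤ s' := by
    have := Finset.sum_nonneg fun x (_ : x ∈ Finset.univ) => hr0 x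
    have := Set.mem_Ici.mp hs'
    linarith
  have hrs : ∀ x, 2 * gdot (r x) (r x) ≤ s' ^ 2 := fun x => by
    have h1 := Finset.single_le_sum (fun x _ => hr0 x) (Finset.mem_univ x)
    have h2 := Set.mem_Ici.mp hs'
    nlinarith
  lift s' to ℕ using by omega
  set pos : (κ → GaussianInt) → GaussianInt := fun v => glin (feat v) V + (s' : ℤ) * Q v with hpos
  have hrigid : ∀ a b c, resonance (toZ2 (pos (u a)), toZ2 (pos (u b)), toZ2 (pos (u c))) = 0 →
      a = b ∨ c = b ∨ ∃ k, (∀ l, l ≠ k → u a l = u b l ∧ u c l = u b l) ∧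
          gdot (u a k - u b k) (u c k - u b k) = 0 ∧ u a k ≠ u b k ∧ u c k ≠ u b k := by
    intro a b c h
    have h' : gdot (pos (u a) - pos (u b)) (pos (u c) - pos (u b)) = 0 := by
      rw [resonance_toZ2] at h
      have : ((gdot (pos (u a) - pos (u b)) (pos (u c) - pos (u b)) : ℤ) : ℝ) = 0 := by linarith
      exact_mod_cast this
    by_cases hp : (a, b, c) ∈ S
    · refine absurd (Set.mem_biUnion (Finset.mem_coe.mpr hp) ?_) hs'S
      have e : ∀ x y, pos (u x) - pos (u y) =
          (r x - r y) + (s' : ℤ) * (Q (u x) - Q (u y)) := fun x y => by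
        simp only [hpos, hr]; ring
      rw [e, e, gdot_add_smul] at h'
      exact h'
    · have hall : ∀ V, gdot (glin (feat (u a) - feat (u b)) V)
          (glin (feat (u c) - feat (u b)) V) = 0 := by
        by_contra! hne
        exact hp (Finset.mem_filter.mpr ⟨Finset.mem_univ _, hne⟩)
      rcases eq_or_exists_slot_of_forall_gdot_eq_zero hall with h | h | h
      · exact Or.inl (hu h)
      · exact Or.inr (Or.inl (hu h))
      · exact Or.inr (Or.inr h)
  refine ⟨fun x => toZ2 (pos (u x)), s', by exact_mod_cast hs1, ?_, hrigid, ?_, ?_⟩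
  · intro a b hab
    have h0 : resonance (toZ2 (pos (u a)), toZ2 (pos (u b)), toZ2 (pos (u a))) = 0 := by
      have : toZ2 (pos (u a)) = toZ2 (pos (u b)) := hab
      rw [this, resonance_toZ2, sub_self]
      simp [gdot]
    rcases hrigid a b a h0 with h | h | ⟨k, -, h, hne, -⟩
    · exact h
    · exact h
    · exact absurd (sub_eq_zero.mp (gdot_self_eq_zero h)) hne
  · intro a b c x k hoff hk hdot
    obtain ⟨A, B, hAB⟩ : AffineInSlot k (u x) pos := by
      refine AffineInSlot.add (AffineInSlot.sum (S := Finset.univ) fun d => ?_)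
        ((AffineInSlot.prod Finset.univ hg).const_mul _)
      obtain ⟨A, B, h⟩ := (affineInSlot_feat d (k := k) (u₀ := u x)).const_mul (V d)
      exact ⟨A, B, fun v hv => (mul_comm _ _).trans (h v hv)⟩
    have ha := hAB (u a) fun l hl => (hoff l hl).1
    have hb := hAB (u b) fun l hl => (hoff l hl).2.1
    have hc := hAB (u c) fun l hl => (hoff l hl).2.2
    have hx := hAB (u x) fun l hl => rfl
    constructor
    · beta_reduce
      rw [toZ2_sub_add, ha, hb, hc, hx, ← hk]
      congr 1; ring
    · have e1 : pos (u a) - pos (u b) = B * (u a k - u b k) := by rw [ha, hb]; ring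
      have e2 : pos (u c) - pos (u b) = B * (u c k - u b k) := by rw [hc, hb]; ring
      rw [resonance_toZ2, e1, e2, gdot_mul_left, hdot]
      simp
  · intro x
    have h1 := gdot_add_self_le (r x) ((s' : ℤ) * Q (u x))
    have h2 := gdot_add_self_le (pos (u x)) (-r x)
    have e : pos (u x) + -r x = (s' : ℤ) * Q (u x) := by simp only [hpos, hr]; ring
    have en : gdot (-r x) (-r x) = gdot (r x) (r x) := by
      simp only [gdot, Zsqrtd.re_neg, Zsqrtd.im_neg]; ring
    have h3 := hrs x
    rw [e, en, gdot_intCast_mul] at h2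
    rw [gdot_intCast_mul] at h1
    rw [nsq_toZ2]
    have h1' : gdot (pos (u x)) (pos (u x)) ≤ (2 * gdot (Q (u x)) (Q (u x)) + 1) * s' ^ 2 := by
      have : gdot (pos (u x)) (pos (u x)) ≤ _ := h1
      linarith
    have h2' : (gdot (Q (u x)) (Q (u x)) - 1) * s' ^ 2 ≤ 2 * gdot (pos (u x)) (pos (u x)) := by
      linarith
    constructor
    · exact_mod_cast h1'
    · exact_mod_cast h2'

/-- Index set of the grid carrying the phases. -/
abbrev GridG := Fin 5 × Fin 5 × Bool

/-- Index set of the grid without phases. -/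
abbrev GridH := Fin 2 × Fin 3

/-- Index set of the modes: a generation, a vertex of a cube and two grid points. -/
abbrev Idx (m : ℕ) := Fin (m + 1) × (Fin m → Bool) × GridG × GridH

/-- Vertices of the unit square; the first argument selects the diagonal. -/
def treeVal : Bool → Bool → GaussianInt
  | false, false => ⟨1, 0⟩
  | false, true => ⟨0, 1⟩
  | true, false => ⟨1, 1⟩
  | true, true => ⟨0, 0⟩

/-- The points of a very elongated grid. -/
def gridVal (i k : ℕ) : GaussianInt := ⟨i, 100 * k⟩

/-- The second coordinate of a point of the grid carrying the phases. -/
def colNum (c : Fin 5 × Bool) : ℕ := 2 * c.1 + c.2.toNat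

lemma colNum_injective : Function.Injective colNum := by decide

section lattice

variable {m : ℕ}

/-- Whether the slot `k` is active in the generation `j`. -/
def isActive (k : Fin m) (j : Fin (m + 1)) : Bool := decide ((k : ℕ) < j)

/-- The slot values of a mode. -/
def slotVal (x : Idx m) : Fin m ⊕ Bool → GaussianInt
  | .inl k => treeVal (isActive k x.1) (x.2.1 k)
  | .inr false => gridVal x.2.2.1.1 (colNum x.2.2.1.2)
  | .inr true => gridVal x.2.2.2.1 x.2.2.2.2

lemma treeVal_inj : ∀ {a b c d : Bool}, treeVal a b = treeVal c d → a = c ∧ b = d := by decide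

lemma gridVal_inj {i k i' k' : ℕ} (h : gridVal i k = gridVal i' k') : i = i' ∧ k = k' := by
  simp only [gridVal, Zsqrtd.mk.injEq] at h
  omega

lemma grid_eq_of_slotVal_false {x y : Idx m} (h : slotVal x (.inr false) = slotVal y (.inr false)) :
    x.2.2.1 = y.2.2.1 := by
  obtain ⟨h1, h2⟩ := gridVal_inj h
  exact Prod.ext (Fin.ext h1) (colNum_injective h2)

lemma grid_eq_of_slotVal_true {x y : Idx m} (h : slotVal x (.inr true) = slotVal y (.inr true)) :
    x.2.2.2 = y.2.2.2 := by
  obtain ⟨h1, h2⟩ := gridVal_inj h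
  exact Prod.ext (Fin.ext h1) (Fin.ext h2)

lemma tree_eq_of_slotVal {x y : Idx m} {k : Fin m} (h : slotVal x (.inl k) = slotVal y (.inl k)) :
    ((k : ℕ) < x.1 ↔ (k : ℕ) < y.1) ∧ x.2.1 k = y.2.1 k := by
  obtain ⟨h1, h2⟩ := treeVal_inj h
  exact ⟨by simpa [isActive] using h1, h2⟩

lemma gen_eq {i j : Fin (m + 1)} (h : ∀ k : Fin m, (k : ℕ) < i ↔ (k : ℕ) < j) : i = j := by
  rcases lt_trichotomy (i : ℕ) j with hlt | heq | hlt
  · have := h ⟨i, by omega⟩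
    simp only at this; omega
  · exact Fin.ext heq
  · have := h ⟨j, by omega⟩
    simp only at this; omega

lemma gen_eq_or {i j : Fin (m + 1)} {k₀ : Fin m}
    (h : ∀ k : Fin m, k ≠ k₀ → ((k : ℕ) < i ↔ (k : ℕ) < j)) :
    i = j ∨ ((i : ℕ) = k₀ ∧ (j : ℕ) = k₀ + 1) ∨ ((i : ℕ) = k₀ + 1 ∧ (j : ℕ) = k₀) := by
  have key : ∀ i j : Fin (m + 1), (∀ k : Fin m, k ≠ k₀ → ((k : ℕ) < i ↔ (k : ℕ) < j)) →
      (i : ℕ) < j → (i : ℕ) = k₀ ∧ (j : ℕ) = k₀ + 1 := by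
    intro i j h hlt
    have h1 : (i : ℕ) = k₀ := by
      by_contra hne
      have := h ⟨i, by omega⟩ (fun e => hne (congrArg Fin.val e))
      simp only at this; omega
    refine ⟨h1, ?_⟩
    by_contra hne
    have := h ⟨i + 1, by omega⟩ (fun e => by have := congrArg Fin.val e; simp only at this; omega)
    simp only at this; omega
  rcases lt_trichotomy (i : ℕ) j with hlt | heq | hlt
  · exact Or.inr (Or.inl (key i j h hlt))
  · exact Or.inl (Fin.ext heq)
  · exact Or.inr (Or.inr (key j i (fun k hk => (h k hk).symm) hlt).symm)

lemma slotVal_injective : Function.Injective (slotVal (m := m)) := fun x y h => by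
  have ht := fun k => tree_eq_of_slotVal (congrFun h (.inl k))
  exact Prod.ext (gen_eq fun k => (ht k).1) (Prod.ext (funext fun k => (ht k).2)
    (Prod.ext (grid_eq_of_slotVal_false (congrFun h _)) (grid_eq_of_slotVal_true (congrFun h _))))

lemma grid_right_angle {i i' i'' k k' k'' : ℕ} (hi : i < 5) (hi' : i' < 5) (hi'' : i'' < 5)
    (h : gdot (gridVal i k - gridVal i' k') (gridVal i'' k'' - gridVal i' k') = 0)
    (h1 : gridVal i k ≠ gridVal i' k') (h2 : gridVal i'' k'' ≠ gridVal i' k') :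
    (i = i' ∧ k'' = k' ∧ i'' ≠ i' ∧ k ≠ k') ∨ (k = k' ∧ i'' = i' ∧ i ≠ i' ∧ k'' ≠ k') := by
  have h1' : ¬ (i = i' ∧ k = k') := fun e => h1 (by rw [e.1, e.2])
  have h2' : ¬ (i'' = i' ∧ k'' = k') := fun e => h2 (by rw [e.1, e.2])
  simp only [gdot, gridVal, Zsqrtd.re_sub, Zsqrtd.im_sub] at h
  have hA : |((i : ℤ) - i') * ((i'' : ℤ) - i')| ≤ 4 * 4 := by
    rw [abs_mul]
    exact mul_le_mul (abs_le.mpr (by omega)) (abs_le.mpr (by omega)) (abs_nonneg _) (by norm_num)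
  rw [abs_le] at hA
  have hB : (100 * (k : ℤ) - 100 * k') * (100 * (k'' : ℤ) - 100 * k') =
      10000 * (((k : ℤ) - k') * ((k'' : ℤ) - k')) := by ring
  rw [hB] at h
  have hB0 : ((k : ℤ) - k') * ((k'' : ℤ) - k') = 0 := by omega
  have hA0 : ((i : ℤ) - i') * ((i'' : ℤ) - i') = 0 := by omega
  rcases mul_eq_zero.mp hB0 with hB0 | hB0 <;> rcases mul_eq_zero.mp hA0 with hA0 | hA0 <;> omega

lemma tree_right_angle : ∀ {p z p' z' p'' z'' : Bool},
    gdot (treeVal p z - treeVal p' z') (treeVal p'' z'' - treeVal p' z') = 0 →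
    treeVal p z ≠ treeVal p' z' → treeVal p'' z'' ≠ treeVal p' z' →
    p = !p' ∧ p'' = !p' ∧ z'' = !z := by decide

/-- Flip one coordinate. -/
def flipAt (k : Fin m) (z : Fin m → Bool) : Fin m → Bool := Function.update z k (!z k)

lemma flipAt_flipAt (k : Fin m) (z : Fin m → Bool) : flipAt k (flipAt k z) = z := by
  funext l
  by_cases h : l = k
  · subst h; simp [flipAt]
  · simp [flipAt, h]

/-- The other generation of a family in the slot `k`. -/
def otherGen (k : Fin m) (j : Fin (m + 1)) : Fin (m + 1) :=
  if (j : ℕ) = k then k.succ else k.castSucc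

/-- Labels for the nondegenerate rectangles with a given corner. -/
abbrev RectLabel (m : ℕ) := GridG ⊕ GridH ⊕ Fin m

/-- The labels which define a rectangle with corner `x`. -/
def RectValid (x : Idx m) : RectLabel m → Prop
  | .inl g => g.1 ≠ x.2.2.1.1 ∧ g.2 ≠ x.2.2.1.2
  | .inr (.inl h) => h.1 ≠ x.2.2.2.1 ∧ h.2 ≠ x.2.2.2.2
  | .inr (.inr k) => (x.1 : ℕ) = k ∨ (x.1 : ℕ) = k + 1

/-- The corner opposite to `x`. -/
def rectOpp (x : Idx m) : RectLabel m → Idx m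
  | .inl g => (x.1, x.2.1, g, x.2.2.2)
  | .inr (.inl h) => (x.1, x.2.1, x.2.2.1, h)
  | .inr (.inr k) => (x.1, flipAt k x.2.1, x.2.2)

/-- The corners adjacent to `x`. -/
def rectAdj (x : Idx m) : RectLabel m → Bool → Idx m
  | .inl g, true => (x.1, x.2.1, (x.2.2.1.1, g.2), x.2.2.2)
  | .inl g, false => (x.1, x.2.1, (g.1, x.2.2.1.2), x.2.2.2)
  | .inr (.inl h), true => (x.1, x.2.1, x.2.2.1, (x.2.2.2.1, h.2))
  | .inr (.inl h), false => (x.1, x.2.1, x.2.2.1, (h.1, x.2.2.2.2))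
  | .inr (.inr k), true => (otherGen k x.1, x.2.1, x.2.2)
  | .inr (.inr k), false => (otherGen k x.1, flipAt k x.2.1, x.2.2)

/-- The interacting triple of a labelled rectangle. -/
def rectTriple (x : Idx m) (c : RectLabel m × Bool) : Idx m × Idx m × Idx m :=
  (rectAdj x c.1 c.2, rectOpp x c.1, rectAdj x c.1 (!c.2))

lemma isActive_otherGen {k l : Fin m} {j : Fin (m + 1)} (hj : (j : ℕ) = k ∨ (j : ℕ) = k + 1)
    (hl : l ≠ k) : isActive l (otherGen k j) = isActive l j := by
  have : (l : ℕ) ≠ k := fun h => hl (Fin.ext h)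
  rw [isActive, isActive, decide_eq_decide]
  unfold otherGen
  split_ifs with h
  · simp only [Fin.val_succ]; omega
  · simp only [Fin.val_castSucc]; omega

lemma isActive_otherGen_self {k : Fin m} {j : Fin (m + 1)} (hj : (j : ℕ) = k ∨ (j : ℕ) = k + 1) :
    isActive k (otherGen k j) = !isActive k j := by
  unfold otherGen isActive
  split_ifs with h
  · simp [h]
  · have : (j : ℕ) = k + 1 := by omega
    simp [this]

/-- The corners of a labelled rectangle differ in one slot only, where they form a rectangle. -/
lemma exists_slot_of_rectValid {x : Idx m} {c : RectLabel m × Bool} (hc : RectValid x c.1) :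
    ∃ k, (∀ l, l ≠ k → slotVal (rectAdj x c.1 c.2) l = slotVal x l ∧
        slotVal (rectOpp x c.1) l = slotVal x l ∧
        slotVal (rectAdj x c.1 (!c.2)) l = slotVal x l) ∧
      slotVal (rectAdj x c.1 c.2) k - slotVal (rectOpp x c.1) k +
        slotVal (rectAdj x c.1 (!c.2)) k = slotVal x k ∧
      gdot (slotVal (rectAdj x c.1 c.2) k - slotVal (rectOpp x c.1) k)
        (slotVal (rectAdj x c.1 (!c.2)) k - slotVal (rectOpp x c.1) k) = 0 := by
  obtain ⟨c, b⟩ := c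
  rcases c with g | h | k
  · refine ⟨.inr false, ?_, ?_⟩
    · rintro (l | _ | _) hl
      · cases b <;> exact ⟨rfl, rfl, rfl⟩
      · exact absurd rfl hl
      · cases b <;> exact ⟨rfl, rfl, rfl⟩
    · cases b <;> simp only [slotVal, rectAdj, rectOpp, Bool.not_true, Bool.not_false] <;>
        constructor
      all_goals first
        | (apply Zsqrtd.ext <;> simp [gridVal]; done)
        | simp [gdot, gridVal]
  · refine ⟨.inr true, ?_, ?_⟩
    · rintro (l | _ | _) hl
      · cases b <;> exact ⟨rfl, rfl, rfl⟩
      · cases b <;> exact ⟨rfl, rfl, rfl⟩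
      · exact absurd rfl hl
    · cases b <;> simp only [slotVal, rectAdj, rectOpp, Bool.not_true, Bool.not_false] <;>
        constructor
      all_goals first
        | (apply Zsqrtd.ext <;> simp [gridVal]; done)
        | simp [gdot, gridVal]
  · have hk : (x.1 : ℕ) = k ∨ (x.1 : ℕ) = k + 1 := hc
    refine ⟨.inl k, ?_, ?_⟩
    · rintro (l | _ | _) hl
      · have hl' : l ≠ k := fun e => hl (congrArg _ e)
        have hf : flipAt k x.2.1 l = x.2.1 l := by simp [flipAt, hl']
        cases b <;> simp only [slotVal, rectAdj, rectOpp, Bool.not_true, Bool.not_false,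
          isActive_otherGen hk hl', hf, and_self]
      · cases b <;> exact ⟨rfl, rfl, rfl⟩
      · cases b <;> exact ⟨rfl, rfl, rfl⟩
    · have hf : flipAt k x.2.1 k = !x.2.1 k := by simp [flipAt]
      have main : ∀ p z : Bool,
          (treeVal (!p) z - treeVal p (!z) + treeVal (!p) (!z) = treeVal p z ∧
            gdot (treeVal (!p) z - treeVal p (!z)) (treeVal (!p) (!z) - treeVal p (!z)) = 0) ∧
          (treeVal (!p) (!z) - treeVal p (!z) + treeVal (!p) z = treeVal p z ∧
            gdot (treeVal (!p) (!z) - treeVal p (!z)) (treeVal (!p) z - treeVal p (!z)) = 0) := by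
        decide
      have := main (isActive k x.1) (x.2.1 k)
      cases b <;> simp only [slotVal, rectAdj, rectOpp, Bool.not_true, Bool.not_false, hf,
        isActive_otherGen_self hk]
      · exact this.2
      · exact this.1

/-- Right angles inside one slot are corners of labelled rectangles. -/
lemma exists_rectTriple_eq {a b c : Idx m} {k : Fin m ⊕ Bool}
    (hoff : ∀ l, l ≠ k → slotVal a l = slotVal b l ∧ slotVal c l = slotVal b l)
    (hdot : gdot (slotVal a k - slotVal b k) (slotVal c k - slotVal b k) = 0)
    (hab : slotVal a k ≠ slotVal b k) (hcb : slotVal c k ≠ slotVal b k) :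
    ∃ x d, RectValid x d.1 ∧ rectTriple x d = (a, b, c) := by
  obtain ⟨ja, za, ga, ha⟩ := a
  obtain ⟨jb, zb, gb, hb⟩ := b
  obtain ⟨jc, zc, gc, hc⟩ := c
  rcases k with k | _ | _
  · have hG := hoff (.inr false) (by simp)
    have hH := hoff (.inr true) (by simp)
    obtain rfl : ga = gb := grid_eq_of_slotVal_false hG.1
    obtain rfl : gc = ga := grid_eq_of_slotVal_false hG.2
    obtain rfl : ha = hb := grid_eq_of_slotVal_true hH.1
    obtain rfl : hc = ha := grid_eq_of_slotVal_true hH.2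
    have hT := fun l (hl : l ≠ k) => hoff (.inl l) (by simpa using hl)
    have hTa := fun l (hl : l ≠ k) => tree_eq_of_slotVal (hT l hl).1
    have hTc := fun l (hl : l ≠ k) => tree_eq_of_slotVal (hT l hl).2
    have hja := gen_eq_or fun l hl => (hTa l hl).1
    have hjc := gen_eq_or fun l hl => (hTc l hl).1
    simp only at hTa hTc hja hjc
    obtain ⟨h1, h2, h3⟩ := tree_right_angle hdot hab hcb
    simp only [isActive] at h1 h2 h3
    have hja' : ((ja : ℕ) = k ∧ (jb : ℕ) = k + 1) ∨ ((ja : ℕ) = k + 1 ∧ (jb : ℕ) = k) := by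
      rcases hja with rfl | h | h
      · simp at h1
      · exact Or.inl h
      · exact Or.inr h
    have hjc' : ((jc : ℕ) = k ∧ (jb : ℕ) = k + 1) ∨ ((jc : ℕ) = k + 1 ∧ (jb : ℕ) = k) := by
      rcases hjc with rfl | h | h
      · simp at h2
      · exact Or.inl h
      · exact Or.inr h
    have hv : (jb : ℕ) = k ∨ (jb : ℕ) = k + 1 := by omega
    have hoa : otherGen k jb = ja := by
      unfold otherGen
      split_ifs with h <;> apply Fin.ext
      · simp only [Fin.val_succ]; omega
      · simp only [Fin.val_castSucc]; omega
    have hoc : otherGen k jb = jc := by rw [hoa]; apply Fin.ext; omega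
    have hz : ∀ z : Fin m → Bool, (∀ l, l ≠ k → z l = zb l) → z = if z k = zb k then zb else
        flipAt k zb := fun z hz => by
      funext l
      by_cases hl : l = k
      · subst hl
        split_ifs with h
        · exact h
        · simp only [flipAt, Function.update_self]
          exact Bool.eq_not_of_ne h
      · split_ifs
        · exact hz l hl
        · rw [hz l hl, flipAt, Function.update_of_ne hl]
    have hza := hz za fun l hl => (hTa l hl).2
    have hzc := hz zc fun l hl => (hTc l hl).2
    by_cases hk : za k = zb k
    · have hk' : ¬ zc k = zb k := by rw [h3, hk]; simp
      rw [if_pos hk] at hza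
      rw [if_neg hk'] at hzc
      refine ⟨(jb, flipAt k zb, gc, hc), (.inr (.inr k), false), hv, ?_⟩
      simp only [rectTriple, rectAdj, rectOpp, Bool.not_false, flipAt_flipAt]
      rw [hza, hzc, hoa, ← hoc, hoa]
    · have hk' : zc k = zb k := by
        rw [h3]; revert hk; cases za k <;> cases zb k <;> simp
      rw [if_neg hk] at hza
      rw [if_pos hk'] at hzc
      refine ⟨(jb, flipAt k zb, gc, hc), (.inr (.inr k), true), hv, ?_⟩
      simp only [rectTriple, rectAdj, rectOpp, Bool.not_true, flipAt_flipAt]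
      rw [hza, hzc, hoa, ← hoc, hoa]
  · have hT := fun l => hoff (.inl l) (by simp)
    have hTa := fun l => tree_eq_of_slotVal (hT l).1
    have hTc := fun l => tree_eq_of_slotVal (hT l).2
    obtain rfl : ja = jb := gen_eq fun l => (hTa l).1
    obtain rfl : jc = ja := gen_eq fun l => (hTc l).1
    obtain rfl : za = zb := funext fun l => (hTa l).2
    obtain rfl : zc = za := funext fun l => (hTc l).2
    have hH := hoff (.inr true) (by simp)
    obtain rfl : ha = hb := grid_eq_of_slotVal_true hH.1
    obtain rfl : hc = ha := grid_eq_of_slotVal_true hH.2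
    obtain ⟨ga1, ga2⟩ := ga
    obtain ⟨gb1, gb2⟩ := gb
    obtain ⟨gc1, gc2⟩ := gc
    rcases grid_right_angle (by omega) (by omega) (by omega) hdot hab hcb with
      ⟨h1, h2, h3, h4⟩ | ⟨h1, h2, h3, h4⟩
    · obtain rfl : ga1 = gb1 := Fin.ext h1
      obtain rfl : gc2 = gb2 := colNum_injective h2
      exact ⟨(jc, zc, (gc1, ga2), hc), (.inl (ga1, gc2), false),
        ⟨fun h => h3 (congrArg _ h.symm), fun h => h4 (congrArg _ h.symm)⟩, rfl⟩
    · obtain rfl : ga2 = gb2 := colNum_injective h1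
      obtain rfl : gc1 = gb1 := Fin.ext h2
      exact ⟨(jc, zc, (ga1, gc2), hc), (.inl (gc1, ga2), true),
        ⟨fun h => h3 (congrArg _ h.symm), fun h => h4 (congrArg _ h.symm)⟩, rfl⟩
  · have hT := fun l => hoff (.inl l) (by simp)
    have hTa := fun l => tree_eq_of_slotVal (hT l).1
    have hTc := fun l => tree_eq_of_slotVal (hT l).2
    obtain rfl : ja = jb := gen_eq fun l => (hTa l).1
    obtain rfl : jc = ja := gen_eq fun l => (hTc l).1
    obtain rfl : za = zb := funext fun l => (hTa l).2
    obtain rfl : zc = za := funext fun l => (hTc l).2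
    have hG := hoff (.inr false) (by simp)
    obtain rfl : ga = gb := grid_eq_of_slotVal_false hG.1
    obtain rfl : gc = ga := grid_eq_of_slotVal_false hG.2
    obtain ⟨ha1, ha2⟩ := ha
    obtain ⟨hb1, hb2⟩ := hb
    obtain ⟨hc1, hc2⟩ := hc
    rcases grid_right_angle (by omega) (by omega) (by omega) hdot hab hcb with
      ⟨h1, h2, h3, h4⟩ | ⟨h1, h2, h3, h4⟩
    · obtain rfl : ha1 = hb1 := Fin.ext h1
      obtain rfl : hc2 = hb2 := Fin.ext h2
      exact ⟨(jc, zc, gc, (hc1, ha2)), (.inr (.inl (ha1, hc2)), false),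
        ⟨fun h => h3 (congrArg _ h.symm), fun h => h4 (congrArg _ h.symm)⟩, rfl⟩
    · obtain rfl : ha2 = hb2 := Fin.ext h1
      obtain rfl : hc1 = hb1 := Fin.ext h2
      exact ⟨(jc, zc, gc, (ha1, hc2)), (.inr (.inl (hc1, ha2)), true),
        ⟨fun h => h3 (congrArg _ h.symm), fun h => h4 (congrArg _ h.symm)⟩, rfl⟩

lemma flipAt_ne (k : Fin m) (z : Fin m → Bool) : flipAt k z ≠ z := fun h => by
  simpa [flipAt] using congrFun h k

lemma otherGen_ne {k : Fin m} {j : Fin (m + 1)} (hj : (j : ℕ) = k ∨ (j : ℕ) = k + 1) :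
    otherGen k j ≠ j := fun h => by
  simpa [h] using isActive_otherGen_self hj

lemma rectAdj_ne_rectOpp {x : Idx m} {c : RectLabel m} (hc : RectValid x c) (b : Bool) :
    rectAdj x c b ≠ rectOpp x c := by
  intro h
  rcases c with g | h' | k
  · cases b
    · exact hc.2 (congrArg (fun y : Idx m => y.2.2.1.2) h).symm
    · exact hc.1 (congrArg (fun y : Idx m => y.2.2.1.1) h).symm
  · cases b
    · exact hc.2 (congrArg (fun y : Idx m => y.2.2.2.2) h).symm
    · exact hc.1 (congrArg (fun y : Idx m => y.2.2.2.1) h).symm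
  · refine otherGen_ne hc (j := x.1) ?_
    cases b <;> exact congrArg (fun y : Idx m => y.1) h

lemma rectAdj_true_ne_false {x : Idx m} {c : RectLabel m} (hc : RectValid x c) :
    rectAdj x c true ≠ rectAdj x c false := by
  intro h
  rcases c with g | h' | k
  · exact hc.1 (congrArg (fun y : Idx m => y.2.2.1.1) h).symm
  · exact hc.1 (congrArg (fun y : Idx m => y.2.2.2.1) h).symm
  · exact flipAt_ne k x.2.1 (congrArg (fun y : Idx m => y.2.1) h).symm

lemma rectOpp_inj {x : Idx m} {c c' : RectLabel m} (hc : RectValid x c) (hc' : RectValid x c')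
    (h : rectOpp x c = rectOpp x c') : c = c' := by
  have h1 := congrArg (fun y : Idx m => y.2.2.1) h
  have h2 := congrArg (fun y : Idx m => y.2.2.2) h
  have h3 := congrArg (fun y : Idx m => y.2.1) h
  rcases c with g | g | k <;> rcases c' with g' | g' | k' <;>
    simp only [rectOpp, RectValid] at h1 h2 h3 hc hc'
  · rw [h1]
  · exact absurd (congrArg Prod.fst h1) hc.1
  · exact absurd (congrArg Prod.fst h1) hc.1
  · exact absurd (congrArg Prod.fst h2) hc.1
  · rw [h2]
  · exact absurd (congrArg Prod.fst h2) hc.1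
  · exact absurd h3 (flipAt_ne k x.2.1)
  · exact absurd h3 (flipAt_ne k x.2.1)
  · by_contra hne
    have hkk : k ≠ k' := fun e => hne (by rw [e])
    have := congrFun h3 k
    simp [flipAt, hkk] at this

lemma rectTriple_inj {x : Idx m} {c c' : RectLabel m × Bool} (hc : RectValid x c.1)
    (hc' : RectValid x c'.1) (h : rectTriple x c = rectTriple x c') : c = c' := by
  obtain ⟨c, b⟩ := c
  obtain ⟨c', b'⟩ := c'
  obtain rfl : c = c' := rectOpp_inj hc hc' (congrArg (fun q => q.2.1) h)
  have h1 : rectAdj x c b = rectAdj x c b' := congrArg (fun q => q.1) h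
  have h2 := rectAdj_true_ne_false hc
  cases b <;> cases b'
  · rfl
  · exact absurd h1.symm h2
  · exact absurd h1 h2
  · rfl

lemma gdot_prod {τ : Type*} (S : Finset τ) (f : τ → GaussianInt) :
    gdot (∏ i ∈ S, f i) (∏ i ∈ S, f i) = ∏ i ∈ S, gdot (f i) (f i) := by
  classical
  induction S using Finset.induction_on with
  | empty => simp [gdot]
  | insert i S hi ih => rw [Finset.prod_insert hi, Finset.prod_insert hi, gdot_mul_left, ih]

lemma gdot_treeVal_le : ∀ p z, gdot (treeVal p z) (treeVal p z) ≤ 2 := by decide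

/-- Squared modulus of the product of the tree slot values. -/
def treeSize (x : Idx m) : ℤ :=
  gdot (∏ k, slotVal x (.inl k)) (∏ k, slotVal x (.inl k))

lemma treeSize_le (x : Idx m) : treeSize x ≤ 2 ^ m := by
  rw [treeSize, gdot_prod]
  refine (Finset.prod_le_prod (fun k _ => gdot_self_nonneg _)
    (fun k _ => gdot_treeVal_le _ _)).trans_eq ?_
  rw [Finset.prod_const, Finset.card_univ, Fintype.card_fin]

lemma treeSize_zero (y : (Fin m → Bool) × GridG × GridH) : treeSize ((0, y) : Idx m) = 1 := by
  rw [treeSize, gdot_prod]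
  refine Finset.prod_eq_one fun k _ => ?_
  simp only [slotVal, isActive, Fin.val_zero, Nat.not_lt_zero, decide_false]
  cases y.1 k <;> rfl

lemma treeSize_last (g : GridG × GridH) :
    treeSize ((Fin.last m, fun _ => false, g) : Idx m) = 2 ^ m := by
  rw [treeSize, gdot_prod]
  refine (Finset.prod_congr rfl fun k _ => ?_).trans
    (by rw [Finset.prod_const, Finset.card_univ, Fintype.card_fin])
  simp only [slotVal, isActive, Fin.val_last, Fin.is_lt, decide_true]
  rfl

/-- The placement of the modes in the frequency lattice. -/
theorem exists_placement (m : ℕ) :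
    ∃ (P : Idx m → Z2) (s : ℕ), 1 ≤ s ∧ Function.Injective P ∧
      (∀ a b c, resonance (P a, P b, P c) = 0 → a = b ∨ c = b ∨
        ∃ (x : Idx m) (d : RectLabel m × Bool), RectValid x d.1 ∧ rectTriple x d = (a, b, c)) ∧
      (∀ (x : Idx m) (d : RectLabel m × Bool), RectValid x d.1 → P (rectAdj x d.1 d.2) - P (rectOpp x d.1) +
          P (rectAdj x d.1 (!d.2)) = P x ∧
        resonance (P (rectAdj x d.1 d.2), P (rectOpp x d.1), P (rectAdj x d.1 (!d.2))) = 0) ∧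
      ∀ x, nsq (P x) ≤ (2 * treeSize x + 1) * s ^ 2 ∧
        (treeSize x - 1) * s ^ 2 ≤ 2 * nsq (P x) := by
  obtain ⟨P, s, hs, hP, h1, h2, h3⟩ := exists_generic_position (slotVal_injective (m := m))
    (g := (Sum.inl : Fin m → Fin m ⊕ Bool)) Sum.inl_injective
  refine ⟨P, s, hs, hP, fun a b c h => ?_, fun x d hd => ?_, h3⟩
  · rcases h1 a b c h with h | h | ⟨k, hoff, hdot, hab, hcb⟩
    · exact Or.inl h
    · exact Or.inr (Or.inl h)
    · exact Or.inr (Or.inr (exists_rectTriple_eq hoff hdot hab hcb))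
  · obtain ⟨k, hoff, hk, hdot⟩ := exists_slot_of_rectValid hd
    exact h2 _ _ _ x k hoff hk hdot

open Classical in
/-- The index triples which feed the mode `x` resonantly. -/
def feeding (x : Idx m) : Finset (Idx m × Idx m × Idx m) :=
  (Finset.univ.image fun y => (y, y, x)) ∪
    (((Finset.univ.erase x).image fun y => (x, y, y)) ∪
      (Finset.univ.filter fun c : RectLabel m × Bool => RectValid x c.1).image (rectTriple x))

lemma mem_feeding {x : Idx m} {q : Idx m × Idx m × Idx m} :
    q ∈ feeding x ↔ (∃ y, (y, y, x) = q) ∨ (∃ y, y ≠ x ∧ (x, y, y) = q) ∨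
      ∃ c : RectLabel m × Bool, RectValid x c.1 ∧ rectTriple x c = q := by
  simp [feeding]

set_option maxRecDepth 10000 in
open Classical in
lemma sum_feeding (x : Idx m) (F : Idx m × Idx m × Idx m → ℂ) :
    ∑ q ∈ feeding x, F q = ∑ y, F (y, y, x) + (∑ y, F (x, y, y) - F (x, x, x)) +
      ∑ c : RectLabel m, if RectValid x c then F (rectTriple x (c, true)) +
        F (rectTriple x (c, false)) else 0 := by
  have h1 : Disjoint ((Finset.univ.erase x).image fun y => (x, y, y))
      ((Finset.univ.filter fun c : RectLabel m × Bool => RectValid x c.1).image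
        (rectTriple x)) := by
    rw [Finset.disjoint_left]
    intro q hq hq'
    simp only [Finset.mem_image, Finset.mem_filter, Finset.mem_univ, true_and] at hq hq'
    obtain ⟨y, -, rfl⟩ := hq
    obtain ⟨c, hc, h⟩ := hq'
    exact rectAdj_ne_rectOpp hc (!c.2)
      ((congrArg (fun q => q.2.2) h).trans (congrArg (fun q => q.2.1) h).symm)
  have h2 : Disjoint (Finset.univ.image fun y => (y, y, x))
      (((Finset.univ.erase x).image fun y => (x, y, y)) ∪
      (Finset.univ.filter fun c : RectLabel m × Bool => RectValid x c.1).image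
        (rectTriple x)) := by
    rw [Finset.disjoint_left]
    intro q hq hq'
    simp only [Finset.mem_image, Finset.mem_filter, Finset.mem_univ, true_and, Finset.mem_union,
      Finset.mem_erase, and_true] at hq hq'
    obtain ⟨y, rfl⟩ := hq
    rcases hq' with ⟨z, hz, h⟩ | ⟨c, hc, h⟩
    · exact hz (congrArg (fun q => q.2.2) h)
    · exact rectAdj_ne_rectOpp hc c.2
        ((congrArg (fun q => q.1) h).trans (congrArg (fun q => q.2.1) h).symm)
  rw [feeding, Finset.sum_union h2, Finset.sum_union h1, Finset.sum_image, Finset.sum_image,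
    Finset.sum_image, Finset.sum_erase_eq_sub (Finset.mem_univ x), add_assoc]
  · rw [add_right_inj, add_right_inj]
    rw [Finset.sum_filter, Fintype.sum_prod_type]
    refine Finset.sum_congr rfl fun c _ => ?_
    rw [Fintype.sum_bool]
    split_ifs <;> simp
  · intro c hc c' hc' h
    simp only [Finset.coe_filter, Finset.mem_univ, true_and, Set.mem_ofPred_eq] at hc hc'
    exact rectTriple_inj hc hc' h
  · intro y _ y' _ h
    exact congrArg (fun q => q.2.1) h
  · intro y _ y' _ h
    exact congrArg (fun q => q.2.1) h

open Classical in
/-- The resonant part of the cubic nonlinearity. -/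
lemma sum_resonant {P : Idx m → Z2} (hP : Function.Injective P)
    (h1 : ∀ a b c, resonance (P a, P b, P c) = 0 → a = b ∨ c = b ∨
        ∃ (x : Idx m) (d : RectLabel m × Bool), RectValid x d.1 ∧ rectTriple x d = (a, b, c))
    (h2 : ∀ (x : Idx m) (d : RectLabel m × Bool), RectValid x d.1 → P (rectAdj x d.1 d.2) -
          P (rectOpp x d.1) + P (rectAdj x d.1 (!d.2)) = P x ∧
        resonance (P (rectAdj x d.1 d.2), P (rectOpp x d.1), P (rectAdj x d.1 (!d.2))) = 0)
    (F : Idx m × Idx m × Idx m → ℂ) (φ : Z2 → Ell1) :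
    (∑ q : Idx m × Idx m × Idx m, if resonance (freq P 1 q) = 0 then
      F q • φ (triOut (freq P 1 q)) else 0) = ∑ x, (∑ q ∈ feeding x, F q) • φ (P x) := by
  have hfreq : ∀ q, freq P 1 q = (P q.1, P q.2.1, P q.2.2) := fun q => by
    simp only [freq, one_smul]
  have hf : ∀ x q, q ∈ feeding x → triOut (freq P 1 q) = P x ∧ resonance (freq P 1 q) = 0 := by
    intro x q hq
    rw [hfreq]
    rcases mem_feeding.mp hq with ⟨y, rfl⟩ | ⟨y, -, rfl⟩ | ⟨c, hc, rfl⟩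
    · have : triOut (P y, P y, P x) = P x := by simp [triOut]
      exact ⟨this, by rw [resonance, this]; ring⟩
    · have : triOut (P x, P y, P y) = P x := by simp [triOut]
      exact ⟨this, by rw [resonance, this]; ring⟩
    · exact h2 x c hc
  have hex : ∀ q, resonance (freq P 1 q) = 0 → ∃ x, q ∈ feeding x := by
    rintro ⟨a, b, c⟩ hq
    rw [hfreq] at hq
    rcases h1 _ _ _ hq with h | h | ⟨x, d, hd, h⟩
    · obtain rfl : a = b := h
      exact ⟨c, mem_feeding.mpr (Or.inl ⟨a, rfl⟩)⟩
    · obtain rfl : c = b := h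
      by_cases hx : c = a
      · subst hx
        exact ⟨c, mem_feeding.mpr (Or.inl ⟨c, rfl⟩)⟩
      · exact ⟨a, mem_feeding.mpr (Or.inr (Or.inl ⟨c, hx, rfl⟩))⟩
    · exact ⟨x, mem_feeding.mpr (Or.inr (Or.inr ⟨d, hd, h⟩))⟩
  simp only [Finset.sum_smul]
  have hrw : ∀ x, ∑ q ∈ feeding x, F q • φ (P x) =
      ∑ q, if q ∈ feeding x then F q • φ (P x) else 0 := fun x => by
    rw [Finset.sum_ite_mem, Finset.univ_inter]
  simp only [hrw]
  rw [Finset.sum_comm]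
  refine Finset.sum_congr rfl fun q _ => ?_
  split_ifs with hq
  · obtain ⟨x, hx⟩ := hex q hq
    rw [Finset.sum_eq_single x, if_pos hx, (hf x q hx).1]
    · intro y _ hy
      refine if_neg fun hy' => hy (hP ?_)
      rw [← (hf x q hx).1, ← (hf y q hy').1]
    · simp
  · exact (Finset.sum_eq_zero fun x _ => if_neg fun hx => hq (hf x q hx).2).symm

end lattice

section resonant

open scoped ComplexConjugate

lemma sum_ite_ne_and_ne {α β : Type*} [Fintype α] [Fintype β] [DecidableEq α] [DecidableEq β]
    (F : α × β → ℂ) (a : α) (b : β) :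
    (∑ p : α × β, if p.1 ≠ a ∧ p.2 ≠ b then F p else 0) =
      ∑ p, F p - ∑ c, F (a, c) - ∑ c, F (c, b) + F (a, b) := by
  have h : ∀ p : α × β, (if p.1 ≠ a ∧ p.2 ≠ b then F p else 0) =
      F p - (if p.1 = a then F p else 0) - (if p.2 = b then F p else 0) +
        (if p.1 = a then if p.2 = b then F p else 0 else 0) := fun p => by
    by_cases h1 : p.1 = a <;> by_cases h2 : p.2 = b <;> simp [h1, h2]
  simp only [h, Finset.sum_add_distrib, Finset.sum_sub_distrib]
  congr 2
  · congr 1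
    rw [Fintype.sum_prod_type, Finset.sum_comm]
    simp
  · rw [Fintype.sum_prod_type]
    simp
  · rw [Fintype.sum_prod_type, Finset.sum_comm]
    simp

/-- A unimodular sequence on the cyclic group of order five with vanishing sum and two-valued
real part of the autocorrelation. -/
lemma exists_cyclic_phases : ∃ x : Fin 5 → ℂ, (∀ i, x i * conj (x i) = 1) ∧ ∑ i, x i = 0 ∧
    ∀ k, k ≠ 0 → ∑ d, x (d + k) * conj (x d) + ∑ d, x d * conj (x (d + k)) = -(5 / 2) := by
  obtain ⟨w, hw1, hw2⟩ : ∃ w : ℂ, w * conj w = 1 ∧ w + conj w + 1 = 0 := by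
    refine ⟨⟨-(1 / 2), √3 / 2⟩, ?_, ?_⟩
    · apply Complex.ext
      · simp
        nlinarith [Real.sq_sqrt (show (0 : ℝ) ≤ 3 by norm_num)]
      · simp; ring
    · apply Complex.ext
      · simp; norm_num
      · simp
  obtain ⟨z, hz1, hz2⟩ : ∃ z : ℂ, z * conj z = 1 ∧
      (w - 1) * z + (conj w - 1) * conj z = 3 / 2 := by
    have hre : w.re = -(1 / 2) := by
      have := congrArg Complex.re hw2
      simp at this; linarith
    have him : w.im ^ 2 = 3 / 4 := by
      have := congrArg Complex.re hw1
      simp [hre] at this; nlinarith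
    obtain ⟨p, hp⟩ : ∃ p : ℝ, 4 * p ^ 2 + 3 * p - 1 / 4 = 0 :=
      ⟨(-3 + √13) / 8, by nlinarith [Real.sq_sqrt (show (0 : ℝ) ≤ 13 by norm_num)]⟩
    refine ⟨⟨p, -(1 + 2 * p) * w.im⟩, ?_, ?_⟩
    · apply Complex.ext
      · simp
        linear_combination (1 + 2 * p) ^ 2 * him + hp
      · simp; ring
    · apply Complex.ext
      · simp [hre]
        linear_combination 2 * (1 + 2 * p) * him
      · simp [hre]; ring
  have h5 : w * w = conj w := by linear_combination w * hw2 - hw1 - hw2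
  have h6 : conj w * conj w = w := by linear_combination conj w * hw2 - hw1 - hw2
  refine ⟨![1, w, conj w, z, -z], ?_, ?_, ?_⟩
  · intro i
    fin_cases i <;> simp <;> first | exact hw1 | exact hz1 | (rw [mul_comm]; exact hw1)
  · simp [Fin.sum_univ_five]; linear_combination hw2
  · generalize hv : conj w = w' at *
    have hv' : conj w' = w := by rw [← hv]; simp
    generalize hy : conj z = z' at *
    intro k hk
    fin_cases k
    · exact absurd rfl hk
    all_goals
      simp [Fin.sum_univ_five, hv, hv', hy]
      grind

/-- A matrix of phases for which the cubic interaction along the grid is a multiple of the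
identity. -/
lemma exists_grid_phases : ∃ u : GridG → ℂ, (∀ g, u g * conj (u g) = 1) ∧
    ∀ g, (∑ g' : GridG, if g'.1 ≠ g.1 ∧ g'.2 ≠ g.2 then
      u (g.1, g'.2) * conj (u g') * u (g'.1, g.2) else 0) = -(3 / 2) * u g := by
  obtain ⟨x, hx1, hx0, hx⟩ := exists_cyclic_phases
  set u : GridG → ℂ := fun g => bif g.2.2 then x (g.2.1 + g.1) else x (g.2.1 - g.1) with hu
  have hu1 : ∀ g, u g * conj (u g) = 1 := fun g => by
    simp only [hu]; cases g.2.2 <;> exact hx1 _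
  have hcol : ∀ c, ∑ a, u (a, c) = 0 := by
    rintro ⟨d, b⟩
    cases b
    · exact (Equiv.sum_comp (Equiv.subLeft d) x).trans hx0
    · exact (Equiv.sum_comp (Equiv.addLeft d) x).trans hx0
  have hgram : ∀ a a', ∑ c, u (a, c) * conj (u (a', c)) =
      25 / 2 * (if a' = a then 1 else 0) - 5 / 2 := by
    intro a a'
    split_ifs with h
    · subst h
      simp only [hu1]
      simp
      norm_num
    · have e1 : ∑ d, x (d + a) * conj (x (d + a')) = ∑ d, x (d + (a - a')) * conj (x d) := by
        rw [← Equiv.sum_comp (Equiv.addRight a') fun d => x (d + (a - a')) * conj (x d)]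
        refine Finset.sum_congr rfl fun d _ => ?_
        simp only [Equiv.coe_addRight]
        congr 2
        abel
      have e2 : ∑ d, x (d - a) * conj (x (d - a')) = ∑ d, x d * conj (x (d + (a - a'))) := by
        rw [← Equiv.sum_comp (Equiv.addRight a)]
        refine Finset.sum_congr rfl fun d _ => ?_
        simp only [Equiv.coe_addRight, add_sub_cancel_right, add_sub_assoc]
      have := hx (a - a') (sub_ne_zero.mpr (Ne.symm h))
      rw [Fintype.sum_prod_type]
      simp only [Fintype.sum_bool, hu, cond_true, cond_false, Finset.sum_add_distrib, e1, e2, this]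
      norm_num
  refine ⟨u, hu1, fun g => ?_⟩
  obtain ⟨a, c⟩ := g
  rw [sum_ite_ne_and_ne (fun g' : GridG => u (a, g'.2) * conj (u g') * u (g'.1, c))]
  have h1 : ∑ p : GridG, u (a, p.2) * conj (u p) * u (p.1, c) = 25 / 2 * u (a, c) := by
    rw [Fintype.sum_prod_type]
    simp only [← Finset.sum_mul, hgram, sub_mul, Finset.sum_sub_distrib, ← Finset.mul_sum, hcol]
    simp [mul_assoc, ← Finset.mul_sum]
  have h2 : ∑ c', u (a, c') * conj (u (a, c')) * u (a, c) = 10 * u (a, c) := by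
    simp only [hu1]; simp
  have h3 : ∑ a', u (a, c) * conj (u (a', c)) * u (a', c) = 5 * u (a, c) := by
    have : ∀ a', u (a, c) * conj (u (a', c)) * u (a', c) = u (a, c) := fun a' => by
      linear_combination u (a, c) * hu1 (a', c)
    simp only [this]; simp
  have h4 := hu1 (a, c)
  simp only [h1, h2, h3]
  linear_combination u (a, c) * h4

variable {m : ℕ}

lemma sum_ite_eq_or_succ {j : ℕ} (hj : j ≤ m) {G H : ℕ → ℂ} (hG : G m = 0) (hH : H 0 = 0) :
    (∑ k : Fin m, if j = (k : ℕ) ∨ j = (k : ℕ) + 1 then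
      (if j = (k : ℕ) then G j else H j) else 0) = G j + H j := by
  have h : ∀ k : ℕ, (if j = k ∨ j = k + 1 then (if j = k then G j else H j) else 0) =
      (if j = k then G j else 0) + (if j = k + 1 then H j else 0) := fun k => by
    by_cases h1 : j = k
    · subst h1; simp
    · simp [h1]
  rw [Fin.sum_univ_eq_sum_range fun k =>
    if j = k ∨ j = k + 1 then (if j = k then G j else H j) else 0]
  simp only [h, Finset.sum_add_distrib]
  congr 1
  · rw [Finset.sum_ite_eq]
    split_ifs with h
    · rfl
    · rw [Finset.mem_range] at h
      rw [show j = m by omega, hG]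
  · cases j with
    | zero => simp [hH]
    | succ j =>
      simp only [add_left_inj]
      rw [Finset.sum_ite_eq, if_pos (Finset.mem_range.mpr (by omega))]

open Classical in
/-- The resonant nonlinearity on states which are uniform within each generation. -/
lemma sum_feeding_cube {u : GridG → ℂ} (hu : ∀ g, u g * conj (u g) = 1)
    (hu' : ∀ g, (∑ g' : GridG, if g'.1 ≠ g.1 ∧ g'.2 ≠ g.2 then
      u (g.1, g'.2) * conj (u g') * u (g'.1, g.2) else 0) = -(3 / 2) * u g)
    {r E : ℂ} (hr : r * conj r = 1) (hr' : r ^ 2 = Complex.I) (hE : E * conj E = 1)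
    {A Y : ℕ → ℝ} (hA : ∀ k ≤ m, A k ^ 2 = Y (k + 1)) (hY0 : Y 0 = 0) (hYm : Y (m + 2) = 0)
    {v : Idx m → ℂ} (hv : ∀ x, v x = A x.1 * r ^ (x.1 : ℕ) * u x.2.2.1 * E) (x : Idx m) :
    ∑ q ∈ feeding x, cube v q = (2 * (∑ y, v y * conj (v y)) +
      2 * Complex.I * ((Y (x.1 + 2) : ℂ) - Y x.1)) * v x := by
  have hrk : ∀ k : ℕ, r ^ k * conj (r ^ k) = 1 := fun k => by
    rw [map_pow, ← mul_pow, hr, one_pow]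
  have hself : v x * conj (v x) = A x.1 ^ 2 := by
    rw [hv]
    simp only [map_mul, Complex.conj_ofReal]
    linear_combination (A x.1 ^ 2 : ℂ) * (hrk x.1 * (u x.2.2.1 * conj (u x.2.2.1) * (E * conj E)) +
      hu x.2.2.1 * (E * conj E) + hE)
  have hG : (∑ g : GridG, if RectValid x (.inl g) then
      cube v (rectTriple x (.inl g, true)) + cube v (rectTriple x (.inl g, false)) else 0) =
      -3 * A x.1 ^ 2 * v x := by
    have : ∀ g : GridG, (if RectValid x (.inl g) then
        cube v (rectTriple x (.inl g, true)) + cube v (rectTriple x (.inl g, false)) else 0) =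
        2 * (A x.1 ^ 3 * r ^ (x.1 : ℕ) * E) * (if g.1 ≠ x.2.2.1.1 ∧ g.2 ≠ x.2.2.1.2 then
      u (x.2.2.1.1, g.2) * conj (u g) * u (g.1, x.2.2.1.2) else 0) := fun g => by
      rw [mul_ite, mul_zero]
      refine if_congr Iff.rfl ?_ rfl
      simp only [cube, rectTriple, rectAdj, rectOpp, Bool.not_true, Bool.not_false, hv, map_mul,
        Complex.conj_ofReal]
      linear_combination (2 * A x.1 ^ 3 * r ^ (x.1 : ℕ) * E * (u (x.2.2.1.1, g.2) * conj (u g) *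
        u (g.1, x.2.2.1.2))) * (hrk x.1 * (E * conj E) + hE)
    simp only [this, ← Finset.mul_sum]
    rw [hu', hv]
    ring
  have hH : (∑ g : GridH, if RectValid x (.inr (.inl g)) then
      cube v (rectTriple x (.inr (.inl g), true)) + cube v (rectTriple x (.inr (.inl g), false))
      else 0) = 4 * A x.1 ^ 2 * v x := by
    have : ∀ g : GridH, (if RectValid x (.inr (.inl g)) then
        cube v (rectTriple x (.inr (.inl g), true)) + cube v (rectTriple x (.inr (.inl g), false))
        else 0) = if g.1 ≠ x.2.2.2.1 ∧ g.2 ≠ x.2.2.2.2 then 2 * A x.1 ^ 2 * v x else 0 :=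
      fun g => by
      refine if_congr Iff.rfl ?_ rfl
      have hv' : ∀ h : GridH, v (x.1, x.2.1, x.2.2.1, h) = v x := fun h => by rw [hv, hv]
      simp only [cube, rectTriple, rectAdj, rectOpp, Bool.not_true, Bool.not_false, hv']
      linear_combination 2 * v x * hself
    simp only [this]
    rw [sum_ite_ne_and_ne fun _ => 2 * (A x.1 : ℂ) ^ 2 * v x]
    simp
    ring
  have hT : (∑ k : Fin m, if RectValid x (.inr (.inr k)) then
      cube v (rectTriple x (.inr (.inr k), true)) + cube v (rectTriple x (.inr (.inr k), false))
      else 0) = 2 * Complex.I * ((Y (x.1 + 2) : ℂ) - Y x.1) * v x := by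
    have hj : (x.1 : ℕ) ≤ m := Nat.lt_succ_iff.mp x.1.2
    have := sum_ite_eq_or_succ hj (G := fun k => 2 * Complex.I * Y (k + 2) * v x)
      (H := fun k => -(2 * Complex.I * Y k * v x)) (by simp [hYm]) (by simp [hY0])
    refine (Finset.sum_congr rfl fun k _ => ?_).trans (this.trans (by ring))
    refine if_ctx_congr Iff.rfl (fun hk => ?_) fun _ => rfl
    have hflip : ∀ (j : Fin (m + 1)) z, v (j, z, x.2.2) = A j * r ^ (j : ℕ) * u x.2.2.1 * E :=
      fun j z => hv _
    simp only [cube, rectTriple, rectAdj, rectOpp, Bool.not_true, Bool.not_false, hflip]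
    have hrI : conj r = -Complex.I * r := by
      have : conj r ^ 2 = -Complex.I := by rw [← map_pow, hr', Complex.conj_I]
      linear_combination -conj r * hr + r * this
    have h2 := hu x.2.2.1
    unfold otherGen
    simp only [map_mul, Complex.conj_ofReal]
    generalize u x.2.2.1 = U at *
    split_ifs with h
    · have hA' : (A (x.1 + 1) : ℂ) ^ 2 = Y (x.1 + 2) := by
        rw [← Complex.ofReal_pow, hA _ (by omega)]
      rw [Fin.val_succ, ← h]
      have h1 := hrk x.1
      rw [pow_succ]
      generalize r ^ (x.1 : ℕ) = R at *
      linear_combination 2 * A x.1 * U * R * E * (A (x.1 + 1) ^ 2 * r ^ 2 *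
        (h1 * (U * conj U * (E * conj E)) + h2 * (E * conj E) + hE) +
        A (x.1 + 1) ^ 2 * hr' + Complex.I * hA')
    · have h' : (x.1 : ℕ) = k + 1 := hk.resolve_left h
      have hA' : (A k : ℂ) ^ 2 = Y x.1 := by
        rw [← Complex.ofReal_pow, hA _ (by omega), h']
      rw [Fin.val_castSucc, h']
      rw [h'] at hA'
      have h1 := hrk k
      rw [pow_succ, map_mul]
      generalize r ^ (k : ℕ) = R at *
      linear_combination 2 * A (k + 1) * U * R * E * (A k ^ 2 * conj r *
        (h1 * (U * conj U * (E * conj E)) + h2 * (E * conj E) + hE) +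
        A k ^ 2 * hrI - Complex.I * r * hA')
  rw [sum_feeding, Fintype.sum_sum_type, Fintype.sum_sum_type, hG, hH, hT]
  have h1 : ∑ y, cube v (y, y, x) = (∑ y, v y * conj (v y)) * v x := by
    rw [Finset.sum_mul]; rfl
  have h2 : ∑ y, cube v (x, y, y) = (∑ y, v y * conj (v y)) * v x := by
    rw [Finset.sum_mul]
    exact Finset.sum_congr rfl fun y _ => by simp only [cube]; ring
  have h3 : cube v (x, x, x) = A x.1 ^ 2 * v x := by
    rw [← hself]; rfl
  rw [h1, h2, h3]
  ring

lemma exists_unimodular_sq_eq_I : ∃ r : ℂ, r * conj r = 1 ∧ r ^ 2 = Complex.I := by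
  have h := Real.sq_sqrt (show (0 : ℝ) ≤ 2 by norm_num)
  refine ⟨⟨√2 / 2, √2 / 2⟩, Complex.ext ?_ ?_, Complex.ext ?_ ?_⟩
  · simp; nlinarith
  · simp
  · simp [pow_two]
  · simp [pow_two]; nlinarith

lemma IsVolterraFlow.continuous {N : ℕ} {X : ℕ → ℝ → ℝ} (h : IsVolterraFlow N X) (k : ℕ) :
    Continuous (X k) := by
  cases k with
  | zero => exact continuous_const.congr fun t => (h.zero_left t).symm
  | succ k => exact continuous_iff_continuousAt.mpr fun t => (h.hasDerivAt k t).continuousAt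

/-- A sum over the modes of a function of the generation. -/
lemma sum_idx {R : Type*} [CommRing R] (f : ℕ → R) :
    ∑ x : Idx m, f x.1 = 300 * 2 ^ m * ∑ k ∈ Finset.range (m + 1), f k := by
  rw [Fintype.sum_prod_type, ← Fin.sum_univ_eq_sum_range, Finset.mul_sum]
  refine Finset.sum_congr rfl fun j _ => ?_
  simp only [Finset.sum_const, Finset.card_univ, Fintype.card_prod, Fintype.card_pi,
    Fintype.card_bool, Finset.prod_const, Fintype.card_fin, nsmul_eq_mul]
  push_cast
  ring

/-- The resonant system contains the Volterra lattice. -/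
theorem exists_resonant_flow {P : Idx m → Z2} (hP : Function.Injective P)
    (h1 : ∀ a b c, resonance (P a, P b, P c) = 0 → a = b ∨ c = b ∨
        ∃ (x : Idx m) (d : RectLabel m × Bool), RectValid x d.1 ∧ rectTriple x d = (a, b, c))
    (h2 : ∀ (x : Idx m) (d : RectLabel m × Bool), RectValid x d.1 → P (rectAdj x d.1 d.2) -
          P (rectOpp x d.1) + P (rectAdj x d.1 (!d.2)) = P x ∧
        resonance (P (rectAdj x d.1 d.2), P (rectOpp x d.1), P (rectAdj x d.1 (!d.2))) = 0)
    {X : ℕ → ℝ → ℝ} (hX : IsVolterraFlow (m + 1) X) (l : ℝ) :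
    ∃ β β' : Idx m → ℝ → ℂ, (∀ x t, HasDerivAt (β x) (β' x t) t) ∧ (∀ x, Continuous (β' x)) ∧
      (∀ t, ∀ φ : Z2 → Ell1, ∑ x, β' x t • φ (P x) = ∑ q : Idx m × Idx m × Idx m,
        if resonance (freq P 1 q) = 0 then
          (Complex.I * cube (fun x => β x t) q) • φ (triOut (freq P 1 q)) else 0) ∧
      ∀ x t, ‖β x t‖ ^ 2 = l ^ 2 * X (x.1 + 1) (l ^ 2 * t) := by
  obtain ⟨u, hu, hu'⟩ := exists_grid_phases
  obtain ⟨r, hr, hr'⟩ := exists_unimodular_sq_eq_I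
  set μ : ℝ := 300 * 2 ^ m * (l ^ 2 * ∑ k ∈ Finset.range (m + 1), X (k + 1) 0) with hμ
  set A : ℕ → ℝ → ℝ := fun k t => l * √(X (k + 1) (l ^ 2 * t)) with hA
  set Y : ℕ → ℝ → ℝ := fun k t => l ^ 2 * X k (l ^ 2 * t) with hY
  set E : ℝ → ℂ := fun t => Complex.exp (((2 * μ * t : ℝ) : ℂ) * Complex.I) with hE
  have hEn : ∀ t, ‖E t‖ = 1 := fun t => Complex.norm_exp_ofReal_mul_I _
  have hEE : ∀ t, E t * conj (E t) = 1 := fun t => by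
    rw [Complex.mul_conj', hEn]; norm_num
  have hAY : ∀ t, ∀ k ≤ m, A k t ^ 2 = Y (k + 1) t := fun t k hk => by
    simp only [hA, hY]
    rw [mul_pow, Real.sq_sqrt (hX.pos _ _ (by omega) (by omega)).le]
  have hEd : ∀ t, HasDerivAt E (2 * μ * Complex.I * E t) t := fun t => by
    have : HasDerivAt (fun t : ℝ => ((2 * μ * t : ℝ) : ℂ) * Complex.I)
        (((2 * μ : ℝ) : ℂ) * Complex.I) t := by
      have := (((hasDerivAt_id t).const_mul (2 * μ)).ofReal_comp).mul_const Complex.I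
      exact this.congr_deriv (by simp)
    refine this.cexp.congr_deriv ?_
    rw [mul_comm, Complex.ofReal_mul, Complex.ofReal_ofNat]
  have hAd : ∀ t, ∀ k ≤ m, HasDerivAt (A k) (2 * (Y k t - Y (k + 2) t) * A k t) t := by
    intro t k hk
    have hp := hX.pos (k + 1) (l ^ 2 * t) (by omega) (by omega)
    have hi : HasDerivAt (fun t => l ^ 2 * t) (l ^ 2) t := by
      simpa using (hasDerivAt_id t).const_mul (l ^ 2)
    have hc := (hX.hasDerivAt k (l ^ 2 * t)).comp t hi
    refine ((hc.sqrt hp.ne').const_mul l).congr_deriv ?_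
    simp only [hA, hY, Function.comp]
    have hs := Real.sq_sqrt hp.le
    have hs0 := Real.sqrt_pos.mpr hp
    set w := √(X (k + 1) (l ^ 2 * t))
    rw [← hs]
    field_simp
    ring
  set β : Idx m → ℝ → ℂ := fun x t => A x.1 t * r ^ (x.1 : ℕ) * u x.2.2.1 * E t with hβ
  have hr1 : ‖r‖ = 1 := by
    have : ‖r‖ ^ 2 = 1 := by
      have := hr; rw [Complex.mul_conj'] at this; exact_mod_cast this
    nlinarith [norm_nonneg r]
  have hu1 : ∀ g, ‖u g‖ ^ 2 = 1 := fun g => by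
    have := hu g; rw [Complex.mul_conj'] at this; exact_mod_cast this
  have hnorm : ∀ x t, ‖β x t‖ ^ 2 = Y (x.1 + 1) t := fun x t => by
    simp only [hβ, norm_mul, norm_pow, hr1, hEn, one_pow, mul_one, mul_pow, hu1, Complex.norm_real,
      Real.norm_eq_abs, sq_abs]
    exact hAY t _ (Nat.lt_succ_iff.mp x.1.2)
  have hmass : ∀ t, ∑ y, β y t * conj (β y t) = μ := fun t => by
    have : ∀ y, β y t * conj (β y t) = ((Y (y.1 + 1) t : ℝ) : ℂ) := fun y => by
      rw [Complex.mul_conj', ← Complex.ofReal_pow, hnorm]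
    simp only [this]
    rw [← Complex.ofReal_sum, sum_idx fun k => Y (k + 1) t]
    simp only [hY, ← Finset.mul_sum, hμ]
    rw [hX.sum_eq]
  refine ⟨β, fun x t => (2 * ((Y x.1 t : ℂ) - Y (x.1 + 2) t) + 2 * μ * Complex.I) * β x t,
    fun x t => ?_, fun x => ?_, fun t φ => ?_, hnorm⟩
  · have := ((((hAd t x.1 (Nat.lt_succ_iff.mp x.1.2)).ofReal_comp).mul_const
      (r ^ (x.1 : ℕ))).mul_const (u x.2.2.1)).fun_mul (hEd t)
    refine this.congr_deriv ?_
    simp only [hβ]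
    push_cast
    ring
  · have hc : ∀ k, Continuous (X k) := hX.continuous
    simp only [hβ, hY, hA, hE]
    fun_prop
  · rw [sum_resonant hP h1 h2]
    refine Finset.sum_congr rfl fun x _ => ?_
    congr 1
    rw [← Finset.mul_sum, sum_feeding_cube hu hu' hr hr' (hEE t) (A := fun k => A k t)
      (Y := fun k => Y k t) (hAY t) (by simp [hY, hX.zero_left])
      (by simp [hY, hX.zero_right _ _ (Nat.lt_succ_self (m + 1))]) (fun x => rfl), hmass]
    linear_combination (2 * ((Y x.1 t : ℂ) - Y (x.1 + 2) t)) * β x t * Complex.I_sq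

end resonant

lemma tsum_modes {ι : Type*} [Fintype ι] {P : ι → Z2} (hP : Function.Injective P) {M : ℕ}
    (hM : 1 ≤ M) (v : ι → ℂ) (w : Z2 → ℝ) :
    ∑' n, w n * ‖modes P M v n‖ ^ 2 = ∑ x, w (M • P x) * ‖v x‖ ^ 2 := by
  classical
  rw [tsum_eq_sum (s := Finset.univ.image fun x => M • P x),
    Finset.sum_image (smul_injective hM hP).injOn]
  · simp only [modes_apply hM hP]
  · intro n hn
    rw [modes_apply_of_notMem]
    · simp
    · simpa using hn

lemma HsFinite.le_HsNormSq {s : ℝ} {a : Z2 → ℂ} (h : HsFinite s a) (n : Z2) :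
    (1 + nsq n) ^ s * ‖a n‖ ^ 2 ≤ HsNormSq s a :=
  h.le_tsum n fun j _ => by
    have : 0 ≤ nsq j := by unfold nsq; positivity
    positivity

/-- Transfer of energy along the generations, with explicit constants. -/
theorem exists_energy_transfer {s : ℝ} (hs : 0 ≤ s) {m n : ℕ} (hn : 1 ≤ n) (hm : m + 1 = 2 * n)
    {δ : ℝ} (hδ : 0 < δ) (hδn : 2 * n * δ ≤ 1 / (48 * n)) {l : ℝ} (hl : 0 < l) :
    ∃ (a : ℝ → Z2 → ℂ) (T D : ℝ), IsSolutionV (fun _ => 0) a ∧ (∀ t, HsFinite s (a t)) ∧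
      0 < T ∧ l ^ 2 * T ≤ 35 * n ^ 3 * (1 + Real.log δ⁻¹) ∧ 0 < D ∧ 0 < HsNormSq s (a 0) ∧
      HsNormSq s (a 0) ≤ l ^ 2 * (300 * 2 ^ m) * D ^ s * (4 ^ s + 2 * n * δ * (4 * 2 ^ m) ^ s) ∧
      l ^ 2 / 4 * ((2 ^ m / 4) ^ s * D ^ s) ≤ HsNormSq s (a T) ∧
      ∑' k, ‖a 0 k‖ ^ 2 ≤ l ^ 2 * (300 * 2 ^ m) * (1 + 2 * n * δ) := by
  obtain ⟨P, S, hS, hP, hres, hrect, hsize⟩ := exists_placement m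
  have hn' : (1 : ℝ) ≤ n := by exact_mod_cast hn
  obtain ⟨X, hX, hX0⟩ := exists_isVolterraFlow (2 * n) (fun k => if k = 1 then 1 else δ)
    (fun k => by split_ifs <;> positivity)
  have hX1 : X 1 0 = 1 := by rw [hX0 1 le_rfl (by omega), if_pos rfl]
  have hX2 : ∀ k, 2 ≤ k → k ≤ 2 * n → X k 0 = δ := fun k hk hk' => by
    rw [hX0 k (by omega) hk', if_neg (by omega)]
  obtain ⟨τ, hτ, hτX⟩ := hX.exists_half_le hn hδ hδn hX1 hX2
  have hδ1 : δ < 1 / 2 := by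
    have : 1 / (48 * (n : ℝ)) ≤ 1 / 48 := by
      apply one_div_le_one_div_of_le <;> linarith
    nlinarith
  have hτ0 : 0 < τ := by
    refine lt_of_le_of_ne hτ.1 fun h => ?_
    rw [← h, hX2 _ (by omega) le_rfl] at hτX
    linarith
  rw [← hm] at hX
  obtain ⟨β, β', hβ, hβ', hβres, hβn⟩ := exists_resonant_flow hP hres hrect hX l
  set T := τ / l ^ 2 with hT
  have hl2 : 0 < l ^ 2 := by positivity
  have hlT : l ^ 2 * T = τ := by rw [hT]; field_simp
  have hT0 : 0 < T := by positivity
  obtain ⟨M, hM, hMb⟩ := exists_dilation_forall_norm_sub_le hP hβ hβ' hβres hT0.le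
    (show 0 < l / 10 by positivity)
  obtain ⟨b, hb0, hb, hsol, hfin⟩ := exists_global_interaction s
    (f := modes P M fun x => β x 0) ((Set.finite_range fun x => M • P x).subset fun k hk => by
      by_contra hk'
      exact hk (modes_apply_of_notMem _ hk'))
  have hb0' : b 0 = modes P M fun x => β x 0 := lp.ext (funext hb0)
  set a : ℝ → Z2 → ℂ := fun t k => Complex.exp ((nsq k * t : ℝ) * Complex.I) * b t k with ha
  have han : ∀ t k, ‖a t k‖ = ‖b t k‖ := fun t k => by
    simp only [ha, norm_mul, Complex.norm_exp_ofReal_mul_I, one_mul]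
  set D : ℝ := ((M : ℝ) * S) ^ 2 with hD
  have hM' : (1 : ℝ) ≤ M := by exact_mod_cast hM
  have hS' : (1 : ℝ) ≤ S := by exact_mod_cast hS
  have hD1 : 1 ≤ D := one_le_pow₀ (by nlinarith)
  have hQ : (1 : ℝ) ≤ 2 ^ m := one_le_pow₀ (by norm_num)
  have hsz : ∀ x, 0 ≤ nsq (M • P x) ∧ nsq (M • P x) ≤ (2 * treeSize x + 1) * D ∧
      (treeSize x - 1) * D ≤ 2 * nsq (M • P x) := fun x => by
    obtain ⟨h1, h2⟩ := hsize x
    refine ⟨by unfold nsq; positivity, ?_, ?_⟩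
    · rw [nsq_smul, hD]
      have := mul_le_mul_of_nonneg_left h1 (sq_nonneg (M : ℝ))
      linarith
    · rw [nsq_smul, hD]
      have := mul_le_mul_of_nonneg_left h2 (sq_nonneg (M : ℝ))
      linarith
  have hw0 : ∀ x : Idx m, (x.1 : ℕ) = 0 → (1 + nsq (M • P x)) ^ s ≤ 4 ^ s * D ^ s := by
    intro x hx
    rw [← Real.mul_rpow (by norm_num) (by positivity)]
    obtain ⟨h1, h2, -⟩ := hsz x
    have hx' : treeSize x = 1 := by
      have := treeSize_zero x.2
      rwa [show ((0 : Fin (m + 1)), x.2) = x from Prod.ext (Fin.ext hx.symm) rfl] at this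
    rw [hx'] at h2
    push_cast at h2
    exact Real.rpow_le_rpow (by linarith) (by linarith) hs
  have hw1 : ∀ x : Idx m, (1 + nsq (M • P x)) ^ s ≤ (4 * 2 ^ m) ^ s * D ^ s := by
    intro x
    rw [← Real.mul_rpow (by positivity) (by positivity)]
    obtain ⟨h1, h2, -⟩ := hsz x
    have hx' : (treeSize x : ℝ) ≤ 2 ^ m := by exact_mod_cast treeSize_le x
    refine Real.rpow_le_rpow (by linarith) ?_ hs
    nlinarith
  have hXδ : ∀ k ∈ Finset.range m, X (k + 1 + 1) 0 = δ := fun k hk => by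
    have := Finset.mem_range.mp hk
    exact hX2 _ (by omega) (by omega)
  have hmn : (m : ℝ) ≤ 2 * n := by
    have : m ≤ 2 * n := by omega
    exact_mod_cast this
  have hsum : ∀ p q : ℝ, 0 ≤ q → ∑ x : Idx m, (if (x.1 : ℕ) = 0 then p else q) *
      (l ^ 2 * X (x.1 + 1) 0) ≤ l ^ 2 * (300 * 2 ^ m) * (p + 2 * n * δ * q) := by
    intro p q hq
    rw [sum_idx fun k => (if k = 0 then p else q) * (l ^ 2 * X (k + 1) 0), Finset.sum_range_succ']
    rw [Finset.sum_congr rfl (g := fun _ => q * (l ^ 2 * δ)) fun k hk => by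
      rw [hXδ k hk, if_neg (Nat.succ_ne_zero k)]]
    rw [if_pos rfl, zero_add, hX1, Finset.sum_const, Finset.card_range, nsmul_eq_mul]
    have : (m : ℝ) * (q * (l ^ 2 * δ)) ≤ 2 * n * (q * (l ^ 2 * δ)) := by gcongr
    calc 300 * 2 ^ m * ((m : ℝ) * (q * (l ^ 2 * δ)) + p * (l ^ 2 * 1))
        ≤ 300 * 2 ^ m * (2 * n * (q * (l ^ 2 * δ)) + p * (l ^ 2 * 1)) := by gcongr
      _ = _ := by ring
  have hβ0 : ∀ x, ‖β x 0‖ ^ 2 = l ^ 2 * X (x.1 + 1) 0 := fun x => by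
    rw [hβn, mul_zero]
  have hN0 : HsNormSq s (a 0) = ∑ x, (1 + nsq (M • P x)) ^ s * (l ^ 2 * X (x.1 + 1) 0) := by
    simp only [HsNormSq, han, hb0']
    rw [tsum_modes hP hM _ fun k => (1 + nsq k) ^ s]
    simp only [hβ0]
  have hXpos : ∀ x : Idx m, 0 < l ^ 2 * X (x.1 + 1) 0 := fun x =>
    mul_pos hl2 (hX.pos _ _ (by omega) (by omega))
  refine ⟨a, T, D, hsol, hfin, hT0, hlT.trans_le hτ.2, by positivity, ?_, ?_, ?_, ?_⟩
  · rw [hN0]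
    refine Finset.sum_pos (fun x _ => mul_pos (Real.rpow_pos_of_pos ?_ _) (hXpos x))
      ⟨(0, fun _ => false, (0, 0, false), 0, 0), Finset.mem_univ _⟩
    linarith [(hsz x).1]
  · rw [hN0]
    calc _ ≤ ∑ x : Idx m, (if (x.1 : ℕ) = 0 then 4 ^ s * D ^ s else (4 * 2 ^ m) ^ s * D ^ s) *
          (l ^ 2 * X (x.1 + 1) 0) := by
          refine Finset.sum_le_sum fun x _ => mul_le_mul_of_nonneg_right ?_ (hXpos x).le
          split_ifs with h
          · exact hw0 x h
          · exact hw1 x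
      _ ≤ _ := hsum _ _ (by positivity)
      _ = _ := by ring
  · set x : Idx m := (Fin.last m, fun _ => false, (0, 0, false), 0, 0) with hx
    refine le_trans ?_ ((hfin T).le_HsNormSq (M • P x))
    have h1 : l ^ 2 / 2 ≤ ‖β x T‖ ^ 2 := by
      rw [hβn, hlT, hx, Fin.val_last, hm]
      nlinarith
    have h2 : l / 2 ≤ ‖b T (M • P x)‖ := by
      have h3 := hMb b hb hb0' x
      have h4 := norm_sub_norm_le (β x T) (b T (M • P x))
      rw [norm_sub_rev] at h4
      have h5 : 7 / 10 * l ≤ ‖β x T‖ := by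
        by_contra hc
        push Not at hc
        nlinarith [norm_nonneg (β x T)]
      linarith
    change _ ≤ (1 + nsq (M • P x)) ^ s * ‖a T (M • P x)‖ ^ 2
    rw [han, ← Real.mul_rpow (by positivity) (by positivity), mul_comm]
    have hQ2 : (2 : ℝ) ≤ 2 ^ m := by
      calc (2 : ℝ) = 2 ^ 1 := by norm_num
        _ ≤ 2 ^ m := pow_le_pow_right₀ (by norm_num) (by omega)
    have h6 : (2 : ℝ) ^ m / 4 * D ≤ 1 + nsq (M • P x) := by
      obtain ⟨-, -, h⟩ := hsz x
      have : (treeSize x : ℝ) = 2 ^ m := by rw [hx, treeSize_last]; norm_num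
      rw [this] at h
      nlinarith
    have h7 : l ^ 2 / 4 ≤ ‖b T (M • P x)‖ ^ 2 := by
      calc l ^ 2 / 4 = (l / 2) ^ 2 := by ring
        _ ≤ _ := by gcongr
    have h8 : 0 ≤ (1 + nsq (M • P x)) ^ s := Real.rpow_nonneg (by linarith [(hsz x).1]) s
    gcongr
  · have h := tsum_modes hP hM (fun x => β x 0) fun _ => 1
    simp only [one_mul] at h
    simp only [han, hb0', h, hβ0]
    refine le_trans (le_of_eq ?_) ((hsum 1 1 zero_le_one).trans_eq (by ring))
    simp

/-- A number of generations adapted to the growth factor. -/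
lemma exists_generations {p K : ℝ} (hp : 0 < p) (hK : 4 ≤ K) :
    ∃ m n : ℕ, 1 ≤ n ∧ m + 1 = 2 * n ∧ K ^ p ≤ 2 ^ m ∧ (2 : ℝ) ^ m ≤ K ^ (p + 1) := by
  have hK0 : 0 < K := by linarith
  set y := p * Real.logb 2 K with hy
  have hlog : 0 < Real.logb 2 K := Real.logb_pos (by norm_num) (by linarith)
  have hy0 : 0 < y := mul_pos hp hlog
  have h2y : (2 : ℝ) ^ y = K ^ p := by
    rw [hy, mul_comm, Real.rpow_mul (by norm_num), Real.rpow_logb (by norm_num) (by norm_num) hK0]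
  have hn0 : 0 < (y + 1) / 2 := by linarith
  have h1 := Nat.le_ceil ((y + 1) / 2)
  have h2 := Nat.ceil_lt_add_one hn0.le
  have h3 : 1 ≤ ⌈(y + 1) / 2⌉₊ := Nat.one_le_iff_ne_zero.mpr (Nat.ceil_pos.mpr hn0).ne'
  set n := ⌈(y + 1) / 2⌉₊ with hn
  have hm : ((2 * n - 1 : ℕ) : ℝ) = 2 * n - 1 := by
    rw [Nat.cast_sub (by omega)]; push_cast; ring
  refine ⟨2 * n - 1, n, h3, by omega, ?_, ?_⟩
  · rw [← h2y, ← Real.rpow_natCast, hm]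
    exact Real.rpow_le_rpow_of_exponent_le (by norm_num) (by linarith)
  · rw [Real.rpow_add_one hK0.ne', ← h2y, ← Real.rpow_natCast, hm]
    calc (2 : ℝ) ^ (2 * (n : ℝ) - 1) ≤ 2 ^ (y + 2) :=
          Real.rpow_le_rpow_of_exponent_le (by norm_num) (by linarith)
      _ = 2 ^ y * 4 := by rw [Real.rpow_add (by norm_num)]; norm_num
      _ ≤ 2 ^ y * K := by gcongr

/-- **Theorem 1.2 (Guardia–Kaloshin).** Fix `s > 1`. There are `c, σ > 0` such that for every
sufficiently large `K > 1` there exist a global Fourier-side solution of the cubic defocusing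
NLS (the case `v ≡ 0`), with finite `H^s` norms, and a time `0 < T ≤ K^c` with
`‖a(T)‖_{H^s} ≥ K ‖a(0)‖_{H^s}` and `‖a(0)‖_{L²} ≤ K^{-σ}`. -/
theorem growth_of_sobolev_norms_NLS_GK_fast
    (s : ℝ) (hs : 1 < s) :
    ∃ c > (0 : ℝ), ∃ σ > (0 : ℝ), ∃ K₀ > (1 : ℝ), ∀ K : ℝ, K₀ ≤ K →
      ∃ (a : ℝ → Z2 → ℂ) (T : ℝ),
        IsSolutionV (fun _ => 0) a ∧
        (∀ t : ℝ, HsFinite s (a t)) ∧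
        0 < HsNorm s (a 0) ∧
        0 < T ∧ T ≤ K ^ c ∧
        K * HsNorm s (a 0) ≤ HsNorm s (a T) ∧
        L2Norm (a 0) ≤ K ^ (-σ) := by
  have hs1 : 0 < s - 1 := by linarith
  set p := 3 / (s - 1) with hp
  have hp0 : 0 < p := by positivity
  set C : ℝ := 1200 * 4 ^ s * (4 ^ s + 1) with hC
  have hC0 : 0 < C := by positivity
  refine ⟨4 + 7 * (p + 1) + s * (p + 2), by positivity, 1, one_pos, C + 100000, by linarith,
    fun K hK => ?_⟩
  have hK5 : 100000 ≤ K := by linarith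
  have hK0 : 0 < K := by linarith
  obtain ⟨m, n, hn, hm, hQ1, hQ2⟩ := exists_generations hp0 (show 4 ≤ K by linarith)
  have hnR : (1 : ℝ) ≤ n := by exact_mod_cast hn
  have hnm : (n : ℝ) ≤ 2 ^ m := by
    have : n ≤ 2 ^ m := (show n ≤ m by omega).trans Nat.lt_two_pow_self.le
    exact_mod_cast this
  set Q : ℝ := 2 ^ m with hQ
  have hQ0 : 1 ≤ Q := hnR.trans hnm
  have hW : 1 ≤ (4 * Q) ^ s := Real.one_le_rpow (by linarith) (by linarith)
  set W := (4 * Q) ^ s with hWdef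
  set δ : ℝ := 1 / (96 * n ^ 2 * W) with hδ
  have hδ0 : 0 < δ := by positivity
  have hδW : 2 * n * δ * W = 1 / (48 * n) := by rw [hδ]; field_simp; norm_num
  have hδn : 2 * n * δ ≤ 1 / (48 * n) := by
    rw [← hδW]; exact le_mul_of_one_le_right (by positivity) hW
  have hn48 : 1 / (48 * (n : ℝ)) ≤ 1 := by
    rw [div_le_one (by positivity)]; linarith
  set l : ℝ := 1 / (600 * Q * K) with hl
  have hl0 : 0 < l := by positivity
  obtain ⟨a, T, D, hsol, hfin, hT, hTl, hD, hpos, hinit, hfinal, hmass⟩ :=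
    exists_energy_transfer (show 0 ≤ s by linarith) hn hm hδ0 hδn hl0
  rw [← hQ] at hinit hfinal hmass
  refine ⟨a, T, hsol, hfin, Real.rpow_pos_of_pos hpos _, hT, ?_, ?_, ?_⟩
  · have hlog : Real.log δ⁻¹ ≤ 96 * n ^ 2 * W := by
      refine (Real.log_le_sub_one_of_pos (inv_pos.mpr hδ0)).trans ?_
      rw [hδ, one_div, inv_inv]; linarith
    have hτ : l ^ 2 * T ≤ 3400 * Q ^ 5 * W := by
      calc l ^ 2 * T ≤ 35 * n ^ 3 * (1 + 96 * n ^ 2 * W) := hTl.trans (by gcongr)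
        _ ≤ 35 * Q ^ 3 * (1 + 96 * Q ^ 2 * W) := by gcongr
        _ ≤ 35 * Q ^ 3 * (Q ^ 2 * W + 96 * Q ^ 2 * W) := by
            gcongr
            exact one_le_mul_of_one_le_of_one_le (one_le_pow₀ hQ0) hW
        _ = 3395 * (Q ^ 5 * W) := by ring
        _ ≤ 3400 * (Q ^ 5 * W) := by gcongr; norm_num
        _ = _ := by ring
    have hT' : T = (600 * Q * K) ^ 2 * (l ^ 2 * T) := by
      rw [hl]; field_simp
    have hKc : K ^ (4 + 7 * (p + 1) + s * (p + 2)) =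
        K ^ 4 * (K ^ (p + 1)) ^ 7 * (K ^ (p + 2)) ^ s := by
      rw [Real.rpow_add hK0, Real.rpow_add hK0, mul_comm 7, mul_comm s, Real.rpow_mul hK0.le,
        Real.rpow_mul hK0.le]
      norm_cast
    have hQW : W ≤ (K ^ (p + 2)) ^ s := by
      refine Real.rpow_le_rpow (by positivity) ?_ (by linarith)
      rw [show p + 2 = 1 + (p + 1) by ring, Real.rpow_add hK0, Real.rpow_one]
      gcongr
      linarith
    rw [hT', hKc]
    calc (600 * Q * K) ^ 2 * (l ^ 2 * T) ≤ (600 * Q * K) ^ 2 * (3400 * Q ^ 5 * W) := by gcongr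
      _ = 1224000000 * K ^ 2 * Q ^ 7 * W := by ring
      _ ≤ K ^ 2 * K ^ 2 * (K ^ (p + 1)) ^ 7 * (K ^ (p + 2)) ^ s := by
          gcongr
          nlinarith
      _ = _ := by ring
  · have hgrow : C * K ^ 2 ≤ Q ^ (s - 1) := by
      calc C * K ^ 2 ≤ K * K ^ 2 := by gcongr; linarith
        _ = K ^ (3 : ℝ) := by norm_cast; ring
        _ = (K ^ p) ^ (s - 1) := by
            rw [← Real.rpow_mul hK0.le, hp, div_mul_cancel₀ _ hs1.ne']
        _ ≤ Q ^ (s - 1) := Real.rpow_le_rpow (by positivity) hQ1 hs1.le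
    have hQs : Q ^ s = Q * Q ^ (s - 1) := by
      rw [← Real.rpow_one_add' (by linarith) (by linarith)]; congr 1; ring
    have hsq : K ^ 2 * HsNormSq s (a 0) ≤ HsNormSq s (a T) := by
      refine le_trans ?_ hfinal
      calc K ^ 2 * HsNormSq s (a 0)
          ≤ K ^ 2 * (l ^ 2 * (300 * Q) * D ^ s * (4 ^ s + 1)) := by
            gcongr
            refine hinit.trans ?_
            gcongr
            exact hδW.trans_le hn48
        _ = l ^ 2 / 4 * D ^ s * Q / 4 ^ s * (C * K ^ 2) := by rw [hC]; field_simp; norm_num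
        _ ≤ l ^ 2 / 4 * D ^ s * Q / 4 ^ s * Q ^ (s - 1) := by gcongr
        _ = l ^ 2 / 4 * ((Q / 4) ^ s * D ^ s) := by
            rw [Real.div_rpow (by linarith) (by norm_num), hQs]; ring
    rw [HsNorm, HsNorm, ← Real.sqrt_eq_rpow, ← Real.sqrt_eq_rpow]
    refine Real.le_sqrt_of_sq_le ?_
    rwa [mul_pow, Real.sq_sqrt hpos.le]
  · rw [L2Norm, ← Real.sqrt_eq_rpow, Real.rpow_neg_one]
    refine Real.sqrt_le_iff.mpr ⟨by positivity, hmass.trans ?_⟩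
    calc l ^ 2 * (300 * Q) * (1 + 2 * n * δ) ≤ l ^ 2 * (300 * Q) * (1 + 1) := by
          gcongr; exact hδn.trans hn48
      _ = 1 / (600 * Q) * K⁻¹ ^ 2 := by rw [hl]; field_simp; norm_num
      _ ≤ 1 * K⁻¹ ^ 2 := by
          gcongr
          rw [div_le_one (by positivity)]; linarith
      _ = _ := one_mul _
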